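/- Let P be a projection complex which is δ₀-hyperbolic with its path metric, and let G be a group with a non-elementary WPD action on P. Then there exists a constant L_WPD(P, G) with the following property: if L ≥ L_WPD(P, G) and {R_v} is an equivariant L-spinning family of subgroups of G, then the quotient group G/⟨R_v⟩ is acylindrically hyperbolic. -/

import Mathlib

open Filter Set

/-- A projection complex in the sense of Bestvina–Bromberg–Fujiwara, as used by
Clay–Mangahas: a vertex set `Y` with projection distance functions `d v x z = d_v(x,z)`
(defined for `x, z ≠ v`; here recorded as total functions, with the axioms guarded by
the definedness conditions), together with a connected graph on `Y`, with its path
metric `graph.dist`, satisfying the bounded edge, path and geodesic image properties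
with constants `Ce`, `Cp`, `Cg`. -/
structure ProjComplex (Y : Type*) where
  theta : ℝ
  theta_nonneg : 0 ≤ theta
  d : Y → Y → Y → ℝ
  d_nonneg : ∀ v x z, 0 ≤ d v x z
  d_symm : ∀ v x z, x ≠ v → z ≠ v → d v x z = d v z x
  d_triangle : ∀ v x z w, x ≠ v → z ≠ v → w ≠ v → d v x w ≤ d v x z + d v z w
  d_triples : ∀ x y z, x ≠ y → y ≠ z → x ≠ z → min (d y x z) (d z x y) ≤ theta
  d_finite : ∀ x z, {y : Y | y ≠ x ∧ y ≠ z ∧ theta < d y x z}.Finite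
  graph : SimpleGraph Y
  connected : graph.Connected
  Ce : ℝ
  Cp : ℝ
  Cg : ℝ
  bounded_edge : ∀ x y z, x ≠ y → z ≠ y → graph.Adj x z → d y x z ≤ Ce
  bounded_path : ∀ (x z y : Y) (n : ℕ) (c : ℕ → Y), x ≠ y → z ≠ y →
    (∀ i < n, graph.Adj (c i) (c (i + 1))) → c 0 = x → c n = z →
    (∀ i ≤ n, 2 < graph.dist (c i) y) → d y x z ≤ Cp
  bounded_geodesic : ∀ (x z y : Y) (n : ℕ) (c : ℕ → Y), x ≠ y → z ≠ y →
    (∀ i < n, graph.Adj (c i) (c (i + 1))) → c 0 = x → c n = z →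
    graph.dist x z = n → (∀ i ≤ n, c i ≠ y) → d y x z ≤ Cg

/-- A group `G` acts on the projection complex `pc` if it acts on the vertex set by
graph automorphisms preserving the projection distances. -/
def PCAction {Y : Type*} (pc : ProjComplex Y) (G : Type*) [Group G] [MulAction G Y] : Prop :=
  (∀ (g : G) (x z : Y), pc.graph.Adj x z → pc.graph.Adj (g • x) (g • z)) ∧
  (∀ (g : G) (v x z : Y), pc.d (g • v) (g • x) (g • z) = pc.d v x z)

/-- `R` is an equivariant family of subgroups: each `R v` is contained in the stabilizer
of `v` and `g (R v) g⁻¹ = R (g v)` for all `g`. -/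
def IsEquivFamily {Y G : Type*} [Group G] [MulAction G Y] (R : Y → Subgroup G) : Prop :=
  (∀ (v : Y) (g : G), g ∈ R v → g • v = v) ∧
  (∀ (g : G) (v : Y) (h : G), h ∈ R v ↔ g * h * g⁻¹ ∈ R (g • v))

/-- The `L`-spinning condition: for distinct vertices `v, w` and nontrivial `h ∈ R v`,
`d_v(w, hw) ≥ L`. -/
def IsSpinning {Y G : Type*} [Group G] [MulAction G Y] (pc : ProjComplex Y)
    (R : Y → Subgroup G) (L : ℝ) : Prop :=
  ∀ v w : Y, v ≠ w → ∀ h : G, h ∈ R v → h ≠ 1 → L ≤ pc.d v w (h • w)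

/-- An equivariant `L`-spinning family of subgroups of `G`. -/
def IsEquivSpinningFamily {Y G : Type*} [Group G] [MulAction G Y] (pc : ProjComplex Y)
    (R : Y → Subgroup G) (L : ℝ) : Prop :=
  IsEquivFamily R ∧ IsSpinning pc R L

/-- The subgroup `H = ⟨R_v⟩` of `G` generated by the family `{R_v}`; for an equivariant
family this subgroup is normal, so we record it as a normal closure (to which it is
then equal) so that the quotient `G ⧸ H` carries its group structure. -/
def spinSubgroup {Y G : Type*} [Group G] [MulAction G Y] (R : Y → Subgroup G) : Subgroup G :=
  Subgroup.normalClosure (⋃ v : Y, (R v : Set G))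

instance spinSubgroup_normal {Y G : Type*} [Group G] [MulAction G Y] (R : Y → Subgroup G) :
    (spinSubgroup R).Normal :=
  Subgroup.normalClosure_normal

/-- `f` is a hyperbolic element for an action `act` of a group `Gp` on the vertices of a
graph `Γ` (with its path metric): the translation length `lim d(x, fⁿx)/n` exists and is
positive for some (equivalently, any) `x`. -/
def ActHyperbolic {V Gp : Type*} (Γ : SimpleGraph V) [Group Gp] (act : Gp → V → V)
    (f : Gp) : Prop :=
  ∃ x : V, ∃ l : ℝ, 0 < l ∧
    Filter.Tendsto (fun n : ℕ => (Γ.dist x (act (f ^ n) x) : ℝ) / n) Filter.atTop (nhds l)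

/-- `f` is a WPD element for the action `act` on the graph `Γ` (with its path metric). -/
def ActWPD {V Gp : Type*} (Γ : SimpleGraph V) [Group Gp] (act : Gp → V → V) (f : Gp) : Prop :=
  ActHyperbolic Γ act f ∧
  ∀ (x : V) (D : ℝ), 0 ≤ D → ∃ M : ℕ,
    {g : Gp | (Γ.dist x (act g x) : ℝ) ≤ D ∧
      (Γ.dist (act (f ^ M) x) (act g (act (f ^ M) x)) : ℝ) ≤ D}.Finite

/-- `f₁` and `f₂` are independent hyperbolic elements:
`d(f₁^{n₁} x, f₂^{n₂} x) → ∞` as `n₁, n₂ → ±∞`, for some (equivalently, any) `x`. -/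
def ActIndependent {V Gp : Type*} (Γ : SimpleGraph V) [Group Gp] (act : Gp → V → V)
    (f₁ f₂ : Gp) : Prop :=
  ActHyperbolic Γ act f₁ ∧ ActHyperbolic Γ act f₂ ∧
  ∃ x : V, ∀ C : ℝ, ∃ N : ℕ, ∀ m n : ℤ, N ≤ m.natAbs → N ≤ n.natAbs →
    C ≤ (Γ.dist (act (f₁ ^ m) x) (act (f₂ ^ n) x) : ℝ)

/-- A non-elementary WPD action: there are two independent WPD elements. -/
def ActNonelementaryWPD {V Gp : Type*} (Γ : SimpleGraph V) [Group Gp]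
    (act : Gp → V → V) : Prop :=
  ∃ f₁ f₂ : Gp, ActWPD Γ act f₁ ∧ ActWPD Γ act f₂ ∧ ActIndependent Γ act f₁ f₂

/-- A (combinatorial, 1-Lipschitz) path in a graph, recorded on the interval `[a,b]`:
at each step it stays put or crosses an edge. -/
def IsPathOn {V : Type*} (Γ : SimpleGraph V) (c : ℕ → V) (a b : ℕ) : Prop :=
  ∀ i, a ≤ i → i < b → c i = c (i + 1) ∨ Γ.Adj (c i) (c (i + 1))

/-- A geodesic in a graph (for the path metric), recorded on the interval `[a,b]`. -/
def IsGeodesicOn {V : Type*} (Γ : SimpleGraph V) (c : ℕ → V) (a b : ℕ) : Prop :=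
  IsPathOn Γ c a b ∧ ∀ i j, a ≤ i → i ≤ j → j ≤ b → Γ.dist (c i) (c j) = j - i

/-- `δ`-hyperbolicity of a graph with its path metric: every geodesic triangle is
`δ`-thin, i.e. each side lies in the `δ`-neighborhood of the union of the other two. -/
def GraphDeltaHyperbolic {V : Type*} (Γ : SimpleGraph V) (δ : ℝ) : Prop :=
  ∀ (n₀ n₁ n₂ : ℕ) (c₀ c₁ c₂ : ℕ → V),
    IsGeodesicOn Γ c₀ 0 n₀ → IsGeodesicOn Γ c₁ 0 n₁ → IsGeodesicOn Γ c₂ 0 n₂ →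
    c₀ n₀ = c₁ 0 → c₁ n₁ = c₂ 0 → c₂ n₂ = c₀ 0 →
    ∀ i ≤ n₀, ∃ j, (j ≤ n₁ ∧ (Γ.dist (c₀ i) (c₁ j) : ℝ) ≤ δ) ∨
      (j ≤ n₂ ∧ (Γ.dist (c₀ i) (c₂ j) : ℝ) ≤ δ)

/-- A group is virtually cyclic if it has a cyclic subgroup of finite index. -/
def VirtuallyCyclic (Gp : Type*) [Group Gp] : Prop :=
  ∃ K : Subgroup Gp, K.FiniteIndex ∧ IsCyclic K

/-- `γ` is a (unit-speed) geodesic segment from `x` to `y` in a metric space. -/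
def IsGeodSegment {X : Type*} [MetricSpace X] (γ : ℝ → X) (x y : X) : Prop :=
  γ 0 = x ∧ γ (dist x y) = y ∧
  ∀ s ∈ Set.Icc (0 : ℝ) (dist x y), ∀ t ∈ Set.Icc (0 : ℝ) (dist x y),
    dist (γ s) (γ t) = |s - t|

/-- A geodesic metric space: any two points are joined by a geodesic segment. -/
def GeodesicSpace (X : Type*) [MetricSpace X] : Prop :=
  ∀ x y : X, ∃ γ : ℝ → X, IsGeodSegment γ x y

/-- `δ`-hyperbolicity of a metric space: every geodesic triangle is `δ`-thin, i.e.
each side lies in the `δ`-neighborhood of the union of the other two. -/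
def MetricDeltaHyperbolic (X : Type*) [MetricSpace X] (δ : ℝ) : Prop :=
  ∀ (x y z : X) (γ₀ γ₁ γ₂ : ℝ → X),
    IsGeodSegment γ₀ x y → IsGeodSegment γ₁ y z → IsGeodSegment γ₂ z x →
    ∀ s ∈ Set.Icc (0 : ℝ) (dist x y), ∃ p : X,
      ((∃ t ∈ Set.Icc (0 : ℝ) (dist y z), p = γ₁ t) ∨
        (∃ t ∈ Set.Icc (0 : ℝ) (dist z x), p = γ₂ t)) ∧ dist (γ₀ s) p ≤ δ

/-- `act` is an action of the group `Gp` on `X` by isometries. -/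
def IsometricAction {Gp X : Type*} [Group Gp] [MetricSpace X] (act : Gp → X → X) : Prop :=
  (∀ x : X, act 1 x = x) ∧ (∀ (g g' : Gp) (x : X), act (g * g') x = act g (act g' x)) ∧
  (∀ (g : Gp) (x y : X), dist (act g x) (act g y) = dist x y)

/-- `f` is a hyperbolic element for the action `act` on the metric space `X`. -/
def MetricActHyperbolic {Gp X : Type*} [Group Gp] [MetricSpace X] (act : Gp → X → X)
    (f : Gp) : Prop :=
  ∃ x : X, ∃ l : ℝ, 0 < l ∧
    Filter.Tendsto (fun n : ℕ => dist x (act (f ^ n) x) / n) Filter.atTop (nhds l)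

/-- The action `act` is acylindrical: for all `D ≥ 0` there are `R ≥ 0` and `N` such
that for all `x, y` at distance at least `R`, at most `N` elements `g` move both `x`
and `y` by at most `D`. -/
def MetricActAcylindrical {Gp X : Type*} [Group Gp] [MetricSpace X]
    (act : Gp → X → X) : Prop :=
  ∀ D : ℝ, 0 ≤ D → ∃ (Rc : ℝ) (N : ℕ), 0 ≤ Rc ∧ ∀ x y : X, Rc ≤ dist x y →
    {g : Gp | dist x (act g x) ≤ D ∧ dist y (act g y) ≤ D}.Finite ∧
    {g : Gp | dist x (act g x) ≤ D ∧ dist y (act g y) ≤ D}.ncard ≤ N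

/-- A group is acylindrically hyperbolic if it is not virtually cyclic and admits an
acylindrical isometric action on a `δ`-hyperbolic geodesic metric space with a
hyperbolic element. -/
def IsAcylindricallyHyperbolic.{v} (Gp : Type*) [Group Gp] : Prop :=
  ¬ VirtuallyCyclic Gp ∧
  ∃ (X : Type v) (mX : MetricSpace X) (act : Gp → X → X) (δ : ℝ), 0 ≤ δ ∧
    @IsometricAction Gp X _ mX act ∧ @GeodesicSpace X mX ∧
    @MetricDeltaHyperbolic X mX δ ∧ @MetricActAcylindrical Gp X _ mX act ∧
    ∃ f : Gp, @MetricActHyperbolic Gp X _ mX act f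

section
set_option autoImplicit false
set_option linter.unusedSectionVars false
namespace SpinQuot

/-- A single constant controlling all the bounds of a projection complex. -/
structure PCBound {Y : Type*} (pc : ProjComplex Y) (Θ : ℝ) : Prop where
  pos : 1 ≤ Θ
  triple : ∀ x y z, x ≠ y → y ≠ z → x ≠ z → pc.d y x z ≤ Θ ∨ pc.d z x y ≤ Θ
  adj : ∀ v x z, x ≠ v → z ≠ v → pc.graph.Adj x z → pc.d v x z ≤ Θ
  geod : ∀ v x z, x ≠ v → z ≠ v →
    pc.graph.dist x v + pc.graph.dist v z ≠ pc.graph.dist x z → pc.d v x z ≤ Θ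
  path : ∀ v x z, ∀ p : pc.graph.Walk x z,
    (∀ w ∈ p.support, 2 < pc.graph.dist w v) → pc.d v x z ≤ Θ
  fin : ∀ x z, {v : Y | v ≠ x ∧ v ≠ z ∧ Θ < pc.d v x z}.Finite

theorem PCBound.self {Y : Type*} {pc : ProjComplex Y} {Θ : ℝ} (h : PCBound pc Θ)
    {v x : Y} (hx : x ≠ v) : pc.d v x x ≤ Θ := by
  apply h.geod v x x hx hx
  have := (pc.connected.dist_eq_zero_iff (u := x) (v := v)).not.2 hx
  simp only [SimpleGraph.dist_self]
  omega

theorem exists_pcBound {Y : Type*} (pc : ProjComplex Y) : ∃ Θ : ℝ, PCBound pc Θ := by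
  refine ⟨max 1 (max pc.theta (max pc.Ce (max pc.Cp pc.Cg))), ⟨by simp, ?_, ?_, ?_, ?_, ?_⟩⟩
  · intro x y z h1 h2 h3
    have := pc.d_triples x y z h1 h2 h3
    rcases min_le_iff.1 this with h | h
    · left; exact h.trans (by simp)
    · right; exact h.trans (by simp)
  · intro v x z h1 h2 h3
    exact (pc.bounded_edge x v z h1 h2 h3).trans (by simp)
  · intro v x z h1 h2 h3
    obtain ⟨p, hp⟩ := pc.connected.exists_walk_length_eq_dist x z
    refine (pc.bounded_geodesic x z v p.length p.getVert h1 h2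
      (fun i hi => p.adj_getVert_succ hi) (by simp) (by simp) hp.symm ?_).trans (by simp)
    intro i hi hiv
    apply h3
    have e1 : pc.graph.dist x v ≤ i := by
      rw [← hiv]
      refine (SimpleGraph.dist_le (p.take i)).trans ?_
      simp [SimpleGraph.Walk.take_length]
    have e2 : pc.graph.dist v z ≤ p.length - i := by
      rw [← hiv]
      refine (SimpleGraph.dist_le (p.drop i)).trans ?_
      simp [SimpleGraph.Walk.drop_length]
    have := pc.connected.dist_triangle (u := x) (v := v) (w := z)
    omega
  · intro v x z p hp
    have hx := hp x p.start_mem_support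
    have hz := hp z p.end_mem_support
    refine (pc.bounded_path x z v p.length p.getVert ?_ ?_
      (fun i hi => p.adj_getVert_succ hi) (by simp) (by simp) ?_).trans (by simp)
    · rintro rfl; simp at hx
    · rintro rfl; simp at hz
    · intro i hi
      exact hp _ (p.getVert_mem_support i)
  · intro x z
    refine (pc.d_finite x z).subset ?_
    rintro v ⟨h1, h2, h3⟩
    exact ⟨h1, h2, lt_of_le_of_lt (by simp) h3⟩

section windmill

variable {Y G : Type*} [Group G] [MulAction G Y]

/-- `Red pc R K x y`: the point `y` can be brought to `x` by finitely many rotations about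
vertices `v` at which the projection distance `d_v(x, y)` is at least `K`. -/
inductive Red (pc : ProjComplex Y) (R : Y → Subgroup G) (K : ℝ) (x : Y) : Y → Prop
  | refl : Red pc R K x x
  | step {y v : Y} {r : G} : v ≠ x → v ≠ y → K ≤ pc.d v x y → r ∈ R v →
      Red pc R K x (r • y) → Red pc R K x y

/-- Bent paths starting at `a` with first vertex `w` and endpoint `z`. -/
inductive Bent (R : Y → Subgroup G) (bd B β : Set Y) : Y → Y → Y → Prop
  | base {a b : Y} : a ∈ B → b ∈ β → a ≠ b → Bent R bd B β a b b
  | turn {a v w z : Y} {r : G} : a ∈ B → v ∈ bd → a ≠ v → r ∈ R v → r ≠ 1 →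
      Bent R bd B β v w z → Bent R bd B β a v (r • z)

/-- Endpoints of bent paths. -/
def BentEnd (R : Y → Subgroup G) (bd B β : Set Y) (z : Y) : Prop :=
  z ∈ β ∨ ∃ v r w z', v ∈ bd ∧ r ∈ R v ∧ r ≠ 1 ∧ Bent R bd B β v w z' ∧ z = r • z'

theorem Bent.bentEnd {R : Y → Subgroup G} {bd B β : Set Y} {a w z : Y}
    (h : Bent R bd B β a w z) : BentEnd R bd B β z := by
  cases h with
  | base _ h _ => exact Or.inl h
  | turn _ hv _ hr h1 h => exact Or.inr ⟨_, _, _, _, hv, hr, h1, h, rfl⟩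

theorem Bent.smul {R : Y → Subgroup G} (hR : IsEquivFamily R) {bd B β : Set Y} {n : G}
    (hbd : ∀ y ∈ bd, n • y ∈ bd) (hB : ∀ y ∈ B, n • y ∈ B) (hβ : ∀ y ∈ β, n • y ∈ β)
    {a w z : Y} (h : Bent R bd B β a w z) : Bent R bd B β (n • a) (n • w) (n • z) := by
  induction h with
  | base ha hb hab => exact .base (hB _ ha) (hβ _ hb) (by simpa using hab)
  | @turn a v w z r ha hv hav hr h1 h ih =>
    have := Bent.turn (hB _ ha) (hbd _ hv) (by simpa using hav) ((hR.2 n v r).1 hr)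
      (by simpa using h1) ih
    simpa [mul_smul] using this

theorem BentEnd.smul {R : Y → Subgroup G} (hR : IsEquivFamily R) {bd B β : Set Y} {n : G}
    (hbd : ∀ y ∈ bd, n • y ∈ bd) (hB : ∀ y ∈ B, n • y ∈ B) (hβ : ∀ y ∈ β, n • y ∈ β)
    {z : Y} (h : BentEnd R bd B β z) : BentEnd R bd B β (n • z) := by
  rcases h with h | ⟨v, r, w, z', hv, hr, h1, h, rfl⟩
  · exact Or.inl (hβ _ h)
  · refine Or.inr ⟨n • v, n * r * n⁻¹, n • w, n • z', hbd _ hv, (hR.2 n v r).1 hr,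
      by simpa using h1, h.smul hR hbd hB hβ, by simp [mul_smul]⟩

theorem BentEnd.rotate {R : Y → Subgroup G} (hR : IsEquivFamily R) {bd B β : Set Y}
    (hbB : bd ⊆ B) {z v : Y} {s : G} (hv : v ∈ bd) (hs : s ∈ R v)
    (h : BentEnd R bd B β z) : BentEnd R bd B β (s • z) := by
  by_cases hs1 : s = 1
  · simpa [hs1] using h
  rcases h with h | ⟨u, r, w, z', hu, hr, h1, h, rfl⟩
  · by_cases hzv : z = v
    · subst hzv
      rw [hR.1 z s hs]
      exact Or.inl h
    · exact Or.inr ⟨v, s, z, z, hv, hs, hs1, .base (hbB hv) h (Ne.symm hzv), rfl⟩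
  · by_cases huv : u = v
    · subst huv
      by_cases hsr : s * r = 1
      · rw [← mul_smul, hsr, one_smul]
        exact h.bentEnd
      · exact Or.inr ⟨u, s * r, w, z', hu, mul_mem hs hr, hsr, h, by rw [mul_smul]⟩
    · exact Or.inr ⟨v, s, u, r • z', hv, hs, hs1,
        .turn (hbB hv) hu (Ne.symm huv) hr h1 h, rfl⟩

/-- The subgroup generated by `N` and the rotations about the vertices in `bd`. -/
def growGroup (R : Y → Subgroup G) (N : Subgroup G) (bd : Set Y) : Subgroup G :=
  Subgroup.closure ((N : Set G) ∪ {r | ∃ v ∈ bd, r ∈ R v})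

theorem growGroup_induction {R : Y → Subgroup G} {N : Subgroup G} {bd : Set Y}
    {p : G → Prop} (hN : ∀ n ∈ N, p n) (hr : ∀ v ∈ bd, ∀ r ∈ R v, p r) (h1 : p 1)
    (hmul : ∀ a b, a ∈ growGroup R N bd → p a → p b → p (a * b))
    (hinv : ∀ a, a ∈ growGroup R N bd → p a → p a⁻¹)
    {g : G} (hg : g ∈ growGroup R N bd) : p g := by
  refine Subgroup.closure_induction (p := fun g _ => p g) ?_ h1 ?_ ?_ hg
  · rintro x (hx | ⟨v, hv, hx⟩)
    · exact hN _ hx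
    · exact hr v hv _ hx
  · exact fun x y hx _ => hmul x y hx
  · exact fun x hx => hinv x hx

theorem le_growGroup {R : Y → Subgroup G} {N : Subgroup G} {bd : Set Y} {n : G} (hn : n ∈ N) :
    n ∈ growGroup R N bd := Subgroup.subset_closure (Or.inl hn)

theorem mem_growGroup {R : Y → Subgroup G} {N : Subgroup G} {bd : Set Y} {v : Y} (hv : v ∈ bd)
    {r : G} (hr : r ∈ R v) : r ∈ growGroup R N bd := Subgroup.subset_closure (Or.inr ⟨v, hv, hr⟩)

theorem BentEnd.grow {R : Y → Subgroup G} (hR : IsEquivFamily R) {bd B β : Set Y}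
    (hbB : bd ⊆ B) {N : Subgroup G}
    (hbd : ∀ n ∈ N, ∀ y ∈ bd, n • y ∈ bd) (hB : ∀ n ∈ N, ∀ y ∈ B, n • y ∈ B)
    (hβ : ∀ n ∈ N, ∀ y ∈ β, n • y ∈ β)
    {n : G} (hn : n ∈ growGroup R N bd) :
    ∀ z, BentEnd R bd B β (n • z) ↔ BentEnd R bd B β z := by
  have key : ∀ K : Subgroup G, (∀ k ∈ K, ∀ z, BentEnd R bd B β z → BentEnd R bd B β (k • z)) →
      ∀ k ∈ K, ∀ z, (BentEnd R bd B β (k • z) ↔ BentEnd R bd B β z) := by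
    intro K hK k hk z
    refine ⟨fun h => ?_, hK k hk z⟩
    simpa using hK k⁻¹ (inv_mem hk) _ h
  refine growGroup_induction (p := fun n => ∀ z, BentEnd R bd B β (n • z) ↔ BentEnd R bd B β z)
    ?_ ?_ ?_ ?_ ?_ hn
  · exact key N fun k hk z h => h.smul hR (hbd k hk) (hB k hk) (hβ k hk)
  · exact fun v hv => key (R v) fun k hk z h => h.rotate hR hbB hv hk
  · simp
  · intro a b _ ha hb z
    rw [mul_smul, ha, hb]
  · intro a _ ha z
    rw [← ha, smul_inv_smul]

variable {pc : ProjComplex Y} {Θ L M : ℝ} {R : Y → Subgroup G}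

theorem Bent.props (hb : PCBound pc Θ) (hact : PCAction pc G)
    (hR : IsEquivSpinningFamily pc R L) {bd B β : Set Y} (hbB : bd ⊆ B) (hβB : β ⊆ B)
    (hM : ∀ u ∈ bd, ∀ a ∈ B, ∀ b ∈ B, a ≠ u → b ≠ u → pc.d u a b ≤ M)
    (hL : M + 2 * Θ < L) {a w z : Y} (h : Bent R bd B β a w z) :
    a ∈ B ∧ w ∈ B ∧ a ≠ w ∧ z ≠ a ∧ (z = w ∨ (z ≠ w ∧ w ∈ bd ∧ L - M - Θ ≤ pc.d w a z)) ∧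
      (z = w ∨ pc.d a w z ≤ Θ) := by
  have hpos := hb.pos
  induction h with
  | base ha hb' hab =>
    exact ⟨ha, hβB hb', hab, hab.symm, Or.inl rfl, Or.inl rfl⟩
  | @turn a v w z r ha hv hav hr h1 h ih =>
    obtain ⟨-, hw, hvw, hzv, -, h6⟩ := ih
    have hrv := hR.1.1 v r hr
    have hne : ∀ y, y ≠ v → r • y ≠ v := fun y hy e => hy (by
      rw [← hrv] at e; exact smul_left_cancel r e)
    have hrz := hne z hzv
    have hwv := hvw.symm
    have e1 : pc.d v (r • w) (r • z) ≤ Θ := by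
      have : pc.d v (r • w) (r • z) = pc.d v w z := by
        conv_lhs => rw [← hrv]
        exact hact.2 r v w z
      rw [this]
      rcases h6 with rfl | h6
      · exact hb.self hzv
      · exact h6
    have e2 := hR.2 v w hvw r hr h1
    have e3 := hM v hv a ha w hw hav hwv
    have e4 := pc.d_triangle v w a (r • w) hwv hav (hne w hwv)
    have e5 := pc.d_triangle v a (r • z) (r • w) hav hrz (hne w hwv)
    have e6 := pc.d_symm v w a hwv hav
    have e7 := pc.d_symm v (r • w) (r • z) (hne w hwv) hrz
    have e8 : L - M - Θ ≤ pc.d v a (r • z) := by linarith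
    have e9 : r • z ≠ a := by
      intro e
      rw [e] at e8
      have := hb.self hav
      linarith
    refine ⟨ha, hbB hv, hav, e9, Or.inr ⟨hrz, hv, e8⟩, Or.inr ?_⟩
    rcases hb.triple (r • z) v a hrz hav.symm e9 with h | h
    · rw [pc.d_symm v _ _ hrz hav] at h
      linarith
    · rwa [pc.d_symm a _ _ hav.symm e9]

theorem Bent.red (hb : PCBound pc Θ) (hact : PCAction pc G)
    (hR : IsEquivSpinningFamily pc R L) {bd B β : Set Y} (hbB : bd ⊆ B) (hβB : β ⊆ B)
    (hM : ∀ u ∈ bd, ∀ a ∈ B, ∀ b ∈ B, a ≠ u → b ≠ u → pc.d u a b ≤ M)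
    (hL : M + 2 * Θ < L) {x : Y} (hxB : x ∈ B) (hxbd : x ∉ bd)
    (hβ : ∀ b ∈ β, Red pc R (L - M - Θ) x b)
    {a w z : Y} (h : Bent R bd B β a w z) : Red pc R (L - M - Θ) x z := by
  induction h with
  | base _ hb' _ => exact hβ _ hb'
  | @turn a v w z r ha hv hav hr h1 h ih =>
    have hvx : v ≠ x := fun e => hxbd (e ▸ hv)
    have hp := (Bent.turn hxB hv hvx.symm hr h1 h).props hb hact hR hbB hβB hM hL
    have hzv := (h.props hb hact hR hbB hβB hM hL).2.2.2.1
    have hne : r • z ≠ v := fun e => hzv (by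
      rw [← hR.1.1 v r hr] at e; exact smul_left_cancel r e)
    rcases hp.2.2.2.2.1 with h' | h'
    · exact absurd h' hne
    · exact .step (r := r⁻¹) hvx hne.symm h'.2.2 (inv_mem hr) (by simpa using ih)

theorem Bent.bound (hb : PCBound pc Θ) (hact : PCAction pc G)
    (hR : IsEquivSpinningFamily pc R L) {bd B : Set Y} (hbB : bd ⊆ B)
    (hM : ∀ u ∈ bd, ∀ a ∈ B, ∀ b ∈ B, a ≠ u → b ≠ u → pc.d u a b ≤ M)
    (hL : M + 6 * Θ < L) {N : Subgroup G} {U : Set Y} {D : ℝ} (hBU : B ⊆ U)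
    (hU : ∀ n ∈ growGroup R N bd, ∀ y ∈ U, n • y ∈ U)
    (hD : ∀ v, v ∉ U → ∀ a ∈ B, ∀ b ∈ B, pc.d v a b ≤ D)
    {c w z : Y} (h : Bent R bd B B c w z) :
    z ∈ U ∧ ∀ v, v ∉ U → ∀ a ∈ U, a ≠ w → pc.d w a c ≤ Θ → pc.d v a c ≤ Θ →
      pc.d v a z ≤ D + 2 * Θ := by
  have hpos := hb.pos
  have neU : ∀ {p v : Y}, p ∈ U → v ∉ U → p ≠ v := fun hp hv e => hv (e ▸ hp)
  induction h with
  | @base c b hc hb' hab =>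
    refine ⟨hBU hb', ?_⟩
    intro v hv a ha haw h1 h2
    have := pc.d_triangle v a c b (neU ha hv) (neU (hBU hc) hv) (neU (hBU hb') hv)
    have := hD v hv c hc b hb'
    linarith
  | @turn c u w z r hc hu hcu hr h1 h ih =>
    obtain ⟨hzU, ih⟩ := ih
    have hrg : r ∈ growGroup R N bd := mem_growGroup hu hr
    have hrzU := hU r hrg z hzU
    refine ⟨hrzU, ?_⟩
    intro v hv a ha hau h3 h4
    have hp := (Bent.turn hc hu hcu hr h1 h).props hb hact hR hbB subset_rfl hM (by linarith)
    obtain ⟨-, hwB, huw, hzu, -, h6⟩ := h.props hb hact hR hbB subset_rfl hM (by linarith)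
    have hru := hR.1.1 u r hr
    have hrz : r • z ≠ u := fun e => hzu (by
      rw [← hru] at e; exact smul_left_cancel r e)
    have e1 : L - M - Θ ≤ pc.d u c (r • z) := by
      rcases hp.2.2.2.2.1 with h' | h'
      · exact absurd h' hrz
      · exact h'.2.2
    have huU := hBU (hbB hu)
    have huv := neU huU hv
    have e2 := pc.d_triangle u c a (r • z) hcu hau hrz
    have e3 := pc.d_symm u c a hcu hau
    have e4 := pc.d_triangle u a v (r • z) hau huv.symm hrz
    have hav := neU ha hv
    have hcv := neU (hBU hc) hv
    have hrzv := neU hrzU hv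
    by_cases hcase : Θ < pc.d u v (r • z)
    · have e5 : pc.d v u (r • z) ≤ Θ := by
        rcases hb.triple (r • z) u v hrz huv hrzv with h' | h'
        · rw [pc.d_symm u _ _ hrz huv.symm] at h'
          linarith
        · rwa [pc.d_symm v _ _ huv hrzv]
      have e6 := hD v hv c hc u (hbB hu)
      have e7 := pc.d_triangle v a c (r • z) hav hcv hrzv
      have e8 := pc.d_triangle v c u (r • z) hcv huv hrzv
      linarith
    · have e5 : pc.d v a u ≤ Θ := by
        rcases hb.triple a u v hau huv hav with h' | h'
        · linarith
        · exact h'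
      have hru' : r⁻¹ • u = u := by rw [inv_smul_eq_iff, hru]
      have hri : r⁻¹ ∈ growGroup R N bd := inv_mem hrg
      have hv' : r⁻¹ • v ∉ U := fun h' => hv (by simpa using hU r hrg _ h')
      have key : pc.d (r⁻¹ • v) (r⁻¹ • a) z = pc.d v a (r • z) := by
        have := hact.2 r (r⁻¹ • v) (r⁻¹ • a) z
        simpa using this.symm
      have k2 : pc.d u (r⁻¹ • a) z = pc.d u a (r • z) := by
        have := hact.2 r u (r⁻¹ • a) z
        rw [hru] at this
        simpa using this.symm
      have hau' : r⁻¹ • a ≠ u := fun e => hau (by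
        rw [← hru'] at e; exact smul_left_cancel _ e)
      have e6 : pc.d u w z ≤ Θ := by
        rcases h6 with rfl | h6
        · exact hb.self hzu
        · exact h6
      have e7 := pc.d_triangle u (r⁻¹ • a) w z hau' huw.symm hzu
      have e8 : Θ < pc.d u (r⁻¹ • a) w := by linarith
      have e9 : r⁻¹ • a ≠ w := by
        intro e
        rw [e] at e8
        have := hb.self huw.symm
        linarith
      rw [← key]
      refine ih (r⁻¹ • v) hv' (r⁻¹ • a) (hU _ hri _ ha) e9 ?_ ?_
      · rcases hb.triple (r⁻¹ • a) u w hau' huw e9 with h' | h'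
        · linarith
        · exact h'
      · have := hact.2 r⁻¹ v a u
        rw [hru'] at this
        linarith

end windmill

section windmill
variable {Y G : Type*} [Group G] [MulAction G Y] 
variable {pc : ProjComplex Y} {Θ L : ℝ} {R : Y → Subgroup G}

/-- The vertices adjacent to `W` but not in it. -/
def outer (pc : ProjComplex Y) (W : Set Y) : Set Y := {v | v ∉ W ∧ ∃ w ∈ W, pc.graph.Adj v w}

/-- The closed neighbourhood of `W`. -/
def nbhd (pc : ProjComplex Y) (W : Set Y) : Set Y := W ∪ outer pc W

/-- Connectedness inside `W`. -/
def Joined (pc : ProjComplex Y) (W : Set Y) (a b : Y) : Prop :=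
  Relation.ReflTransGen (fun a b => pc.graph.Adj a b ∧ a ∈ W ∧ b ∈ W) a b

theorem Joined.symm {W : Set Y} {a b : Y} (h : Joined pc W a b) : Joined pc W b a := by
  induction h with
  | refl => exact .refl
  | tail _ h ih => exact Relation.ReflTransGen.head ⟨h.1.symm, h.2.2, h.2.1⟩ ih

theorem Joined.mono {W W' : Set Y} (hW : W ⊆ W') {a b : Y} (h : Joined pc W a b) :
    Joined pc W' a b :=
  Relation.ReflTransGen.mono (fun _ _ h => ⟨h.1, hW h.2.1, hW h.2.2⟩) _ _ h

theorem Joined.smul (hact : PCAction pc G) {W : Set Y} {g : G} (hg : ∀ w ∈ W, g • w ∈ W)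
    {a b : Y} (h : Joined pc W a b) : Joined pc W (g • a) (g • b) := by
  induction h with
  | refl => exact .refl
  | tail _ h ih => exact ih.tail ⟨hact.1 g _ _ h.1, hg _ h.2.1, hg _ h.2.2⟩

theorem Joined.walk {W : Set Y} {a b : Y} (ha : a ∈ W) (h : Joined pc W a b) :
    ∃ p : pc.graph.Walk a b, ∀ v ∈ p.support, v ∈ W := by
  induction h with
  | refl => exact ⟨.nil, by simpa using ha⟩
  | tail _ h ih =>
    obtain ⟨p, hp⟩ := ih
    refine ⟨p.concat h.1, ?_⟩
    intro v hv
    rw [SimpleGraph.Walk.support_concat] at hv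
    simp only [List.mem_append, List.mem_singleton] at hv
    rcases hv with hv | rfl
    · exact hp v hv
    · exact h.2.2

/-- The invariants of a windmill based at `x`. -/
structure Windmill (pc : ProjComplex Y) (Θ L : ℝ) (R : Y → Subgroup G) (x : Y) (W : Set Y)
    (N : Subgroup G) : Prop where
  base : x ∈ W
  conn : ∀ a ∈ W, Joined pc W a x
  inv : ∀ n ∈ N, ∀ w ∈ W, n • w ∈ W
  rot : ∀ v ∈ W, R v ≤ N
  far0 : ∀ v, v ∉ W → ∀ a ∈ W, ∀ b ∈ W, pc.d v a b ≤ 9 * Θ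
  far1 : ∀ v, v ∉ nbhd pc W → ∀ a ∈ W, ∀ b ∈ W, pc.d v a b ≤ 5 * Θ
  red : ∀ n ∈ N, Red pc R (L - 12 * Θ) x (n • x)

theorem Windmill.init (hb : PCBound pc Θ) (hR : IsEquivSpinningFamily pc R L) (x : Y) :
    Windmill pc Θ L R x {x} (R x) := by
  have hpos := hb.pos
  refine ⟨rfl, ?_, ?_, ?_, ?_, ?_, ?_⟩
  · rintro a rfl
    exact .refl
  · rintro n hn w rfl
    exact hR.1.1 _ n hn
  · rintro v rfl
    exact le_rfl
  · rintro v hv a rfl b rfl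
    have := hb.self (v := v) (x := b) (fun e => hv e.symm)
    linarith
  · rintro v hv a rfl b rfl
    have := hb.self (v := v) (x := b) (fun e => hv (Or.inl e.symm))
    linarith
  · intro n hn
    rw [hR.1.1 _ n hn]
    exact .refl

theorem Windmill.step (hb : PCBound pc Θ) (hact : PCAction pc G)
    (hR : IsEquivSpinningFamily pc R L) (hL : 20 * Θ ≤ L) {x : Y} {W : Set Y} {N : Subgroup G}
    (h : Windmill pc Θ L R x W N) :
    ∃ W' N', Windmill pc Θ L R x W' N' ∧ nbhd pc W ⊆ W' ∧ N ≤ N' := by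
  have hpos := hb.pos
  set bd := outer pc W with hbd
  set B := nbhd pc W with hB
  set N' := growGroup R N bd with hN'
  set W' : Set Y := {y | ∃ n ∈ N', ∃ b ∈ B, y = n • b} with hW'
  have hbB : bd ⊆ B := fun _ h => Or.inr h
  have hWB : W ⊆ B := fun _ h => Or.inl h
  have hBW' : B ⊆ W' := fun b hb => ⟨1, one_mem _, b, hb, by simp⟩
  have hinvW : ∀ n ∈ N, ∀ y, n • y ∈ W ↔ y ∈ W := fun n hn y =>
    ⟨fun hy => by simpa using h.inv n⁻¹ (inv_mem hn) _ hy, h.inv n hn y⟩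
  have hNbd : ∀ n ∈ N, ∀ y ∈ bd, n • y ∈ bd := by
    rintro n hn y ⟨h1, w, hw, h2⟩
    exact ⟨fun h' => h1 ((hinvW n hn y).1 h'), n • w, h.inv n hn w hw, hact.1 n _ _ h2⟩
  have hNB : ∀ n ∈ N, ∀ y ∈ B, n • y ∈ B := by
    rintro n hn y (hy | hy)
    · exact Or.inl (h.inv n hn y hy)
    · exact Or.inr (hNbd n hn y hy)
  have hinv' : ∀ n ∈ N', ∀ y ∈ W', n • y ∈ W' := by
    rintro n hn y ⟨m, hm, b, hb', rfl⟩
    exact ⟨n * m, mul_mem hn hm, b, hb', by rw [mul_smul]⟩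
  have nbound : ∀ v, ∀ D, v ∉ B → (∀ a ∈ W, ∀ b ∈ W, pc.d v a b ≤ D) →
      ∀ a ∈ B, ∀ b ∈ B, pc.d v a b ≤ D + 2 * Θ := by
    intro v D hv hD
    have key : ∀ a ∈ B, ∃ a' ∈ W, pc.d v a a' ≤ Θ := by
      rintro a (ha | ⟨h1, w, hw, haw⟩)
      · exact ⟨a, ha, hb.self (fun e => hv (e ▸ hWB ha))⟩
      · exact ⟨w, hw, hb.adj v a w (fun e => hv (e ▸ hbB ⟨h1, w, hw, haw⟩))
          (fun e => hv (e ▸ hWB hw)) haw⟩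
    intro a ha b hb'
    obtain ⟨a', ha', h1⟩ := key a ha
    obtain ⟨b', hb'', h2⟩ := key b hb'
    have ne : ∀ y ∈ B, y ≠ v := fun y hy e => hv (e ▸ hy)
    have e1 := pc.d_triangle v a a' b (ne _ ha) (ne _ (hWB ha')) (ne _ hb')
    have e2 := pc.d_triangle v a' b' b (ne _ (hWB ha')) (ne _ (hWB hb'')) (ne _ hb')
    have e3 := pc.d_symm v b b' (ne _ hb') (ne _ (hWB hb''))
    have e4 := hD a' ha' b' hb''
    linarith
  have hM : ∀ u ∈ bd, ∀ a ∈ B, ∀ b ∈ B, a ≠ u → b ≠ u → pc.d u a b ≤ 11 * Θ := by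
    intro u hu
    have key : ∀ a ∈ B, a ≠ u → ∃ a' ∈ W, pc.d u a a' ≤ Θ := by
      rintro a (ha | ⟨-, w, hw, haw⟩) hau
      · exact ⟨a, ha, hb.self hau⟩
      · exact ⟨w, hw, hb.adj u a w hau (fun e => hu.1 (e ▸ hw)) haw⟩
    intro a ha b hb' hau hbu
    obtain ⟨a', ha', h1⟩ := key a ha hau
    obtain ⟨b', hb'', h2⟩ := key b hb' hbu
    have ne : ∀ y ∈ W, y ≠ u := fun y hy e => hu.1 (e ▸ hy)
    have e1 := pc.d_triangle u a a' b hau (ne _ ha') hbu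
    have e2 := pc.d_triangle u a' b' b (ne _ ha') (ne _ hb'') hbu
    have e3 := pc.d_symm u b b' hbu (ne _ hb'')
    have e4 := h.far0 u hu.1 a' ha' b' hb''
    linarith
  have hxB : x ∈ B := hWB h.base
  have hxbd : x ∉ bd := fun h' => h'.1 h.base
  have gen : ∀ (U : Set Y) (D : ℝ), W' ⊆ U → (∀ n ∈ N', ∀ y ∈ U, n • y ∈ U) →
      (∀ v, v ∉ U → ∀ a ∈ W, ∀ b ∈ W, pc.d v a b ≤ D) →
      ∀ v, v ∉ U → ∀ a ∈ W', ∀ b ∈ W', pc.d v a b ≤ D + 4 * Θ := by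
    intro U D hWU hU hD
    have hBU := hBW'.trans hWU
    have hD' : ∀ v, v ∉ U → ∀ a ∈ B, ∀ b ∈ B, pc.d v a b ≤ D + 2 * Θ := fun v hv =>
      nbound v D (fun h' => hv (hBU h')) (hD v hv)
    have bent : ∀ a w z, Bent R bd B B a w z → ∀ v, v ∉ U → pc.d v a z ≤ D + 4 * Θ := by
      intro a w z hz v hv
      have hp := hz.props hb hact hR hbB subset_rfl hM (by linarith)
      have := (hz.bound hb hact hR hbB hM (by linarith) hBU hU hD').2 v hv a (hBU hp.1)
        hp.2.2.1 (hb.self hp.2.2.1) (hb.self (fun e => hv (e ▸ hBU hp.1)))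
      linarith
    have one : ∀ z, BentEnd R bd B B z → ∀ a ∈ B, ∀ v, v ∉ U → pc.d v a z ≤ D + 4 * Θ := by
      rintro z (hz | ⟨u, r, w, z', hu, hr, h1, hz, rfl⟩) a ha v hv
      · have := hD' v hv a ha z hz
        linarith
      · by_cases hau : a = u
        · subst hau
          have hri : r ∈ N' := mem_growGroup hu hr
          have := bent a w z' hz (r⁻¹ • v) (fun h' => hv (by simpa using hU r hri _ h'))
          have e := hact.2 r (r⁻¹ • v) a z'
          rw [smul_inv_smul, hR.1.1 a r hr] at e
          linarith
        · exact bent a u _ (.turn ha hu hau hr h1 hz) v hv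
    rintro v hv a ⟨n, hn, a, ha, rfl⟩ b ⟨m, hm, b, hb', rfl⟩
    have hv' : n⁻¹ • v ∉ U := fun h' => hv (by simpa using hU n hn _ h')
    have e := hact.2 n (n⁻¹ • v) a (n⁻¹ • m • b)
    rw [smul_inv_smul, smul_inv_smul] at e
    rw [e]
    refine one _ ?_ a ha _ hv'
    rw [← mul_smul]
    exact (BentEnd.grow hR.1 hbB hNbd hNB hNB (mul_mem (inv_mem hn) hm) b).2 (Or.inl hb')
  have hconnB : ∀ b ∈ B, Joined pc W' b x := by
    rintro b (hb' | ⟨h1, w, hw, h2⟩)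
    · exact (h.conn b hb').mono (hWB.trans hBW')
    · exact .head ⟨h2, hBW' (hbB ⟨h1, w, hw, h2⟩), hBW' (hWB hw)⟩
        ((h.conn w hw).mono (hWB.trans hBW'))
  refine ⟨W', N', ⟨hBW' hxB, ?_, hinv', ?_, ?_, ?_, ?_⟩, hBW', fun n hn => le_growGroup hn⟩
  · rintro y ⟨n, hn, b, hb', rfl⟩
    refine ((hconnB b hb').smul hact (hinv' n hn)).trans ?_
    refine growGroup_induction (p := fun n => Joined pc W' (n • x) x) ?_ ?_ ?_ ?_ ?_ hn
    · intro n hn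
      exact hconnB _ (hWB (h.inv n hn x h.base))
    · intro v hv r hr
      have h1 := (hconnB v (hbB hv)).smul hact (hinv' r (mem_growGroup hv hr))
      rw [hR.1.1 v r hr] at h1
      exact h1.symm.trans (hconnB v (hbB hv))
    · rw [one_smul]
      exact .refl
    · intro a b ha h1 h2
      rw [mul_smul]
      exact (h2.smul hact (hinv' a ha)).trans h1
    · intro a ha h1
      have := h1.smul hact (hinv' a⁻¹ (inv_mem ha))
      rw [inv_smul_smul] at this
      exact this.symm
  · rintro y ⟨n, hn, b, hb', rfl⟩ r hr
    have : n⁻¹ * r * n ∈ R b := by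
      have := (hR.1.2 n⁻¹ (n • b) r).1 hr
      simpa using this
    have h2 : n⁻¹ * r * n ∈ N' := by
      rcases hb' with hb' | hb'
      · exact le_growGroup (h.rot b hb' this)
      · exact mem_growGroup hb' this
    have := mul_mem (mul_mem hn h2) (inv_mem hn)
    simpa [mul_assoc] using this
  · have := gen W' (5 * Θ) subset_rfl hinv' (fun v hv => h.far1 v (fun h' => hv (hBW' h')))
    intro v hv a ha b hb'
    linarith [this v hv a ha b hb']
  · have := gen (nbhd pc W') Θ (fun _ h => Or.inl h) ?_ ?_
    · intro v hv a ha b hb'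
      linarith [this v hv a ha b hb']
    · rintro n hn y (hy | ⟨h1, w, hw, h2⟩)
      · exact Or.inl (hinv' n hn y hy)
      · refine Or.inr ⟨fun h' => h1 (by simpa using hinv' n⁻¹ (inv_mem hn) _ h'), n • w,
          hinv' n hn w hw, hact.1 n _ _ h2⟩
    · intro v hv a ha b hb'
      obtain ⟨p, hp⟩ := Joined.walk ha ((h.conn a ha).trans (h.conn b hb').symm)
      refine hb.path v a b p fun w hw => ?_
      have hwW := hp w hw
      by_contra hlt
      apply hv
      obtain ⟨q, hq⟩ := pc.connected.exists_walk_length_eq_dist w v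
      have adjn : ∀ {W₁ : Set Y} {a b : Y}, a ∈ W₁ → pc.graph.Adj a b → b ∈ nbhd pc W₁ := by
        intro W₁ a b ha hab
        by_cases hbW : b ∈ W₁
        · exact Or.inl hbW
        · exact Or.inr ⟨hbW, a, ha, hab.symm⟩
      match q, hq with
      | .nil, _ => exact Or.inl (hBW' (hWB hwW))
      | .cons h1 .nil, _ => exact Or.inl (hBW' (adjn hwW h1))
      | .cons h1 (.cons h2 .nil), _ => exact adjn (hBW' (adjn hwW h1)) h2
      | .cons h1 (.cons h2 (.cons h3 q)), hq => simp at hq; omega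
  · intro n hn
    set β : Set Y := {y | ∃ n ∈ N, y = n • x}
    have hβB : β ⊆ B := by
      rintro y ⟨n, hn, rfl⟩
      exact hWB (h.inv n hn x h.base)
    have hNβ : ∀ n ∈ N, ∀ y ∈ β, n • y ∈ β := by
      rintro n hn y ⟨m, hm, rfl⟩
      exact ⟨n * m, mul_mem hn hm, by rw [mul_smul]⟩
    have hend : BentEnd R bd B β (n • x) :=
      (BentEnd.grow hR.1 hbB hNbd hNB hNβ hn x).2 (Or.inl ⟨1, one_mem _, by simp⟩)
    have e12 : L - 12 * Θ = L - 11 * Θ - Θ := by ring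
    have hβ : ∀ b ∈ β, Red pc R (L - 11 * Θ - Θ) x b := by
      rintro b ⟨m, hm, rfl⟩
      rw [← e12]
      exact h.red m hm
    rw [e12]
    rcases hend with hz | ⟨u, r, w, z', hu, hr, h1, hz, hz'⟩
    · exact hβ _ hz
    · rw [hz']
      exact (Bent.turn hxB hu (fun e => hxbd (e ▸ hu)) hr h1 hz).red hb hact hR hbB hβB hM
        (by linarith) hxB hxbd hβ

theorem Windmill.exists_ball (hb : PCBound pc Θ) (hact : PCAction pc G)
    (hR : IsEquivSpinningFamily pc R L) (hL : 20 * Θ ≤ L) (x : Y) (n : ℕ) :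
    ∃ W N, Windmill pc Θ L R x W N ∧ ∀ y, pc.graph.dist x y ≤ n → y ∈ W := by
  induction n with
  | zero =>
    refine ⟨_, _, .init hb hR x, fun y hy => ?_⟩
    exact ((pc.connected.dist_eq_zero_iff).1 (Nat.le_zero.1 hy)).symm
  | succ n ih =>
    obtain ⟨W, N, h, hW⟩ := ih
    obtain ⟨W', N', h', hWW', -⟩ := h.step hb hact hR hL
    refine ⟨W', N', h', fun y hy => hWW' ?_⟩
    rcases Nat.lt_or_ge n (pc.graph.dist x y) with hlt | hge
    · obtain ⟨p, hp⟩ := pc.connected.exists_walk_length_eq_dist y x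
      rw [SimpleGraph.dist_comm] at hp
      match p, hp with
      | .nil, hp => simp at hlt
      | .cons (v := v) h1 p, hp =>
        have : v ∈ W := hW v (by
          rw [SimpleGraph.dist_comm]
          have := SimpleGraph.dist_le p
          simp at hp
          omega)
        by_cases hyW : y ∈ W
        · exact Or.inl hyW
        · exact Or.inr ⟨hyW, v, this, h1⟩
    · exact Or.inl (hW y hge)

/-- Every point of the `spinSubgroup`-orbit of `x` can be reduced to `x` by large rotations. -/
theorem red_spinSubgroup (hb : PCBound pc Θ) (hact : PCAction pc G)
    (hR : IsEquivSpinningFamily pc R L) (hL : 20 * Θ ≤ L) (x : Y) {h : G}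
    (hh : h ∈ spinSubgroup R) : Red pc R (L - 12 * Θ) x (h • x) := by
  have key : ∃ n : ℕ, ∀ W N, Windmill pc Θ L R x W N →
      (∀ y, pc.graph.dist x y ≤ n → y ∈ W) → h ∈ N := by
    refine Subgroup.closure_induction (p := fun h _ => ∃ n : ℕ, ∀ W N, Windmill pc Θ L R x W N →
      (∀ y, pc.graph.dist x y ≤ n → y ∈ W) → h ∈ N) ?_ ?_ ?_ ?_ hh
    · intro c hc
      obtain ⟨s, hs, hsc⟩ := Group.mem_conjugatesOfSet_iff.1 hc
      obtain ⟨v, hv⟩ := Set.mem_iUnion.1 hs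
      obtain ⟨g, rfl⟩ := isConj_iff.1 hsc
      refine ⟨pc.graph.dist x (g • v), fun W N hW hball => ?_⟩
      exact hW.rot (g • v) (hball _ le_rfl) ((hR.1.2 g v s).1 hv)
    · exact ⟨0, fun W N _ _ => one_mem _⟩
    · rintro a b - - ⟨n, hn⟩ ⟨m, hm⟩
      exact ⟨max n m, fun W N hW hball => mul_mem
        (hn W N hW fun y hy => hball y (hy.trans (le_max_left _ _)))
        (hm W N hW fun y hy => hball y (hy.trans (le_max_right _ _)))⟩
    · rintro a - ⟨n, hn⟩
      exact ⟨n, fun W N hW hball => inv_mem (hn W N hW hball)⟩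
  obtain ⟨n, hn⟩ := key
  obtain ⟨W, N, hW, hball⟩ := Windmill.exists_ball hb hact hR hL x n
  exact hW.red h (hn W N hW hball)

end windmill

section polygon
variable {Y G : Type*} [Group G] [MulAction G Y]
variable {pc : ProjComplex Y}

theorem pcDist_smul (hact : PCAction pc G) (g : G) (x y : Y) :
    pc.graph.dist (g • x) (g • y) = pc.graph.dist x y := by
  have key : ∀ (g : G) (x y : Y), pc.graph.dist (g • x) (g • y) ≤ pc.graph.dist x y := by
    intro g x y
    obtain ⟨p, hp⟩ := pc.connected.exists_walk_length_eq_dist x y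
    have := SimpleGraph.dist_le (p.map (⟨fun y => g • y, fun h => hact.1 g _ _ h⟩ :
      pc.graph →g pc.graph))
    rw [SimpleGraph.Walk.length_map, hp] at this
    exact this
  refine le_antisymm (key g x y) ?_
  simpa using key g⁻¹ (g • x) (g • y)

/-- The distance between orbits of a subgroup. -/
noncomputable def qd (pc : ProjComplex Y) (H : Subgroup G) (x y : Y) : ℕ :=
  sInf {n | ∃ h ∈ H, pc.graph.dist x (h • y) = n}

variable {H : Subgroup G}

theorem exists_qd (pc : ProjComplex Y) (H : Subgroup G) (x y : Y) :
    ∃ h ∈ H, pc.graph.dist x (h • y) = qd pc H x y :=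
  Nat.sInf_mem (s := {n | ∃ h ∈ H, pc.graph.dist x (h • y) = n}) ⟨_, 1, one_mem _, rfl⟩

theorem qd_le {h : G} (hh : h ∈ H) (x y : Y) : qd pc H x y ≤ pc.graph.dist x (h • y) :=
  Nat.sInf_le ⟨h, hh, rfl⟩

theorem qd_le_dist (x y : Y) : qd pc H x y ≤ pc.graph.dist x y := by
  simpa using qd_le (pc := pc) (one_mem H) x y

theorem qd_smul_right {h : G} (hh : h ∈ H) (x y : Y) : qd pc H x (h • y) = qd pc H x y := by
  apply le_antisymm
  · obtain ⟨k, hk, e⟩ := exists_qd pc H x y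
    rw [← e]
    have := qd_le (pc := pc) (mul_mem hk (inv_mem hh)) x (h • y)
    rwa [mul_smul, inv_smul_smul] at this
  · obtain ⟨k, hk, e⟩ := exists_qd pc H x (h • y)
    rw [← e, ← mul_smul]
    exact qd_le (mul_mem hk hh) x y

theorem qd_comm (hact : PCAction pc G) (x y : Y) : qd pc H x y = qd pc H y x := by
  have key : ∀ x y, qd pc H x y ≤ qd pc H y x := by
    intro x y
    obtain ⟨k, hk, e⟩ := exists_qd pc H y x
    rw [← e, SimpleGraph.dist_comm, ← pcDist_smul hact k⁻¹, inv_smul_smul]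
    exact qd_le (inv_mem hk) x y
  exact le_antisymm (key x y) (key y x)

theorem qd_smul_left (hact : PCAction pc G) {h : G} (hh : h ∈ H) (x y : Y) :
    qd pc H (h • x) y = qd pc H x y := by
  rw [qd_comm hact, qd_smul_right hh, qd_comm hact]

theorem qd_smul (hact : PCAction pc G) [hH : H.Normal] (g : G) (x y : Y) :
    qd pc H (g • x) (g • y) = qd pc H x y := by
  have key : ∀ (g : G) (x y : Y), qd pc H (g • x) (g • y) ≤ qd pc H x y := by
    intro g x y
    obtain ⟨k, hk, e⟩ := exists_qd pc H x y
    rw [← e, ← pcDist_smul hact g]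
    have := qd_le (pc := pc) (hH.conj_mem k hk g) (g • x) (g • y)
    simpa [mul_smul] using this
  refine le_antisymm (key g x y) ?_
  simpa using key g⁻¹ (g • x) (g • y)

theorem qd_triangle (hact : PCAction pc G) (x y z : Y) :
    qd pc H x z ≤ qd pc H x y + qd pc H y z := by
  obtain ⟨h, hh, e⟩ := exists_qd pc H x y
  obtain ⟨k, hk, e'⟩ := exists_qd pc H y z
  have h1 := qd_le (pc := pc) (mul_mem hh hk) x z
  have h2 := pc.connected.dist_triangle (u := x) (v := h • y) (w := (h * k) • z)
  have h3 := pcDist_smul hact h y (k • z)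
  rw [← mul_smul] at h3
  omega

theorem qd_eq_zero (x y : Y) : qd pc H x y = 0 ↔ ∃ h ∈ H, h • y = x := by
  constructor
  · intro h0
    obtain ⟨k, hk, e⟩ := exists_qd pc H x y
    rw [h0] at e
    exact ⟨k, hk, (pc.connected.dist_eq_zero_iff.1 e).symm⟩
  · rintro ⟨h, hh, rfl⟩
    have := qd_le (pc := pc) hh (h • y) y
    simpa using this

theorem exists_between (pc : ProjComplex Y) (x y : Y) {i : ℕ} (hi : i ≤ pc.graph.dist x y) :
    ∃ m, pc.graph.dist x m = i ∧ pc.graph.dist m y = pc.graph.dist x y - i := by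
  obtain ⟨p, hp⟩ := pc.connected.exists_walk_length_eq_dist x y
  refine ⟨p.getVert i, ?_⟩
  have e1 : pc.graph.dist x (p.getVert i) ≤ i := by
    refine (SimpleGraph.dist_le (p.take i)).trans ?_
    simp [SimpleGraph.Walk.take_length]
  have e2 : pc.graph.dist (p.getVert i) y ≤ p.length - i := by
    refine (SimpleGraph.dist_le (p.drop i)).trans ?_
    simp [SimpleGraph.Walk.drop_length]
  have := pc.connected.dist_triangle (u := x) (v := p.getVert i) (w := y)
  omega

theorem qd_geodesic (x y : Y) {i : ℕ} (hi : i ≤ qd pc H x y) (hact : PCAction pc G) :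
    ∃ m, qd pc H x m = i ∧ qd pc H m y = qd pc H x y - i := by
  obtain ⟨k, hk, e⟩ := exists_qd pc H x y
  obtain ⟨m, h1, h2⟩ := exists_between pc x (k • y) (i := i) (by omega)
  refine ⟨m, ?_⟩
  have h3 := qd_le_dist (pc := pc) (H := H) x m
  have h4 := qd_le_dist (pc := pc) (H := H) m (k • y)
  have h5 := qd_triangle (H := H) hact x m y
  rw [qd_smul_right hk] at h4
  omega

/-- In a `δ`-hyperbolic graph a point between `x` and `y` is almost between `z` and one of
them. -/
theorem graph_thin {δ₀ : ℝ} (hP : GraphDeltaHyperbolic pc.graph δ₀) {δ : ℕ} (hδ : δ₀ ≤ δ)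
    {x m y : Y} (z : Y)
    (hm : pc.graph.dist x m + pc.graph.dist m y = pc.graph.dist x y) :
    pc.graph.dist z m + pc.graph.dist x m ≤ pc.graph.dist x z + 2 * δ ∨
      pc.graph.dist z m + pc.graph.dist y m ≤ pc.graph.dist y z + 2 * δ := by
  have geo : ∀ {u v : Y} (p : pc.graph.Walk u v), p.length = pc.graph.dist u v →
      IsGeodesicOn pc.graph p.getVert 0 p.length := by
    intro u v p hp
    refine ⟨fun i _ hi => Or.inr (p.adj_getVert_succ hi), fun i j _ hij hj => ?_⟩
    have e1 : pc.graph.dist u (p.getVert i) ≤ i := by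
      refine (SimpleGraph.dist_le (p.take i)).trans ?_
      simp [SimpleGraph.Walk.take_length]
    have e2 : pc.graph.dist (p.getVert j) v ≤ p.length - j := by
      refine (SimpleGraph.dist_le (p.drop j)).trans ?_
      simp [SimpleGraph.Walk.drop_length]
    have e3 : pc.graph.dist (p.getVert i) (p.getVert j) ≤ j - i := by
      have e : (p.drop i).getVert (j - i) = p.getVert j := by
        rw [SimpleGraph.Walk.drop_getVert]
        congr 1
        omega
      rw [← e]
      refine (SimpleGraph.dist_le ((p.drop i).take (j - i))).trans ?_
      simp [SimpleGraph.Walk.take_length]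
    have := pc.connected.dist_triangle (u := u) (v := p.getVert i) (w := v)
    have := pc.connected.dist_triangle (u := p.getVert i) (v := p.getVert j) (w := v)
    omega
  obtain ⟨p1, hp1⟩ := pc.connected.exists_walk_length_eq_dist x m
  obtain ⟨p2, hp2⟩ := pc.connected.exists_walk_length_eq_dist m y
  obtain ⟨q, hq⟩ := pc.connected.exists_walk_length_eq_dist y z
  obtain ⟨s, hs⟩ := pc.connected.exists_walk_length_eq_dist z x
  have btw : ∀ {u v : Y} (p : pc.graph.Walk u v), p.length = pc.graph.dist u v → ∀ j ≤ p.length,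
      pc.graph.dist u (p.getVert j) = j ∧ pc.graph.dist (p.getVert j) v = p.length - j := by
    intro u v p hp j hj
    have h1 := (geo p hp).2 0 j (by omega) (by omega) hj
    have h2 := (geo p hp).2 j p.length (by omega) hj le_rfl
    simp only [SimpleGraph.Walk.getVert_zero, SimpleGraph.Walk.getVert_length] at h1 h2
    omega
  have hlen : (p1.append p2).length = pc.graph.dist x y := by
    rw [SimpleGraph.Walk.length_append]
    omega
  have hmid : (p1.append p2).getVert p1.length = m := by
    rw [SimpleGraph.Walk.getVert_append]
    simp
  obtain ⟨j, h⟩ := hP _ _ _ _ _ _ (geo (p1.append p2) hlen) (geo q hq) (geo s hs)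
    (by rw [SimpleGraph.Walk.getVert_length]; simp) (by simp) (by simp) p1.length (by simp)
  rw [hmid] at h
  rcases h with ⟨hj, h⟩ | ⟨hj, h⟩
  · right
    have h' : pc.graph.dist m (q.getVert j) ≤ δ := by exact_mod_cast h.trans hδ
    have h1 := btw q hq j hj
    have h2 := pc.connected.dist_triangle (u := z) (v := q.getVert j) (w := m)
    have h3 := pc.connected.dist_triangle (u := y) (v := q.getVert j) (w := m)
    have c1 := pc.graph.dist_comm (u := z) (v := q.getVert j)
    have c2 := pc.graph.dist_comm (u := m) (v := q.getVert j)
    omega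
  · left
    have h' : pc.graph.dist m (s.getVert j) ≤ δ := by exact_mod_cast h.trans hδ
    have h1 := btw s hs j hj
    have h2 := pc.connected.dist_triangle (u := z) (v := s.getVert j) (w := m)
    have h3 := pc.connected.dist_triangle (u := x) (v := s.getVert j) (w := m)
    have c1 := pc.graph.dist_comm (u := x) (v := s.getVert j)
    have c2 := pc.graph.dist_comm (u := m) (v := s.getVert j)
    have c3 := pc.graph.dist_comm (u := x) (v := z)
    omega

/-- A closed-up polygon whose sides alternate between rigid pairs and pairs realizing the
distance in the quotient can be straightened to a genuine closed polygon. -/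
theorem polygon_lift {Θ K B : ℝ} {R : Y → Subgroup G} (hb : PCBound pc Θ)
    (hact : PCAction pc G) (hR : IsEquivFamily R) (hRH : ∀ v, R v ≤ H) (hH : H.Normal) {n : ℕ}
    (hK : n * (B + Θ) < K) (hK0 : Θ < K) {x y : Y} (hred : Red pc R K x y) :
    ∀ a b : ℕ → Y, a 0 = x → a n = y →
      (∀ i < n, ∀ v, v ≠ a i → v ≠ b i → pc.d v (a i) (b i) ≤ B) →
      (∀ i < n, pc.graph.dist (b i) (a (i + 1)) = qd pc H (b i) (a (i + 1))) →
      ∃ h : ℕ → G, (∀ i, h i ∈ H) ∧ h 0 = 1 ∧ h n • a n = a 0 ∧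
        ∀ i < n, pc.graph.dist (h i • b i) (h (i + 1) • a (i + 1)) =
          qd pc H (b i) (a (i + 1)) := by
  induction hred with
  | refl =>
    intro a b h0 hn _ h2
    refine ⟨fun _ => 1, fun _ => one_mem _, rfl, by simp [h0, hn], fun i hi => ?_⟩
    simpa using h2 i hi
  | @step y v r hvx hvy hKd hr _ ih =>
    intro a b h0 hn h1 h2
    have hrv := hR.1 v r hr
    obtain ⟨i, hi, hiv⟩ : ∃ i < n, pc.graph.dist (b i) v + pc.graph.dist v (a (i + 1)) =
        pc.graph.dist (b i) (a (i + 1)) := by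
      by_contra hcon
      push Not at hcon
      have hb' : ∀ i < n, b i ≠ v := fun i hi e => hcon i hi (by rw [← e]; simp)
      have ha' : ∀ i ≤ n, a i ≠ v := by
        intro i hi e
        rcases i with _ | i
        · exact hvx (by rw [← e, h0])
        · exact hcon i (by omega) (by rw [← e]; simp)
      have : ∀ i ≤ n, pc.d v (a 0) (a i) ≤ i * (B + Θ) + (if i = 0 then Θ else 0) := by
        intro i
        induction i with
        | zero =>
          intro hi
          simpa using hb.self (ha' 0 hi)
        | succ i ihi =>
          intro hi
          have e1 := ihi (by omega)
          have e2 := h1 i (by omega) v (ha' i (by omega)).symm (hb' i (by omega)).symm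
          have e3 := hb.geod v (b i) (a (i + 1)) (hb' i (by omega)) (ha' _ hi)
            (hcon i (by omega))
          have e4 := pc.d_triangle v (a i) (b i) (a (i + 1)) (ha' _ (by omega))
            (hb' i (by omega)) (ha' _ hi)
          have e5 := pc.d_triangle v (a 0) (a i) (a (i + 1)) (ha' _ (by omega))
            (ha' i (by omega)) (ha' _ hi)
          rcases Nat.eq_zero_or_pos i with rfl | hipos
          · simp only [zero_add, Nat.cast_one, one_mul, one_ne_zero, if_false]
            simp only [zero_add] at e4
            linarith
          · rw [if_neg (by omega)] at e1 ⊢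
            push_cast
            linarith
      have hn0 : n ≠ 0 := by
        rintro rfl
        have := this 0 le_rfl
        rw [h0] at hn
        subst hn
        linarith [hb.self (v := v) (x := x) hvx.symm]
      have := this n le_rfl
      rw [if_neg hn0, h0, hn] at this
      linarith
    set a' : ℕ → Y := fun j => if j ≤ i then a j else r • a j with ha'
    set b' : ℕ → Y := fun j => if j ≤ i then b j else r • b j with hb'
    have hd : ∀ p q, pc.d v (r • p) (r • q) = pc.d v p q := fun p q => by
      have := hact.2 r v p q
      rwa [hrv] at this
    have hrig : ∀ i < n, ∀ v, v ≠ a' i → v ≠ b' i → pc.d v (a' i) (b' i) ≤ B := by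
      intro j hj w hwa hwb
      simp only [ha', hb'] at hwa hwb ⊢
      split_ifs at hwa hwb ⊢
      · exact h1 j hj w hwa hwb
      · have := hact.2 r (r⁻¹ • w) (a j) (b j)
        rw [smul_inv_smul] at this
        rw [this]
        refine h1 j hj _ ?_ ?_
        · rwa [Ne, inv_smul_eq_iff]
        · rwa [Ne, inv_smul_eq_iff]
    have hex : ∀ i < n, pc.graph.dist (b' i) (a' (i + 1)) = qd pc H (b' i) (a' (i + 1)) := by
      intro j hj
      simp only [ha', hb']
      split_ifs with c1 c2
      · exact h2 j hj
      · have hji : j = i := by omega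
        subst hji
        rw [qd_smul_right (hRH v hr)]
        refine le_antisymm ?_ ?_
        · rw [← h2 j hj, ← hiv]
          refine (pc.connected.dist_triangle (v := v)).trans ?_
          have := pcDist_smul hact r v (a (j + 1))
          rw [hrv] at this
          rw [this]
        · exact qd_le (hRH v hr) _ _
      · omega
      · rw [pcDist_smul hact, qd_smul hact]
        exact h2 j hj
    obtain ⟨k, hk, hk0, hkn, hks⟩ := ih a' b' (by simp [ha', h0]) (by simp [ha', hn, hi]) hrig hex
    refine ⟨fun j => if j ≤ i then k j else k j * r, ?_, by simp [hk0], ?_, ?_⟩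
    · intro j
      dsimp only
      split_ifs
      · exact hk j
      · exact mul_mem (hk j) (hRH v hr)
    · have : a' 0 = a 0 := by simp [ha']
      rw [← this, ← hkn]
      simp [ha', mul_smul]
    · intro j hj
      have e1 : ∀ j, (if j ≤ i then k j else k j * r) • a j = k j • a' j := by
        intro j
        simp only [ha']
        split_ifs
        · rfl
        · rw [mul_smul]
      have e2 : ∀ j, (if j ≤ i then k j else k j * r) • b j = k j • b' j := by
        intro j
        simp only [hb']
        split_ifs
        · rfl
        · rw [mul_smul]
      rw [e1, e2, hks j hj]
      simp only [ha', hb']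
      split_ifs
      · rfl
      · rw [qd_smul_right (hRH v hr)]
      · omega
      · exact qd_smul hact r _ _

end polygon

/-- An isometric action on a discretely geodesic hyperbolic space with integer distances. -/
structure HypAct {Γ Q : Type*} [Group Γ] [MulAction Γ Q] (d : Q → Q → ℕ) (δ : ℕ) : Prop where
  eq_iff : ∀ x y, d x y = 0 ↔ x = y
  symm : ∀ x y, d x y = d y x
  tri : ∀ x y z, d x z ≤ d x y + d y z
  geod : ∀ x y i, i ≤ d x y → ∃ m, d x m = i ∧ d m y = d x y - i
  hyp : ∀ a b c e, d a b + d c e ≤ d a c + d b e + δ ∨ d a b + d c e ≤ d a e + d b c + δ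
  inv : ∀ (g : Γ) x y, d (g • x) (g • y) = d x y

/-- A WPD element `f` together with an independent element `t`, with respect to a base point. -/
structure WPDData {Γ Q : Type*} [Group Γ] [MulAction Γ Q] (d : Q → Q → ℕ) (f t : Γ) (x : Q) :
    Prop where
  growth : ∃ k n₀ : ℕ, ∀ n, n₀ ≤ n → n ≤ k * d x (f ^ n • x)
  wpd : ∀ D : ℕ, ∃ M : ℕ,
    {g : Γ | d x (g • x) ≤ D ∧ d (f ^ M • x) (g • f ^ M • x) ≤ D}.Finite
  growth' : ∀ C : ℕ, ∃ N : ℕ, ∀ n, N ≤ n → C ≤ d x (t ^ n • x)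
  indep : ∀ C : ℕ, ∃ N : ℕ, ∀ m n : ℤ, N ≤ m.natAbs → N ≤ n.natAbs →
    C ≤ d (f ^ m • x) (t ^ n • x)

theorem four_point_of_thin {Q : Type*} {d : Q → Q → ℕ} {δ : ℕ} (symm : ∀ x y, d x y = d y x)
    (tri : ∀ x y z, d x z ≤ d x y + d y z)
    (geod : ∀ x y i, i ≤ d x y → ∃ m, d x m = i ∧ d m y = d x y - i)
    (thin : ∀ x m y z, d x m + d m y = d x y →
      d z m + d x m ≤ d x z + δ ∨ d z m + d y m ≤ d y z + δ) (a b c e : Q) :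
    d a b + d c e ≤ d a c + d b e + (2 * δ + 1) ∨
      d a b + d c e ≤ d a e + d b c + (2 * δ + 1) := by
  have t1 := tri a b c
  have t2 := tri b a c
  have t3 := tri a c b
  have s1 := symm b a
  have s2 := symm c b
  obtain ⟨m, h1, h2⟩ := geod a b ((d a b + d a c - d b c) / 2) (by omega)
  have h3 : d a m + d m b = d a b := by omega
  have h4 := thin a m b c h3
  have h5 := thin a m b e h3
  have t4 := tri c m e
  have s3 := symm m e
  have s4 := symm b m
  omega

theorem not_virtuallyCyclic {Γ Q : Type*} [Group Γ] [MulAction Γ Q] {d : Q → Q → ℕ} {δ : ℕ}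
    (hd : HypAct (Γ := Γ) d δ) {f t : Γ} {x : Q} (h : WPDData d f t x) : ¬ VirtuallyCyclic Γ := by
  rintro ⟨K, hK, hcyc⟩
  obtain ⟨k, hk⟩ := hcyc.exists_generator
  have pw : ∀ g : Γ, ∃ a : ℕ, 0 < a ∧ ∃ p : ℤ, g ^ a = (k : Γ) ^ p := by
    intro g
    obtain ⟨a, ha, -, hga⟩ := Subgroup.exists_pow_mem_of_index_ne_zero hK.index_ne_zero g
    obtain ⟨p, hp⟩ := Subgroup.mem_zpowers_iff.1 (hk ⟨g ^ a, hga⟩)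
    exact ⟨a, ha, p, by simpa using (congrArg Subtype.val hp).symm⟩
  obtain ⟨a, ha, p, hp⟩ := pw f
  obtain ⟨b, hb, q, hq⟩ := pw t
  have fin : ∀ g : Γ, (∀ C : ℕ, ∃ N : ℕ, ∀ n, N ≤ n → C ≤ d x (g ^ n • x)) → ∀ a, 0 < a →
      g ^ a ≠ 1 := by
    intro g hg a ha e
    obtain ⟨N, hN⟩ := hg 1
    have := hN (a * N) (by nlinarith)
    rw [pow_mul, e, one_pow, one_smul, (hd.eq_iff x x).2 rfl] at this
    omega
  have hp0 : p ≠ 0 := by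
    rintro rfl
    refine fin f ?_ a ha (by simpa using hp)
    obtain ⟨k, n0, hk⟩ := h.growth
    intro C
    refine ⟨max n0 (k * C), fun n hn => ?_⟩
    have h1 := hk n (le_trans (le_max_left _ _) hn)
    have h2 : k * C ≤ n := le_trans (le_max_right _ _) hn
    by_contra hlt
    push Not at hlt
    rcases Nat.eq_zero_or_pos k with rfl | hk0
    · have := hk (n0 + 1) (by omega)
      omega
    · nlinarith
  have hq0 : q ≠ 0 := by
    rintro rfl
    exact fin t h.growth' b hb (by simpa using hq)
  obtain ⟨N, hN⟩ := h.indep 1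
  have e : f ^ ((a : ℤ) * q * N) = t ^ ((b : ℤ) * p * N) := by
    rw [zpow_mul, zpow_mul, zpow_mul _ _ (N : ℤ), zpow_mul _ (b : ℤ), zpow_natCast f,
      zpow_natCast t, hp, hq]
    simp only [← zpow_mul]
    congr 1
    ring
  have big : ∀ r : ℤ, r ≠ 0 → N ≤ (r * N).natAbs := by
    intro r hr
    rw [Int.natAbs_mul]
    have := Int.natAbs_pos.2 hr
    simp only [Int.natAbs_natCast]
    nlinarith
  have := hN _ _ (big (a * q) (by positivity)) (big (b * p) (by positivity))
  rw [e, (hd.eq_iff _ _).2 rfl] at this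
  omega

section lift
variable {Y G : Type*} [Group G] [MulAction G Y]
variable {pc : ProjComplex Y} {Θ K B : ℝ} {R : Y → Subgroup G} {H : Subgroup G}

/-- The quotient pseudo-distance agrees with the distance on rigid pairs. -/
theorem qd_eq_of_rigid (hb : PCBound pc Θ)
    (hact : PCAction pc G) (hR : IsEquivFamily R) (hRH : ∀ v, R v ≤ H) (hH : H.Normal)
    (hred : ∀ x, ∀ h ∈ H, Red pc R K x (h • x)) (hK : 4 * (B + Θ) < K) (hB : Θ ≤ B)
    {p q : Y} (hpq : ∀ v, v ≠ p → v ≠ q → pc.d v p q ≤ B) :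
    qd pc H p q = pc.graph.dist p q := by
  have := hb.pos
  obtain ⟨h, hh, e⟩ := exists_qd pc H q p
  obtain ⟨k, hk, hk0, hkn, hks⟩ := polygon_lift (B := B) hb hact hR hRH hH (n := 1) (by push_cast; linarith)
    (by linarith) (hred p h hh) (fun i => if i = 0 then p else h • p) (fun _ => q) (by simp)
    (by simp) (by
      intro i hi v h1 h2
      obtain rfl : i = 0 := by omega
      exact hpq v h1 h2) (by
      intro i hi
      obtain rfl : i = 0 := by omega
      simpa [qd_smul_right hh] using e)
  have h1 := hks 0 (by omega)
  simp only [zero_add, one_ne_zero, if_false, if_true] at hkn h1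
  rw [hk0, hkn, one_smul, qd_smul_right hh, SimpleGraph.dist_comm, qd_comm hact] at h1
  exact h1.symm

/-- Elements coarsely stabilizing a rigid pair in the quotient lift to elements coarsely
stabilizing it. -/
theorem exists_lift_of_rigid (hb : PCBound pc Θ)
    (hact : PCAction pc G) (hR : IsEquivFamily R) (hRH : ∀ v, R v ≤ H) (hH : H.Normal)
    (hred : ∀ x, ∀ h ∈ H, Red pc R K x (h • x)) (hK : 4 * (B + Θ) < K) (hB : Θ ≤ B)
    {p q : Y} (hpq : ∀ v, v ≠ p → v ≠ q → pc.d v p q ≤ B) (g : G) :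
    ∃ h ∈ H, pc.graph.dist p ((h * g) • p) = qd pc H p (g • p) ∧
      pc.graph.dist q ((h * g) • q) = qd pc H q (g • q) := by
  have := hb.pos
  obtain ⟨h, hh, e⟩ := exists_qd pc H q (g • q)
  obtain ⟨h', hh', e'⟩ := exists_qd pc H (h • g • p) p
  obtain ⟨k, hk, hk0, hkn, hks⟩ := polygon_lift (B := B) hb hact hR hRH hH (n := 2) (by push_cast; linarith)
    (by linarith) (hred p h' hh')
    (fun i => if i = 0 then p else if i = 1 then h • g • q else h' • p)
    (fun i => if i = 0 then q else h • g • p) (by simp) (by simp) (by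
      intro i hi v h1 h2
      have : i = 0 ∨ i = 1 := by omega
      rcases this with rfl | rfl
      · exact hpq v h1 h2
      · simp only [one_ne_zero, if_false, if_true] at h1 h2 ⊢
        have h3 : (h * g)⁻¹ • v ≠ p := by
          rwa [Ne, inv_smul_eq_iff, mul_smul]
        have h4 : (h * g)⁻¹ • v ≠ q := by
          rwa [Ne, inv_smul_eq_iff, mul_smul]
        have h5 := hact.2 (h * g) ((h * g)⁻¹ • v) q p
        rw [smul_inv_smul, mul_smul, mul_smul] at h5
        rw [h5, pc.d_symm _ _ _ h4.symm h3.symm]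
        exact hpq _ h3 h4) (by
      intro i hi
      have : i = 0 ∨ i = 1 := by omega
      rcases this with rfl | rfl
      · simpa [qd_smul_right hh] using e
      · simpa [qd_smul_right hh'] using e')
  have h1 := hks 0 (by omega)
  have h2 := hks 1 (by omega)
  simp only [zero_add, one_ne_zero, if_false, if_true, OfNat.ofNat_ne_zero, OfNat.ofNat_ne_one,
    Nat.reduceAdd] at hkn h1 h2
  rw [hk0, one_smul, qd_smul_right hh] at h1
  rw [hkn, qd_smul_right hh', qd_smul_left hact hh] at h2
  refine ⟨k 1 * h, mul_mem (hk 1) hh, ?_, ?_⟩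
  · rw [mul_smul, mul_smul, SimpleGraph.dist_comm, h2, qd_comm hact]
  · rw [mul_smul, mul_smul, h1]

/-- Quadrilaterals in the quotient lift. -/
theorem qd_thin (hb : PCBound pc Θ)
    (hact : PCAction pc G) (hR : IsEquivFamily R) (hRH : ∀ v, R v ≤ H) (hH : H.Normal)
    (hred : ∀ x, ∀ h ∈ H, Red pc R K x (h • x)) (hK : 4 * (B + Θ) < K) (hB : Θ ≤ B)
    {δ₀ : ℝ} (hP : GraphDeltaHyperbolic pc.graph δ₀) {δ : ℕ} (hδ : δ₀ ≤ δ)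
    (x m y z : Y) (hm : qd pc H x m + qd pc H m y = qd pc H x y) :
    qd pc H z m + qd pc H x m ≤ qd pc H x z + 2 * δ ∨
      qd pc H z m + qd pc H y m ≤ qd pc H y z + 2 * δ := by
  have := hb.pos
  obtain ⟨h1, hh1, e1⟩ := exists_qd pc H x m
  obtain ⟨h2, hh2, e2⟩ := exists_qd pc H (h1 • m) y
  obtain ⟨h3, hh3, e3⟩ := exists_qd pc H (h2 • y) z
  obtain ⟨h4, hh4, e4⟩ := exists_qd pc H (h3 • z) x
  set a : ℕ → Y := fun i => if i = 0 then x else if i = 1 then h1 • m else if i = 2 then h2 • y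
    else if i = 3 then h3 • z else h4 • x with ha
  have cases4 : ∀ {i : ℕ}, i < 4 → i = 0 ∨ i = 1 ∨ i = 2 ∨ i = 3 := by omega
  obtain ⟨k, hk, hk0, hkn, hks⟩ := polygon_lift (B := B) hb hact hR hRH hH (n := 4) (by push_cast; linarith)
    (by linarith) (hred x h4 hh4) a a (by simp [ha]) (by simp [ha]) (by
      intro i hi v h1 h2
      exact (hb.self h1.symm).trans hB) (by
      intro i hi
      rcases cases4 hi with rfl | rfl | rfl | rfl
      · simpa [ha, qd_smul_right hh1] using e1
      · simpa [ha, qd_smul_right hh2] using e2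
      · simpa [ha, qd_smul_right hh3] using e3
      · simpa [ha, qd_smul_right hh4] using e4)
  have c0 := hks 0 (by omega)
  have c1 := hks 1 (by omega)
  have c2 := hks 2 (by omega)
  have c3 := hks 3 (by omega)
  simp only [Nat.reduceAdd, zero_add] at c0 c1 c2 c3
  rw [hkn] at c3
  simp only [ha, hk0, one_smul, one_ne_zero, if_false, if_true,
    OfNat.ofNat_ne_zero, OfNat.ofNat_ne_one, Nat.reduceEqDiff, ← mul_smul,
    qd_smul_right hh1, qd_smul_right hh2, qd_smul_right hh3,
    qd_smul_right hh4, qd_smul_left hact hh1, qd_smul_left hact hh2, qd_smul_left hact hh3]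
    at c0 c1 c2 c3
  have d1 := qd_le (pc := pc) (mul_mem (hk 2) hh2) x y
  have d2 := pc.connected.dist_triangle (u := x) (v := (k 1 * h1) • m) (w := (k 2 * h2) • y)
  have d3 := qd_le_dist (pc := pc) (H := H) ((k 3 * h3) • z) ((k 1 * h1) • m)
  rw [qd_smul_right (mul_mem (hk 1) hh1), qd_smul_left hact (mul_mem (hk 3) hh3)] at d3
  have d4 := graph_thin hP hδ (x := x) (m := (k 1 * h1) • m) (y := (k 2 * h2) • y)
    ((k 3 * h3) • z) (by omega)
  have s1 := pc.graph.dist_comm (u := (k 3 * h3) • z) (v := x)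
  have s2 := pc.graph.dist_comm (u := (k 2 * h2) • y) (v := (k 1 * h1) • m)
  have s3 := qd_comm (H := H) hact z x
  have s4 := qd_comm (H := H) hact y m
  omega

end lift

section orbit
variable {Y G : Type*} [Group G] [MulAction G Y]
variable {pc : ProjComplex Y} {Θ : ℝ}

theorem growth_of_hyperbolic (hact : PCAction pc G) {f : G}
    (hf : ActHyperbolic pc.graph (fun (g : G) (x : Y) => g • x) f) (x : Y) :
    ∃ k n₀ : ℕ, ∀ n, n₀ ≤ n → n ≤ k * pc.graph.dist x (f ^ n • x) := by
  obtain ⟨x', l, hl, ht⟩ := hf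
  obtain ⟨k, hk⟩ := exists_nat_ge (2 / l)
  obtain ⟨n₁, hn₁⟩ := Filter.eventually_atTop.1 (ht.eventually (lt_mem_nhds (half_lt_self hl)))
  set c := pc.graph.dist x x' with hc
  refine ⟨2 * k, max (n₁ + 1) (4 * k * c), fun n hn => ?_⟩
  have h1 := hn₁ n (by have := le_trans (le_max_left _ _) hn; omega)
  have h2 : 4 * k * c ≤ n := le_trans (le_max_right _ _) hn
  have hn0 : (0 : ℝ) < n := by
    have := le_trans (le_max_left _ _) hn
    exact_mod_cast (by omega : 0 < n)
  rw [lt_div_iff₀ hn0] at h1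
  have h3 : (n : ℝ) ≤ k * pc.graph.dist x' (f ^ n • x') := by
    rw [div_le_iff₀ hl] at hk
    have : (0 : ℝ) ≤ k := Nat.cast_nonneg k
    nlinarith
  have h4 : n ≤ k * pc.graph.dist x' (f ^ n • x') := by exact_mod_cast h3
  have h5 := pc.connected.dist_triangle (u := x') (v := x) (w := f ^ n • x')
  have h6 := pc.connected.dist_triangle (u := x) (v := f ^ n • x) (w := f ^ n • x')
  rw [pcDist_smul hact, ← hc] at h6
  rw [pc.graph.dist_comm (u := x') (v := x), ← hc] at h5
  have h7 := Nat.mul_le_mul_left k (h5.trans (Nat.add_le_add_left h6 _))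
  nlinarith

theorem orbit_bound (hb : PCBound pc Θ) (hact : PCAction pc G) {f : G} {x : Y}
    (hf : ∃ k n₀ : ℕ, ∀ n, n₀ ≤ n → n ≤ k * pc.graph.dist x (f ^ n • x)) :
    ∃ B : ℝ, ∀ N : ℕ, ∀ v, v ≠ x → v ≠ f ^ N • x → pc.d v x (f ^ N • x) ≤ B := by
  obtain ⟨k, n₀, hk⟩ := hf
  have hpos := hb.pos
  set a := pc.graph.dist x (f • x) with ha
  set c : ℕ → Y := fun i => f ^ i • x with hc
  have hadd : ∀ i j, c (i + j) = f ^ i • c j := fun i j => by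
    simp only [hc, pow_add, mul_smul]
  have hstep : ∀ i, pc.graph.dist (c i) (c (i + 1)) = a := by
    intro i
    have h0 : c i = f ^ i • x := rfl
    rw [hadd, h0, pcDist_smul hact]
    simp [hc, ha]
  set W := max n₀ (k * (2 * a + 4)) with hW
  have hwin : ∀ v i j, i ≤ j → pc.graph.dist (c i) v ≤ a + 2 → pc.graph.dist (c j) v ≤ a + 2 →
      j - i ≤ W := by
    intro v i j hij h1 h2
    obtain ⟨s, rfl⟩ := Nat.exists_eq_add_of_le hij
    have h3 := pc.connected.dist_triangle (u := c i) (v := v) (w := c (i + s))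
    rw [pc.graph.dist_comm (u := v), hadd] at h3
    have h0 : c i = f ^ i • x := rfl
    rw [← hadd] at h3
    have h4 : pc.graph.dist (c i) (c (i + s)) = pc.graph.dist x (c s) := by
      rw [hadd, h0, pcDist_smul hact]
    rw [h4] at h3
    by_contra hlt
    push Not at hlt
    have h5 : n₀ ≤ W := le_max_left _ _
    have h6 : k * (2 * a + 4) ≤ W := le_max_right _ _
    have h7 := hk s (by omega)
    have h8 : k * pc.graph.dist x (c s) ≤ k * (2 * a + 4) := Nat.mul_le_mul_left _ (by omega)
    have h9 : f ^ s • x = c s := rfl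
    rw [h9] at h7
    omega
  have hpath : ∀ v i s, (∀ l, i ≤ l → l ≤ i + s → a + 2 < pc.graph.dist (c l) v) →
      ∃ p : pc.graph.Walk (c i) (c (i + s)), ∀ w ∈ p.support, 2 < pc.graph.dist w v := by
    intro v i s
    induction s with
    | zero =>
      intro h
      refine ⟨.nil, ?_⟩
      intro w hw
      simp only [SimpleGraph.Walk.support_nil, List.mem_singleton] at hw
      subst hw
      have := h i le_rfl le_rfl
      omega
    | succ s ih =>
      intro h
      obtain ⟨p, hp⟩ := ih fun l h1 h2 => h l h1 (by omega)
      obtain ⟨q, hq⟩ := pc.connected.exists_walk_length_eq_dist (c (i + s)) (c (i + s + 1))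
      refine ⟨p.append q, ?_⟩
      intro w hw
      rw [SimpleGraph.Walk.mem_support_append_iff] at hw
      rcases hw with hw | hw
      · exact hp w hw
      · classical
        have h1 := SimpleGraph.dist_le (q.takeUntil w hw)
        have h2 := q.length_takeUntil_le_length hw
        have h3 := h (i + s) (by omega) (by omega)
        have h4 := pc.connected.dist_triangle (u := c (i + s)) (v := w) (w := v)
        rw [hstep] at hq
        omega
  have hmid : ∀ s, ∃ b : ℝ, ∀ v, v ≠ x → v ≠ c s → pc.d v x (c s) ≤ b := by
    intro s
    obtain ⟨b, hb'⟩ := ((hb.fin x (c s)).image (fun v => pc.d v x (c s))).bddAbove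
    refine ⟨max Θ b, fun v h1 h2 => ?_⟩
    by_cases h3 : Θ < pc.d v x (c s)
    · exact (hb' ⟨v, ⟨h1, h2, h3⟩, rfl⟩).trans (le_max_right _ _)
    · exact (not_lt.1 h3).trans (le_max_left _ _)
  choose b hb' using hmid
  obtain ⟨B₀, hB₀⟩ := ((Finset.range (W + 3)).finite_toSet.image b).bddAbove
  refine ⟨max Θ (B₀ + 2 * Θ), fun N v hvx hvN => ?_⟩
  have far_ne : ∀ l, a + 2 < pc.graph.dist (c l) v → c l ≠ v := by
    intro l hl e
    rw [e] at hl
    simp at hl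
  have h0x : c 0 = x := by simp [hc]
  have far_bound : ∀ i j, i ≤ j → (∀ l, i ≤ l → l ≤ j → a + 2 < pc.graph.dist (c l) v) →
      pc.d v (c i) (c j) ≤ Θ := by
    intro i j hij h
    obtain ⟨s, rfl⟩ := Nat.exists_eq_add_of_le hij
    obtain ⟨p, hp⟩ := hpath v i s h
    exact hb.path v _ _ p hp
  by_cases hall : ∀ l ≤ N, a + 2 < pc.graph.dist (c l) v
  · have := far_bound 0 N (by omega) (fun l _ hl => hall l hl)
    rw [h0x] at this
    exact this.trans (le_max_left _ _)
  push Not at hall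
  classical
  have hspec := Nat.find_spec hall
  set i₀ := Nat.find hall with hi₀
  have hmin : ∀ l < i₀, l ≤ N → a + 2 < pc.graph.dist (c l) v := by
    intro l hl hlN
    have := Nat.find_min hall hl
    push Not at this
    exact this hlN
  set i₁ := Nat.findGreatest (fun l => pc.graph.dist (c l) v ≤ a + 2) N with hi₁
  have h1 : pc.graph.dist (c i₁) v ≤ a + 2 :=
    Nat.findGreatest_spec (P := fun l => pc.graph.dist (c l) v ≤ a + 2) hspec.1 hspec.2
  have h01 : i₀ ≤ i₁ := Nat.le_findGreatest hspec.1 hspec.2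
  have h1N : i₁ ≤ N := Nat.findGreatest_le N
  have hmax : ∀ l, i₁ < l → l ≤ N → a + 2 < pc.graph.dist (c l) v := by
    intro l hl hlN
    have := Nat.findGreatest_is_greatest hl hlN
    omega
  have hw := hwin v i₀ i₁ h01 hspec.2 h1
  obtain ⟨p, hpl, hpu, hpv, hp⟩ : ∃ p, i₀ - 1 ≤ p ∧ p ≤ i₀ ∧ c p ≠ v ∧ pc.d v x (c p) ≤ Θ := by
    refine ⟨i₀ - 1, le_rfl, by omega, ?_⟩
    rcases Nat.eq_zero_or_pos i₀ with h | h
    · rw [h, Nat.zero_sub, h0x]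
      exact ⟨hvx.symm, hb.self hvx.symm⟩
    · refine ⟨far_ne _ (hmin _ (by omega) (by omega)), ?_⟩
      rw [← h0x]
      exact far_bound 0 _ (by omega) fun l _ hl => hmin l (by omega) (by omega)
  obtain ⟨q, hql, hqu, hqv, hq⟩ : ∃ q, i₁ ≤ q ∧ q ≤ i₁ + 1 ∧ c q ≠ v ∧ pc.d v (c q) (c N) ≤ Θ := by
    rcases Nat.lt_or_ge i₁ N with h | h
    · refine ⟨i₁ + 1, by omega, le_rfl, far_ne _ (hmax _ (by omega) (by omega)), ?_⟩
      exact far_bound _ N (by omega) fun l hl hl' => hmax l (by omega) hl'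
    · have : i₁ = N := by omega
      refine ⟨i₁, le_rfl, by omega, ?_⟩
      rw [this]
      exact ⟨hvN.symm, hb.self hvN.symm⟩
  have hpq : p ≤ q := by omega
  obtain ⟨s, rfl⟩ := Nat.exists_eq_add_of_le hpq
  have e1 : pc.d v (c p) (c (p + s)) ≤ B₀ := by
    have h2 := hact.2 (f ^ p) ((f ^ p)⁻¹ • v) x (c s)
    rw [smul_inv_smul, ← hadd] at h2
    have h3 : f ^ p • x = c p := rfl
    rw [h3] at h2
    rw [h2]
    refine (hb' s _ ?_ ?_).trans (hB₀ ⟨s, by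
      simp only [Finset.coe_range, Set.mem_Iio]; omega, rfl⟩)
    · rw [Ne, inv_smul_eq_iff]
      exact hpv.symm
    · rw [Ne, inv_smul_eq_iff, ← hadd]
      exact hqv.symm
  have hNv : c N ≠ v := hvN.symm
  have e2 := pc.d_triangle v x (c p) (c N) hvx.symm hpv hNv
  have e3 := pc.d_triangle v (c p) (c (p + s)) (c N) hpv hqv hNv
  refine le_trans ?_ (le_max_right _ _)
  have e4 := hp
  change pc.d v x (c N) ≤ _
  linarith

theorem orbit_bound_int (hb : PCBound pc Θ) (hact : PCAction pc G) {f : G} {x : Y}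
    (hf : ∃ k n₀ : ℕ, ∀ n, n₀ ≤ n → n ≤ k * pc.graph.dist x (f ^ n • x)) :
    ∃ B : ℝ, ∀ m n : ℤ, ∀ v, v ≠ f ^ m • x → v ≠ f ^ n • x →
      pc.d v (f ^ m • x) (f ^ n • x) ≤ B := by
  obtain ⟨B, hB⟩ := orbit_bound hb hact hf
  refine ⟨B, ?_⟩
  have key : ∀ (m : ℤ) (N : ℕ), ∀ v, v ≠ f ^ m • x → v ≠ f ^ (m + N) • x →
      pc.d v (f ^ m • x) (f ^ (m + N) • x) ≤ B := by
    intro m N v h1 h2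
    have e : f ^ (m + N) • x = f ^ m • f ^ N • x := by
      rw [zpow_add, mul_smul, zpow_natCast]
    rw [e] at h2 ⊢
    have := hact.2 (f ^ m) ((f ^ m)⁻¹ • v) x (f ^ N • x)
    rw [smul_inv_smul] at this
    rw [this]
    refine hB N _ ?_ ?_
    · rwa [Ne, inv_smul_eq_iff]
    · rwa [Ne, inv_smul_eq_iff]
  intro m n v h1 h2
  rcases le_total m n with h | h
  · obtain ⟨N, rfl⟩ := Int.le.dest h
    exact key m N v h1 h2
  · obtain ⟨N, rfl⟩ := Int.le.dest h
    rw [pc.d_symm _ _ _ h1.symm h2.symm]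
    exact key n N v h2 h1

theorem orbit_bound_mixed (hb : PCBound pc Θ) (hact : PCAction pc G) {f t : G} {x : Y}
    (hf : ∃ k n₀ : ℕ, ∀ n, n₀ ≤ n → n ≤ k * pc.graph.dist x (f ^ n • x))
    (ht : ∃ k n₀ : ℕ, ∀ n, n₀ ≤ n → n ≤ k * pc.graph.dist x (t ^ n • x)) :
    ∃ B : ℝ, ∀ m n : ℤ, ∀ v, v ≠ f ^ m • x → v ≠ t ^ n • x →
      pc.d v (f ^ m • x) (t ^ n • x) ≤ B := by
  obtain ⟨B, hB⟩ := orbit_bound_int hb hact hf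
  obtain ⟨B', hB'⟩ := orbit_bound_int hb hact ht
  have mv : ∀ g : G, (∃ k n₀ : ℕ, ∀ n, n₀ ≤ n → n ≤ k * pc.graph.dist x (g ^ n • x)) →
      ∃ n : ℤ, g ^ n • x ≠ x := by
    rintro g ⟨k, n₀, h⟩
    refine ⟨((n₀ + 1 : ℕ) : ℤ), fun e => ?_⟩
    have := h (n₀ + 1) (by omega)
    rw [zpow_natCast] at e
    rw [e] at this
    simp at this
  obtain ⟨m₀, hm₀⟩ := mv f hf
  obtain ⟨n₀, hn₀⟩ := mv t ht
  refine ⟨max (B + B') (B + pc.d x (f ^ m₀ • x) (t ^ n₀ • x) + B'), fun m n v h1 h2 => ?_⟩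
  by_cases hv : v = x
  · subst hv
    have e1 := pc.d_triangle v (f ^ m • v) (f ^ m₀ • v) (t ^ n • v) h1.symm hm₀ h2.symm
    have e2 := pc.d_triangle v (f ^ m₀ • v) (t ^ n₀ • v) (t ^ n • v) hm₀ hn₀ h2.symm
    have e3 := hB m m₀ v h1 hm₀.symm
    have e4 := hB' n₀ n v hn₀.symm h2
    refine le_trans ?_ (le_max_right _ _)
    linarith
  · have e1 := pc.d_triangle v (f ^ m • x) x (t ^ n • x) h1.symm (Ne.symm hv) h2.symm
    have e3 := hB m 0 v h1 (by simpa using hv)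
    have e4 := hB' 0 n v (by simpa using hv) h2
    rw [zpow_zero, one_smul] at e3 e4
    refine le_trans ?_ (le_max_left _ _)
    linarith

end orbit

section quot
variable {Y G : Type*} [Group G] [MulAction G Y]
variable {pc : ProjComplex Y}

/-- Points with vanishing quotient pseudo-distance are identified. -/
def qdSetoid (hact : PCAction pc G) (H : Subgroup G) : Setoid Y where
  r x y := qd pc H x y = 0
  iseqv :=
    { refl := fun x => (qd_eq_zero x x).2 ⟨1, one_mem H, one_smul G x⟩
      symm := fun {x y} h => by rw [qd_comm hact]; exact h
      trans := fun {x y z} h h' => by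
        have := qd_triangle (H := H) hact x y z
        omega }

theorem qd_congr (hact : PCAction pc G) {H : Subgroup G} {a b a' b' : Y}
    (h : qd pc H a a' = 0) (h' : qd pc H b b' = 0) : qd pc H a b = qd pc H a' b' := by
  have h1 := qd_triangle (H := H) hact a a' b
  have h2 := qd_triangle (H := H) hact a' b' b
  have h3 := qd_triangle (H := H) hact a' a b'
  have h4 := qd_triangle (H := H) hact a b b'
  have s1 := qd_comm (H := H) hact a a'
  have := qd_comm (H := H) hact b b'
  omega

/-- The distance on the quotient of the vertex set. -/
noncomputable def qDist (hact : PCAction pc G) (H : Subgroup G) :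
    Quotient (qdSetoid hact H) → Quotient (qdSetoid hact H) → ℕ :=
  Quotient.lift₂ (fun x y => qd pc H x y) fun _ _ _ _ h k => qd_congr hact h k

/-- The quotient group acts on the quotient of the vertex set. -/
@[reducible]
def quotAct (hact : PCAction pc G) (H : Subgroup G) [hH : H.Normal] :
    MulAction (G ⧸ H) (Quotient (qdSetoid hact H)) where
  smul γ q := Quotient.liftOn₂ γ q (fun g y => (⟦g • y⟧ : Quotient (qdSetoid hact H))) (by
    intro g y g' y' hg hy
    refine Quotient.sound ?_
    change qd pc H (g • y) (g' • y') = 0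
    have h1 : g⁻¹ * g' ∈ H := QuotientGroup.leftRel_apply.1 hg
    have h2 : g' • y' = g • (g⁻¹ * g') • y' := by rw [smul_smul, mul_inv_cancel_left]
    rw [h2, qd_smul hact, qd_smul_right h1]
    exact hy)
  one_smul q := by
    induction q using Quotient.inductionOn with
    | h y => exact congrArg _ (one_smul G y)
  mul_smul γ γ' q := by
    induction q using Quotient.inductionOn with
    | h y =>
      induction γ using QuotientGroup.induction_on with
      | H g =>
        induction γ' using QuotientGroup.induction_on with
        | H g' => exact congrArg _ (mul_smul g g' y)

end quot

/-- For sufficiently spinning families, the quotient group acts on a hyperbolic space with an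
element satisfying the weak proper discontinuity condition and an independent one. -/
theorem exists_wpd_quotient.{u, v} {Y : Type u} {G : Type v} [Group G]
    [MulAction G Y] (pc : ProjComplex Y) (hact : PCAction pc G) (δ₀ : ℝ)
    (hP : GraphDeltaHyperbolic pc.graph δ₀)
    (hne : ActNonelementaryWPD pc.graph (fun (g : G) (x : Y) => g • x)) :
    ∃ LWPD : ℝ, ∀ (L : ℝ) (R : Y → Subgroup G), LWPD ≤ L →
      IsEquivSpinningFamily pc R L →
      ∃ (Q : Type u) (_ : MulAction (G ⧸ spinSubgroup R) Q) (d : Q → Q → ℕ) (δ : ℕ)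
        (f t : G ⧸ spinSubgroup R) (x : Q),
        HypAct (Γ := G ⧸ spinSubgroup R) d δ ∧ WPDData d f t x := by
  obtain ⟨Θ, hb⟩ := exists_pcBound pc
  obtain ⟨f₁, f₂, hf₁, hf₂, -, -, x, hind⟩ := hne
  have g₁ := growth_of_hyperbolic hact hf₁.1 x
  have g₂ := growth_of_hyperbolic hact hf₂.1 x
  obtain ⟨B₁, hB₁⟩ := orbit_bound_int hb hact g₁
  obtain ⟨B₂, hB₂⟩ := orbit_bound_int hb hact g₂
  obtain ⟨B₃, hB₃⟩ := orbit_bound_mixed hb hact g₁ g₂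
  set B := max (max B₁ B₂) (max B₃ Θ) with hBdef
  have hBΘ : Θ ≤ B := (le_max_right _ _).trans (le_max_right _ _)
  have hb1 : B₁ ≤ B := (le_max_left _ _).trans (le_max_left _ _)
  have hb2 : B₂ ≤ B := (le_max_right _ _).trans (le_max_left _ _)
  have hb3 : B₃ ≤ B := (le_max_left _ _).trans (le_max_right _ _)
  refine ⟨max (20 * Θ) (12 * Θ + 4 * (B + Θ) + 1), fun L R hL hR => ?_⟩
  have hL1 := (le_max_left _ _).trans hL
  have hL2 := (le_max_right _ _).trans hL
  set H := spinSubgroup R with hH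
  have hHn : H.Normal := spinSubgroup_normal R
  have hRH : ∀ v, R v ≤ H := fun v g hg =>
    Subgroup.subset_normalClosure (Set.mem_iUnion.2 ⟨v, hg⟩)
  have hred : ∀ x, ∀ h ∈ H, Red pc R (L - 12 * Θ) x (h • x) := fun x h hh =>
    red_spinSubgroup hb hact hR hL1 x hh
  have hK : 4 * (B + Θ) < L - 12 * Θ := by linarith
  have rig : ∀ {p q : Y}, (∀ v, v ≠ p → v ≠ q → pc.d v p q ≤ B) →
      qd pc H p q = pc.graph.dist p q := fun {p q} h =>
    qd_eq_of_rigid hb hact hR.1 hRH hHn hred hK hBΘ h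
  have r₁ : ∀ n : ℕ, ∀ v, v ≠ x → v ≠ f₁ ^ n • x → pc.d v x (f₁ ^ n • x) ≤ B := by
    intro n v h1 h2
    have := hB₁ 0 n v (by simpa using h1) (by simpa using h2)
    rw [zpow_zero, one_smul, zpow_natCast] at this
    exact this.trans hb1
  have r₂ : ∀ n : ℕ, ∀ v, v ≠ x → v ≠ f₂ ^ n • x → pc.d v x (f₂ ^ n • x) ≤ B := by
    intro n v h1 h2
    have := hB₂ 0 n v (by simpa using h1) (by simpa using h2)
    rw [zpow_zero, one_smul, zpow_natCast] at this
    exact this.trans hb2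
  let _ : MulAction (G ⧸ H) (Quotient (qdSetoid hact H)) := quotAct hact H
  set δ := ⌈δ₀⌉₊ with hδ
  have hδ' : δ₀ ≤ δ := Nat.le_ceil δ₀
  have act : ∀ (g : G) (y : Y), ((g : G ⧸ H) • (⟦y⟧ : Quotient (qdSetoid hact H))) = ⟦g • y⟧ :=
    fun g y => rfl
  have dd : ∀ y z : Y, qDist hact H ⟦y⟧ ⟦z⟧ = qd pc H y z := fun y z => rfl
  have hsymm : ∀ a b, qDist hact H a b = qDist hact H b a := by
    rintro ⟨a⟩ ⟨b⟩
    exact qd_comm hact a b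
  have htri : ∀ a b c, qDist hact H a c ≤ qDist hact H a b + qDist hact H b c := by
    rintro ⟨a⟩ ⟨b⟩ ⟨c⟩
    exact qd_triangle hact a b c
  have hgeod : ∀ a b i, i ≤ qDist hact H a b →
      ∃ m, qDist hact H a m = i ∧ qDist hact H m b = qDist hact H a b - i := by
    rintro ⟨a⟩ ⟨b⟩ i hi
    obtain ⟨m, h1, h2⟩ := qd_geodesic a b hi hact
    exact ⟨⟦m⟧, h1, h2⟩
  have hthin : ∀ a m b c, qDist hact H a m + qDist hact H m b = qDist hact H a b →
      qDist hact H c m + qDist hact H a m ≤ qDist hact H a c + 2 * δ ∨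
        qDist hact H c m + qDist hact H b m ≤ qDist hact H b c + 2 * δ := by
    rintro ⟨a⟩ ⟨m⟩ ⟨b⟩ ⟨c⟩ h
    exact qd_thin hb hact hR.1 hRH hHn hred hK hBΘ hP hδ' a m b c h
  refine ⟨Quotient (qdSetoid hact H), inferInstance, qDist hact H, 2 * (2 * δ) + 1,
    (f₁ : G ⧸ H), (f₂ : G ⧸ H), ⟦x⟧, ?_, ?_⟩
  · refine ⟨?_, hsymm, htri, hgeod, four_point_of_thin hsymm htri hgeod hthin, ?_⟩
    · rintro ⟨a⟩ ⟨b⟩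
      exact (Quotient.eq (r := qdSetoid hact H)).symm
    · intro γ
      induction γ using QuotientGroup.induction_on with
      | H g =>
        rintro ⟨a⟩ ⟨b⟩
        exact qd_smul hact g a b
  · refine ⟨?_, ?_, ?_, ?_⟩
    · obtain ⟨k, n₀, h⟩ := g₁
      refine ⟨k, n₀, fun n hn => ?_⟩
      rw [← QuotientGroup.mk_pow, act, dd, rig (r₁ n)]
      exact h n hn
    · intro D
      obtain ⟨M, hM⟩ := hf₁.2 x D (Nat.cast_nonneg D)
      refine ⟨M, (hM.image (fun g : G => (g : G ⧸ H))).subset ?_⟩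
      intro γ
      induction γ using QuotientGroup.induction_on with
      | H g =>
        rintro ⟨h1, h2⟩
        rw [← QuotientGroup.mk_pow, act, act, dd] at h2
        rw [act, dd] at h1
        obtain ⟨h, hh, e1, e2⟩ :=
          exists_lift_of_rigid hb hact hR.1 hRH hHn hred hK hBΘ (r₁ M) g
        refine ⟨h * g, ⟨?_, ?_⟩, ?_⟩
        · rw [e1]; exact_mod_cast h1
        · rw [e2]; exact_mod_cast h2
        · refine QuotientGroup.eq.2 ?_
          have := hHn.conj_mem _ (inv_mem hh) g⁻¹
          simpa [mul_assoc] using this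
    · intro C
      obtain ⟨k, n₀, h⟩ := g₂
      refine ⟨max n₀ (k * C + 1), fun n hn => ?_⟩
      rw [← QuotientGroup.mk_pow, act, dd, rig (r₂ n)]
      have h1 := h n ((le_max_left _ _).trans hn)
      have h2 := (le_max_right _ _).trans hn
      by_contra hlt
      push Not at hlt
      have := Nat.mul_le_mul_left k hlt.le
      omega
    · intro C
      obtain ⟨N, hN⟩ := hind C
      refine ⟨N, fun m n hm hn => ?_⟩
      rw [← QuotientGroup.mk_zpow, ← QuotientGroup.mk_zpow, act, act, dd, rig]
      · exact_mod_cast hN m n hm hn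
      · intro v h1 h2
        exact (hB₃ m n v h1 h2).trans hb3

/-- A system of projection distances. -/
structure ProjSys {V : Type*} (pd : V → V → V → ℕ) (θ : ℕ) : Prop where
  symm : ∀ S a b, pd S a b = pd S b a
  tri : ∀ S a b c, a ≠ S → b ≠ S → c ≠ S → pd S a c ≤ pd S a b + pd S b c
  self : ∀ S a, a ≠ S → pd S a a ≤ θ
  triple : ∀ x y z, x ≠ y → y ≠ z → x ≠ z → θ < pd y x z → pd z x y ≤ θ
  fin : ∀ a b, {S | S ≠ a ∧ S ≠ b ∧ θ < pd S a b}.Finite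

/-- A system of projection distances for which large projections determine further projections
exactly. -/
structure StrongProj {V : Type*} (D : V → V → V → ℕ) (Θ : ℕ) : Prop where
  symm : ∀ S a b, D S a b = D S b a
  tri : ∀ S a b c, a ≠ S → b ≠ S → c ≠ S → D S a c ≤ D S a b + D S b c
  self : ∀ S a, a ≠ S → D S a a ≤ Θ
  exact : ∀ S T a w, a ≠ T → T ≠ S → a ≠ S → Θ < D T a S → D S a w = D S T w
  fin : ∀ a b, {S | S ≠ a ∧ S ≠ b ∧ Θ < D S a b}.Finite

section chain
variable {V : Type*} {pd : V → V → V → ℕ} {θ : ℕ} {S : V}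

/-- `T` separates `a` from `S` by at least `K`, or coincides with `a`. -/
def Blk (pd : V → V → V → ℕ) (S : V) (K : ℕ) (a T : V) : Prop :=
  T ≠ S ∧ a ≠ S ∧ (a = T ∨ K < pd T a S)

theorem Blk.refl {K : ℕ} {a : V} (h : a ≠ S) : Blk pd S K a a := ⟨h, h, Or.inl rfl⟩

theorem Blk.mono {K K' : ℕ} {a T : V} (h : Blk pd S K a T) (hK : K' ≤ K) : Blk pd S K' a T :=
  ⟨h.1, h.2.1, h.2.2.imp id fun h => lt_of_le_of_lt hK h⟩

theorem Blk.proj_le {a T : V} (hp : ProjSys pd θ) (h : Blk pd S θ a T) : pd S a T ≤ θ := by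
  obtain ⟨h1, h2, h3⟩ := h
  by_cases h : a = T
  · subst h; exact hp.self _ _ h2
  · exact hp.triple a T S h h1 h2 (h3.resolve_left h)

theorem Blk.back {a T : V} (hp : ProjSys pd θ) (h : Blk pd S θ a T) (hne : a ≠ T) :
    pd a T S ≤ θ := by
  obtain ⟨h1, h2, h3⟩ := h
  rw [hp.symm]
  refine hp.triple S T a h1.symm hne.symm h2.symm ?_
  rw [hp.symm]
  exact h3.resolve_left hne

theorem Blk.cmp {K K' : ℕ} {v p q : V} (hp : ProjSys pd θ) (h : Blk pd S (K + θ) v p)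
    (h' : Blk pd S (K' + θ) v q) : Blk pd S K q p ∨ Blk pd S K' p q := by
  obtain ⟨h1, h2, h3⟩ := h
  obtain ⟨h1', -, h3'⟩ := h'
  by_cases hpq : p = q
  · subst hpq; exact Or.inl (Blk.refl h1)
  by_cases hvp : v = p
  · subst hvp
    exact Or.inr ⟨h1', h1, Or.inr (by have := h3'.resolve_left hpq; omega)⟩
  by_cases hvq : v = q
  · subst hvq
    exact Or.inl ⟨h1, h1', Or.inr (by have := h3.resolve_left hvp; omega)⟩
  have a1 := h3.resolve_left hvp
  have a2 := h3'.resolve_left hvq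
  rcases le_or_gt (pd p v q) θ with h | h
  · have := hp.tri p v q S hvp (Ne.symm hpq) h1.symm
    exact Or.inl ⟨h1, h1', Or.inr (by omega)⟩
  · have b1 := hp.triple v p q hvp hpq hvq h
    have b2 := hp.tri q v p S hvq hpq h1'.symm
    exact Or.inr ⟨h1', h1, Or.inr (by omega)⟩

theorem Blk.near {a j m : V} (hp : ProjSys pd θ) (h : Blk pd S (2 * θ) a j)
    (h' : Blk pd S θ j m) (hjm : j ≠ m) : a ≠ m ∧ pd m a j ≤ θ := by
  have h1 := h'.back hp hjm
  have ham : a ≠ m := by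
    rintro rfl
    have := h.2.2.resolve_left hjm.symm
    omega
  refine ⟨ham, ?_⟩
  by_cases haj : a = j
  · subst haj; exact hp.self _ _ hjm
  · have h2 := h.2.2.resolve_left haj
    have h3 := hp.tri j a m S haj hjm.symm h.1.symm
    exact hp.triple a j m haj hjm ham (by omega)

theorem exists_center (hp : ProjSys pd θ) : ∀ (n : ℕ) (p v : ℕ → V), p 0 ≠ S →
    (∀ i < n, Blk pd S (10 * θ) (v i) (p i) ∧ Blk pd S (10 * θ) (v i) (p (i + 1))) →
    ∃ m ≤ n, ∀ i ≤ n, Blk pd S (6 * θ) (p i) (p m) := by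
  intro n
  induction n using Nat.strong_induction_on with
  | _ n ih =>
  intro p v h0 hv
  rcases n with _ | n
  · refine ⟨0, le_rfl, fun i hi => ?_⟩
    obtain rfl : i = 0 := by omega
    exact Blk.refl h0
  obtain ⟨m, hm, hc⟩ := ih n (by omega) p v h0 fun i hi => hv i (by omega)
  have hS : ∀ i ≤ n + 1, p i ≠ S := by
    intro i hi
    rcases i with _ | i
    · exact h0
    · exact (hv i (by omega)).2.1
  have cmp9 : ∀ i < n + 1, Blk pd S (9 * θ) (p (i + 1)) (p i) ∨
      Blk pd S (9 * θ) (p i) (p (i + 1)) := by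
    intro i hi
    exact Blk.cmp hp ((hv i hi).1.mono (by omega)) ((hv i hi).2.mono (by omega))
  have key : Blk pd S θ (p (n + 1)) (p m) → Blk pd S (6 * θ) (p (n + 1)) (p m) := by
    intro hk
    obtain ⟨j', hj', hcj⟩ := ih (n - m) (by omega) (fun i => p (m + 1 + i)) (fun i => v (m + 1 + i))
      (hS _ (by omega)) (fun i hi => hv (m + 1 + i) (by omega))
    set j := m + 1 + j' with hj
    have hcj' : ∀ i, m + 1 ≤ i → i ≤ n + 1 → Blk pd S (6 * θ) (p i) (p j) := by
      intro i h1 h2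
      have := hcj (i - (m + 1)) (by omega)
      rwa [show m + 1 + (i - (m + 1)) = i by omega] at this
    have all : ∀ i ≤ n + 1, Blk pd S θ (p i) (p m) := by
      intro i hi
      rcases Nat.lt_or_ge n i with h | h
      · obtain rfl : i = n + 1 := by omega
        exact hk
      · exact (hc i h).mono (by omega)
    by_cases hjm : p j = p m
    · rw [← hjm]; exact hcj' _ (by omega) le_rfl
    have n1 := ((hcj' (n + 1) (by omega) le_rfl).mono (by omega)).near hp (all j (by omega)) hjm
    have n2 := ((hcj' (m + 1) (by omega) (by omega)).mono (by omega)).near hp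
      (all j (by omega)) hjm
    have n3 : 9 * θ < pd (p m) (p (m + 1)) S := by
      rcases cmp9 m (by omega) with h | h
      · exact h.2.2.resolve_left n2.1
      · have := h.2.2.resolve_left n2.1.symm
        have := (all (m + 1) (by omega)).back hp n2.1
        rw [hp.symm] at this
        have := (h.mono (K' := θ) (by omega)).back hp n2.1.symm
        have := (all (m + 1) (by omega)).2.2.resolve_left n2.1
        omega
    have hSm := hS m (by omega)
    have t1 := hp.tri (p m) (p (m + 1)) (p j) S n2.1 hjm hSm.symm
    have t2 := hp.tri (p m) (p j) (p (n + 1)) S hjm n1.1 hSm.symm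
    have s := hp.symm (p m) (p j) (p (n + 1))
    exact ⟨hSm, hS _ le_rfl, Or.inr (by omega)⟩
  have done : Blk pd S θ (p (n + 1)) (p m) →
      ∃ m ≤ n + 1, ∀ i ≤ n + 1, Blk pd S (6 * θ) (p i) (p m) := by
    intro hk
    refine ⟨m, by omega, fun i hi => ?_⟩
    rcases Nat.lt_or_ge n i with h | h
    · obtain rfl : i = n + 1 := by omega
      exact key hk
    · exact hc i h
  have hSm := hS m (by omega)
  rcases cmp9 n (by omega) with h | h
  · refine done ?_
    by_cases hnm : p n = p m
    · rw [← hnm]; exact h.mono (by omega)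
    have n1 := (h.mono (by omega)).near hp ((hc n le_rfl).mono (by omega)) hnm
    have n2 := (hc n le_rfl).2.2.resolve_left hnm
    have t := hp.tri (p m) (p n) (p (n + 1)) S hnm n1.1 hSm.symm
    have s := hp.symm (p m) (p n) (p (n + 1))
    exact ⟨hSm, hS _ le_rfl, Or.inr (by omega)⟩
  · rcases Blk.cmp (K := 8 * θ) (K' := 5 * θ) hp (h.mono (by omega))
      ((hc n le_rfl).mono (by omega)) with h' | h'
    · by_cases hmn : p m = p (n + 1)
      · exact done (by rw [hmn]; exact Blk.refl (hS _ le_rfl))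
      refine ⟨n + 1, le_rfl, fun i hi => ?_⟩
      rcases Nat.lt_or_ge n i with hi' | hi'
      · obtain rfl : i = n + 1 := by omega
        exact Blk.refl (hS _ le_rfl)
      · have n1 := ((hc i hi').mono (by omega)).near hp (h'.mono (by omega)) hmn
        have n2 := h'.2.2.resolve_left hmn
        have t := hp.tri (p (n + 1)) (p m) (p i) S hmn n1.1 (hS _ le_rfl).symm
        have s := hp.symm (p (n + 1)) (p m) (p i)
        exact ⟨hS _ le_rfl, hS _ hi, Or.inr (by omega)⟩
    · exact done (h'.mono (by omega))

/-- Two vertices are directly linked, as seen from `S`, if some vertex blocks both. -/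
def Link (pd : V → V → V → ℕ) (θ : ℕ) (S a b : V) : Prop :=
  ∃ T, Blk pd S (10 * θ) a T ∧ Blk pd S (10 * θ) b T

/-- Two vertices lie on the same side as seen from `S`. -/
def Side (pd : V → V → V → ℕ) (θ : ℕ) (S a b : V) : Prop :=
  Relation.ReflTransGen (Link pd θ S) a b

theorem Side.symm {a b : V} (h : Side pd θ S a b) : Side pd θ S b a :=
  have : Std.Symm (Link pd θ S) := ⟨fun _ _ ⟨T, h1, h2⟩ => ⟨T, h2, h1⟩⟩
  Relation.ReflTransGen.stdSymm.symm _ _ h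

theorem Side.exists_chain {a b : V} (ha : a ≠ S) (h : Side pd θ S a b) :
    ∃ (n : ℕ) (p v : ℕ → V), p 0 ≠ S ∧
    (∀ i < n, Blk pd S (10 * θ) (v i) (p i) ∧ Blk pd S (10 * θ) (v i) (p (i + 1))) ∧
    Blk pd S (10 * θ) a (p 0) ∧ Blk pd S (10 * θ) b (p n) := by
  induction h with
  | refl => exact ⟨0, fun _ => a, fun _ => a, ha, by simp, Blk.refl ha, Blk.refl ha⟩
  | @tail b c _ hbc ih =>
    obtain ⟨n, p, v, h0, hv, h1, h2⟩ := ih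
    obtain ⟨T, hT1, hT2⟩ := hbc
    refine ⟨n + 1, fun i => if i = n + 1 then T else p i, fun i => if i = n then b else v i,
      by simpa using h0, ?_, by simpa using h1, by simpa using hT2⟩
    intro i hi
    rcases Nat.lt_or_ge i n with h | h
    · simpa [show i ≠ n + 1 by omega, show i ≠ n by omega] using hv i h
    · obtain rfl : i = n := by omega
      simpa using ⟨h2, hT1⟩

theorem Side.bound {a b : V} (hp : ProjSys pd θ) (ha : a ≠ S) (h : Side pd θ S a b) :
    b ≠ S ∧ pd S a b ≤ 4 * θ := by
  obtain ⟨n, p, v, h0, hv, h1, h2⟩ := h.exists_chain ha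
  refine ⟨h2.2.1, ?_⟩
  obtain ⟨m, hm, hc⟩ := exists_center hp n p v h0 hv
  have c0 := hc 0 (by omega)
  have cn := hc n le_rfl
  have e1 := (h1.mono (K' := θ) (by omega)).proj_le hp
  have e2 := (h2.mono (K' := θ) (by omega)).proj_le hp
  have e3 := (c0.mono (K' := θ) (by omega)).proj_le hp
  have e4 := (cn.mono (K' := θ) (by omega)).proj_le hp
  have t1 := hp.tri S a (p 0) b ha h0 h2.2.1
  have t2 := hp.tri S (p 0) (p m) b h0 c0.1 h2.2.1
  have t3 := hp.tri S (p m) (p n) b c0.1 h2.1 h2.2.1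
  have s1 := hp.symm S (p m) (p n)
  have s2 := hp.symm S b (p n)
  omega

/-- The projection distance between sides. -/
noncomputable def sideDist (pd : V → V → V → ℕ) (θ : ℕ) (S a b : V) : ℕ :=
  sSup {n | ∃ a' b', Side pd θ S a a' ∧ Side pd θ S b b' ∧ n = pd S a' b'}

theorem sideDist_bdd (hp : ProjSys pd θ) {a b a' b' : V} (ha : a ≠ S) (hb : b ≠ S)
    (h : Side pd θ S a a') (h' : Side pd θ S b b') : pd S a' b' ≤ pd S a b + 8 * θ := by
  obtain ⟨ha', e1⟩ := h.bound hp ha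
  obtain ⟨hb', e2⟩ := h'.bound hp hb
  have t1 := hp.tri S a' a b' ha' ha hb'
  have t2 := hp.tri S a b b' ha hb hb'
  have s1 := hp.symm S a' a
  omega

theorem le_sideDist (hp : ProjSys pd θ) {a b a' b' : V} (ha : a ≠ S) (hb : b ≠ S)
    (h : Side pd θ S a a') (h' : Side pd θ S b b') : pd S a' b' ≤ sideDist pd θ S a b :=
  le_csSup ⟨pd S a b + 8 * θ, by
    rintro n ⟨a', b', h, h', rfl⟩
    exact sideDist_bdd hp ha hb h h'⟩ ⟨a', b', h, h', rfl⟩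

theorem sideDist_le {a b : V} {C : ℕ}
    (h : ∀ a' b', Side pd θ S a a' → Side pd θ S b b' → pd S a' b' ≤ C) :
    sideDist pd θ S a b ≤ C := by
  refine csSup_le ⟨_, a, b, .refl, .refl, rfl⟩ ?_
  rintro n ⟨a', b', h1, h2, rfl⟩
  exact h a' b' h1 h2

theorem sideDist_le_add (hp : ProjSys pd θ) {a b : V} (ha : a ≠ S) (hb : b ≠ S) :
    sideDist pd θ S a b ≤ pd S a b + 8 * θ :=
  sideDist_le fun _ _ h h' => sideDist_bdd hp ha hb h h'

theorem pd_le_sideDist (hp : ProjSys pd θ) {a b : V} (ha : a ≠ S) (hb : b ≠ S) :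
    pd S a b ≤ sideDist pd θ S a b :=
  le_sideDist hp ha hb .refl .refl

theorem strongProj_sideDist (hp : ProjSys pd θ) : StrongProj (sideDist pd θ) (20 * θ) where
  symm S a b := by
    unfold sideDist
    congr 1
    ext n
    constructor <;> rintro ⟨a', b', h1, h2, rfl⟩ <;> exact ⟨b', a', h2, h1, hp.symm _ _ _⟩
  tri S a b c ha hb hc := by
    refine sideDist_le fun a' c' h h' => ?_
    have := hp.tri S a' b c' (h.bound hp ha).1 hb (h'.bound hp hc).1
    have h1 := le_sideDist hp ha hb h .refl
    have h2 := le_sideDist hp hb hc .refl h'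
    omega
  self S a ha := by
    have := sideDist_le_add hp ha ha
    have := hp.self S a ha
    omega
  exact S T a w haT hTS haS h := by
    have h1 := sideDist_le_add hp haT hTS.symm
    have hb : Blk pd S (10 * θ) a T := ⟨hTS, haS, Or.inr (by omega)⟩
    have hs : Side pd θ S a T := .single ⟨T, hb, Blk.refl hTS⟩
    unfold sideDist
    congr 1
    ext n
    constructor
    · rintro ⟨a', b', h1, h2, rfl⟩
      exact ⟨a', b', hs.symm.trans h1, h2, rfl⟩
    · rintro ⟨a', b', h1, h2, rfl⟩
      exact ⟨a', b', hs.trans h1, h2, rfl⟩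
  fin a b := by
    refine (hp.fin a b).subset ?_
    rintro S ⟨h1, h2, h3⟩
    have := sideDist_le_add hp h1.symm h2.symm
    exact ⟨h1, h2, by omega⟩

theorem sideDist_smul {Γ : Type*} [Group Γ] [MulAction Γ V]
    (hinv : ∀ (g : Γ) S a b, pd (g • S) (g • a) (g • b) = pd S a b) (g : Γ) (S a b : V) :
    sideDist pd θ (g • S) (g • a) (g • b) = sideDist pd θ S a b := by
  have blk : ∀ (g : Γ) {K : ℕ} {S a T : V}, Blk pd S K a T →
      Blk pd (g • S) K (g • a) (g • T) := by
    rintro g K S a T ⟨h1, h2, h3⟩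
    refine ⟨by simpa using h1, by simpa using h2, ?_⟩
    rw [hinv]
    exact h3.imp (congrArg _) id
  have side : ∀ (g : Γ) {S a b : V}, Side pd θ S a b → Side pd θ (g • S) (g • a) (g • b) := by
    intro g S a b h
    refine Relation.ReflTransGen.lift (p := Link pd θ (g • S)) (fun v : V => g • v) ?_ _ _ h
    rintro a b ⟨T, h1, h2⟩
    exact ⟨g • T, blk g h1, blk g h2⟩
  have sub : ∀ (g : Γ) (S a b : V),
      {n | ∃ a' b', Side pd θ S a a' ∧ Side pd θ S b b' ∧ n = pd S a' b'} ⊆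
      {n | ∃ a' b', Side pd θ (g • S) (g • a) a' ∧ Side pd θ (g • S) (g • b) b' ∧
        n = pd (g • S) a' b'} := by
    rintro g S a b n ⟨a', b', h1, h2, rfl⟩
    exact ⟨g • a', g • b', side g h1, side g h2, (hinv _ _ _ _).symm⟩
  unfold sideDist
  congr 1
  refine Set.Subset.antisymm ?_ (sub g S a b)
  simpa using sub g⁻¹ (g • S) (g • a) (g • b)

end chain

/-- An acylindrical action with an element of positive translation length on a roughly geodesic
hyperbolic space with integer distances. -/
structure AcylData {Γ V : Type*} [Group Γ] [MulAction Γ V] (σ : V → V → ℕ) (c : ℕ) : Prop where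
  self : ∀ a, σ a a = 0
  symm : ∀ a b, σ a b = σ b a
  tri : ∀ a b e, σ a e ≤ σ a b + σ b e
  hyp : ∀ a b e u, σ a b + σ e u ≤ σ a e + σ b u + c ∨ σ a b + σ e u ≤ σ a u + σ b e + c
  geod : ∀ a b i, i ≤ σ a b → ∃ m, σ a m ≤ i + c ∧ σ m b ≤ σ a b - i + c
  inv : ∀ (g : Γ) a b, σ (g • a) (g • b) = σ a b
  acyl : ∀ C, ∃ r N, ∀ y z, r ≤ σ y z → {g : Γ | σ y (g • y) ≤ C ∧ σ z (g • z) ≤ C}.Finite ∧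
    {g : Γ | σ y (g • y) ≤ C ∧ σ z (g • z) ≤ C}.ncard ≤ N
  lox : ∃ (f : Γ) (v : V), ∀ n, n ≤ σ v (f ^ n • v) + c

section count
variable {V : Type*} {D : V → V → V → ℕ} {Θ : ℕ}

/-- The vertices strongly separating two vertices. -/
def sep (D : V → V → V → ℕ) (Θ : ℕ) (a b : V) : Set V := {S | S ≠ a ∧ S ≠ b ∧ 2 * Θ < D S a b}

/-- The number of vertices strongly separating two vertices. -/
noncomputable def rk (D : V → V → V → ℕ) (Θ : ℕ) (a b : V) : ℕ := (sep D Θ a b).ncard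

theorem sep_comm (h : StrongProj D Θ) (a b : V) : sep D Θ a b = sep D Θ b a := by
  ext S
  simp only [sep, Set.mem_ofPred_eq, h.symm S a b]
  tauto

theorem rk_comm (h : StrongProj D Θ) (a b : V) : rk D Θ a b = rk D Θ b a := by
  rw [rk, sep_comm h, rk]

theorem sep_finite (h : StrongProj D Θ) (a b : V) : (sep D Θ a b).Finite :=
  (h.fin a b).subset fun S hS => ⟨hS.1, hS.2.1, by have := hS.2.2; omega⟩

theorem rk_self (h : StrongProj D Θ) (a : V) : rk D Θ a a = 0 := by
  rw [rk, Set.ncard_eq_zero (sep_finite h a a), Set.eq_empty_iff_forall_notMem]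
  rintro S ⟨h1, -, h2⟩
  have := h.self S a h1.symm
  omega

/-- `T` weakly separates `a` and `b`. -/
def Wk (D : V → V → V → ℕ) (Θ : ℕ) (T a b : V) : Prop := T ≠ a ∧ T ≠ b ∧ Θ < D T a b

theorem Wk.ne (h : StrongProj D Θ) {T a b : V} (hw : Wk D Θ T a b) : a ≠ b := by
  rintro rfl
  have := h.self T a hw.1.symm
  have := hw.2.2
  omega

theorem Wk.symm (h : StrongProj D Θ) {T a b : V} (hw : Wk D Θ T a b) : Wk D Θ T b a :=
  ⟨hw.2.1, hw.1, by rw [h.symm]; exact hw.2.2⟩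

theorem wk_of_sep {T a b : V} (hT : T ∈ sep D Θ a b) : Wk D Θ T a b :=
  ⟨hT.1, hT.2.1, by have := hT.2.2; omega⟩

theorem Wk.exact (h : StrongProj D Θ) {T a b : V} (hw : Wk D Θ T a b) (w : V) :
    D b a w = D b T w :=
  h.exact b T a w hw.1.symm hw.2.1 (hw.ne h) hw.2.2

theorem Wk.sep_subset (h : StrongProj D Θ) {T a b : V} (hw : Wk D Θ T a b) :
    sep D Θ a T ⊆ sep D Θ a b := by
  intro S hS
  have e := (wk_of_sep hS).exact h b
  have h1 : Θ < D T S b := e ▸ hw.2.2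
  have hSb : S ≠ b := by
    rintro rfl
    have := h.self T S hS.2.1
    omega
  have hw' : Wk D Θ T b S := ⟨hw.2.1, hS.2.1.symm, by rwa [h.symm]⟩
  have e2 := hw'.exact h a
  refine ⟨hS.1, hSb, ?_⟩
  rw [h.symm, e2, h.symm]
  exact hS.2.2

theorem Wk.sep_subset' (h : StrongProj D Θ) {T a b : V} (hw : Wk D Θ T a b) :
    sep D Θ T b ⊆ sep D Θ a b := by
  rw [sep_comm h T b, sep_comm h a b]
  exact (hw.symm h).sep_subset h

theorem Wk.disjoint (h : StrongProj D Θ) {T a b : V} (hw : Wk D Θ T a b) :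
    Disjoint (sep D Θ a T) (sep D Θ T b) := by
  rw [Set.disjoint_left]
  intro S h1 h2
  have e1 := (wk_of_sep h1).exact h b
  have e2 := ((wk_of_sep h2).symm h).exact h S
  have := h.self T S h1.2.1
  have := h.symm T S b
  have := hw.2.2
  omega

theorem Wk.rk_le (h : StrongProj D Θ) {T a b : V} (hw : Wk D Θ T a b) :
    rk D Θ a T + rk D Θ T b ≤ rk D Θ a b := by
  rw [rk, rk, ← Set.ncard_union_eq (hw.disjoint h) (sep_finite h _ _) (sep_finite h _ _)]
  exact Set.ncard_le_ncard (Set.union_subset (hw.sep_subset h) (hw.sep_subset' h))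
    (sep_finite h _ _)

theorem sep_split (h : StrongProj D Θ) {T S a b : V} (hT : T ∈ sep D Θ a b)
    (hS : S ∈ sep D Θ a b) (hne : S ≠ T) : S ∈ sep D Θ a T ∨ S ∈ sep D Θ T b := by
  have t := h.tri T a S b hT.1.symm hne hT.2.1.symm
  have := hT.2.2
  rcases (by omega : Θ < D T a S ∨ Θ < D T S b) with h1 | h1
  · have hw : Wk D Θ T a S := ⟨hT.1, hne.symm, h1⟩
    exact Or.inr ⟨hne, hS.2.1, by rw [← hw.exact h b]; exact hS.2.2⟩
  · have hw : Wk D Θ T b S := ⟨hT.2.1, hne.symm, by rwa [h.symm]⟩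
    refine Or.inl ⟨hS.1, hne, ?_⟩
    rw [h.symm, ← hw.exact h a, h.symm]
    exact hS.2.2

theorem rk_eq_of_sep (h : StrongProj D Θ) {T a b : V} (hT : T ∈ sep D Θ a b) :
    rk D Θ a b = rk D Θ a T + rk D Θ T b + 1 := by
  have hw := wk_of_sep hT
  have e : sep D Θ a b = insert T (sep D Θ a T ∪ sep D Θ T b) := by
    ext S
    constructor
    · intro hS
      by_cases hne : S = T
      · exact Or.inl hne
      · exact Or.inr (sep_split h hT hS hne)
    · rintro (rfl | hS | hS)
      · exact hT
      · exact hw.sep_subset h hS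
      · exact hw.sep_subset' h hS
  rw [rk, e, Set.ncard_insert_of_notMem _ ((sep_finite h _ _).union (sep_finite h _ _)),
    Set.ncard_union_eq (hw.disjoint h) (sep_finite h _ _) (sep_finite h _ _)]
  · rfl
  · rintro (hS | hS)
    · exact hS.2.1 rfl
    · exact hS.1 rfl

theorem rk_injOn (h : StrongProj D Θ) (a b : V) : Set.InjOn (rk D Θ a) (sep D Θ a b) := by
  intro T hT S hS e
  by_contra hne
  have h1 := rk_eq_of_sep h hT
  have h2 := rk_eq_of_sep h hS
  rcases sep_split h hS hT hne with h3 | h3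
  · have := rk_eq_of_sep h h3; omega
  · have := rk_eq_of_sep h h3; omega

theorem exists_rk (h : StrongProj D Θ) (a b : V) {k : ℕ} (hk : k < rk D Θ a b) :
    ∃ T ∈ sep D Θ a b, rk D Θ a T = k ∧ rk D Θ T b + k + 1 = rk D Θ a b := by
  have hfin := sep_finite h a b
  have sub : hfin.toFinset.image (rk D Θ a) ⊆ Finset.range (rk D Θ a b) := by
    intro n hn
    obtain ⟨T, hT, rfl⟩ := Finset.mem_image.1 hn
    have := rk_eq_of_sep h (hfin.mem_toFinset.1 hT)
    exact Finset.mem_range.2 (by omega)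
  have card : (Finset.range (rk D Θ a b)).card ≤ (hfin.toFinset.image (rk D Θ a)).card := by
    rw [Finset.card_image_of_injOn, Finset.card_range, rk, Set.ncard_eq_toFinset_card _ hfin]
    simpa using rk_injOn h a b
  have e := Finset.eq_of_subset_of_card_le sub card
  obtain ⟨T, hT, hTk⟩ := Finset.mem_image.1 (e ▸ Finset.mem_range.2 hk)
  have hT' := hfin.mem_toFinset.1 hT
  have := rk_eq_of_sep h hT'
  exact ⟨T, hT', hTk, by omega⟩

/-- Every vertex is weakly separated by `T` from one of the ends. -/
theorem rk_alt (h : StrongProj D Θ) {T a b : V} (hT : T ∈ sep D Θ a b) (w : V) :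
    rk D Θ a T + rk D Θ T w ≤ rk D Θ a w ∨ rk D Θ b T + rk D Θ T w ≤ rk D Θ b w := by
  by_cases hw : T = w
  · subst hw; rw [rk_self h]; simp
  have t := h.tri T a w b hT.1.symm (Ne.symm hw) hT.2.1.symm
  have := hT.2.2
  have s := h.symm T w b
  rcases (by omega : Θ < D T a w ∨ Θ < D T b w) with h1 | h1
  · exact Or.inl (Wk.rk_le h ⟨hT.1, hw, h1⟩)
  · exact Or.inr (Wk.rk_le h ⟨hT.2.1, hw, h1⟩)

theorem rk_tri (h : StrongProj D Θ) (a w b : V) :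
    rk D Θ a b ≤ rk D Θ a w + rk D Θ w b + 2 := by
  by_contra hlt
  push Not at hlt
  obtain ⟨T, hT, h1, h2⟩ := exists_rk h a b (k := rk D Θ a w + 1) (by omega)
  have := rk_alt h hT w
  have := rk_comm h b T
  have := rk_comm h w b
  omega

theorem rk_hyp (h : StrongProj D Θ) (a b e u : V) :
    rk D Θ a b + rk D Θ e u ≤ rk D Θ a e + rk D Θ b u + 20 ∨
      rk D Θ a b + rk D Θ e u ≤ rk D Θ a u + rk D Θ b e + 20 := by
  have t1 := rk_tri h e a u
  have t2 := rk_tri h a b u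
  have s1 := rk_comm h e a
  have t3 := rk_tri h a b e
  have t4 := rk_tri h b a e
  have t5 := rk_tri h a e b
  have s2 := rk_comm h b a
  have s3 := rk_comm h b e
  rcases Nat.eq_zero_or_pos (rk D Θ a b) with h0 | h0
  · omega
  obtain ⟨T, hT, h1, h2⟩ := exists_rk h a b
    (k := min (rk D Θ a b - 1) ((rk D Θ a b + rk D Θ a e - rk D Θ b e) / 2)) (by omega)
  have c1 := rk_alt h hT e
  have c2 := rk_alt h hT u
  have t6 := rk_tri h e T u
  have s3 := rk_comm h e T
  have s4 := rk_comm h b T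
  omega

theorem mem_sep_move (h : StrongProj D Θ) {S y z w : V} {C : ℕ} (hS : S ∈ sep D Θ y z)
    (hw : rk D Θ y w ≤ C) (hSC : C + 1 < rk D Θ y S) : S ∈ sep D Θ w z := by
  have hr := rk_eq_of_sep h hS
  obtain ⟨T, hT, h1, h2⟩ := exists_rk h y z (k := C + 1) (by omega)
  have hST : S ≠ T := by
    rintro rfl
    omega
  have hSTz : S ∈ sep D Θ T z := by
    refine (sep_split h hT hS hST).resolve_left fun h3 => ?_
    have := rk_eq_of_sep h h3
    omega
  by_cases hTw : T = w
  · rwa [← hTw]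
  have hle : D T y w ≤ Θ := by
    by_contra hlt
    push Not at hlt
    have := Wk.rk_le h (T := T) (a := y) (b := w) ⟨hT.1, hTw, hlt⟩
    omega
  have t := h.tri T y w z hT.1.symm (Ne.symm hTw) hT.2.1.symm
  have := hT.2.2
  exact Wk.sep_subset' h ⟨hTw, hT.2.1, by omega⟩ hSTz

theorem ncard_le_of_fibers {α : Type*} {A : Set α} (f : α → ℕ × ℕ) {m N : ℕ}
    (hf : ∀ a ∈ A, (f a).1 < m ∧ (f a).2 < m)
    (fib : ∀ b, {a ∈ A | f a = b}.Finite ∧ {a ∈ A | f a = b}.ncard ≤ N) :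
    A.Finite ∧ A.ncard ≤ N * (m * m) := by
  classical
  have hA : A ⊆ ⋃ b ∈ (Finset.range m ×ˢ Finset.range m), {a ∈ A | f a = b} := by
    intro a ha
    have := hf a ha
    simp only [Set.mem_iUnion]
    exact ⟨f a, by simpa using this, ha, rfl⟩
  have hfin : A.Finite :=
    (Set.Finite.biUnion (Finset.finite_toSet _) fun b _ => (fib b).1).subset hA
  refine ⟨hfin, ?_⟩
  rw [Set.ncard_eq_toFinset_card _ hfin]
  refine (Finset.card_le_mul_card_image_of_maps_to (f := f)
    (t := Finset.range m ×ˢ Finset.range m) ?_ N ?_).trans ?_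
  · intro a ha
    have := hf a (hfin.mem_toFinset.1 ha)
    simpa using this
  · intro b _
    refine le_trans (le_of_eq ?_) (fib b).2
    rw [Set.ncard_eq_toFinset_card _ (fib b).1]
    congr 1
    ext a
    simp
  · simp

end count

section action
variable {V Γ : Type*} [Group Γ] [MulAction Γ V] {D : V → V → V → ℕ} {Θ : ℕ}

theorem mem_sep_smul (hinv : ∀ (g : Γ) S a b, D (g • S) (g • a) (g • b) = D S a b)
    (g : Γ) {S a b : V} : g • S ∈ sep D Θ (g • a) (g • b) ↔ S ∈ sep D Θ a b := by
  simp [sep, hinv]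

theorem rk_smul (hinv : ∀ (g : Γ) S a b, D (g • S) (g • a) (g • b) = D S a b)
    (g : Γ) (a b : V) : rk D Θ (g • a) (g • b) = rk D Θ a b := by
  have : sep D Θ (g • a) (g • b) = (fun v : V => g • v) '' sep D Θ a b := by
    ext S
    constructor
    · intro hS
      refine ⟨g⁻¹ • S, ?_, smul_inv_smul g S⟩
      rw [← mem_sep_smul hinv g, smul_inv_smul]
      exact hS
    · rintro ⟨S, hS, rfl⟩
      exact (mem_sep_smul hinv g).2 hS
  rw [rk, this, Set.ncard_image_of_injective _ (MulAction.injective g), rk]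

theorem rk_acyl (h : StrongProj D Θ)
    (hinv : ∀ (g : Γ) S a b, D (g • S) (g • a) (g • b) = D S a b) {N : ℕ}
    (hstab : ∀ S T : V, S ≠ T → {g : Γ | g • S = S ∧ g • T = T}.Finite ∧
      {g : Γ | g • S = S ∧ g • T = T}.ncard ≤ N) (C : ℕ) (y z : V)
    (hyz : 2 * C + 20 ≤ rk D Θ y z) :
    {g : Γ | rk D Θ y (g • y) ≤ C ∧ rk D Θ z (g • z) ≤ C}.Finite ∧
    {g : Γ | rk D Θ y (g • y) ≤ C ∧ rk D Θ z (g • z) ≤ C}.ncard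
      ≤ N * ((2 * C + 6) * (2 * C + 6)) := by
  obtain ⟨S, hS, hS1, hS2⟩ := exists_rk h y z (k := C + 2) (by omega)
  obtain ⟨T, hT, hT1, hT2⟩ := exists_rk h y z (k := C + 3) (by omega)
  have hST : S ≠ T := by
    rintro rfl
    omega
  have move : ∀ U ∈ sep D Θ y z, C + 2 ≤ rk D Θ y U → rk D Θ y U ≤ C + 3 → ∀ g : Γ,
      rk D Θ y (g • y) ≤ C → rk D Θ z (g • z) ≤ C →
      g⁻¹ • U ∈ sep D Θ y z ∧ rk D Θ y (g⁻¹ • U) < 2 * C + 6 := by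
    intro U hU h1 h1' g hg hg'
    have h2 := mem_sep_move h hU hg (by omega)
    rw [sep_comm h] at h2
    have h3 := rk_eq_of_sep h hU
    have h4 := mem_sep_move h h2 hg' (by rw [rk_comm h]; omega)
    rw [sep_comm h] at h4
    constructor
    · rw [← mem_sep_smul hinv g, smul_inv_smul]
      exact h4
    · rw [← rk_smul hinv g, smul_inv_smul]
      have := rk_tri h (g • y) y U
      rw [rk_comm h (g • y) y] at this
      omega
  refine ncard_le_of_fibers (fun g => (rk D Θ y (g⁻¹ • S), rk D Θ y (g⁻¹ • T))) ?_ ?_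
  · rintro g ⟨h1, h2⟩
    exact ⟨(move S hS (by omega) (by omega) g h1 h2).2, (move T hT (by omega) (by omega) g h1 h2).2⟩
  · intro b
    rcases Set.eq_empty_or_nonempty {g ∈ {g : Γ | rk D Θ y (g • y) ≤ C ∧ rk D Θ z (g • z) ≤ C} |
        (rk D Θ y (g⁻¹ • S), rk D Θ y (g⁻¹ • T)) = b} with he | ⟨g₀, ⟨hg₀, hg₀'⟩, hb⟩
    · rw [he]; simp
    obtain ⟨hf, hN⟩ := hstab S T hST
    have sub : {g ∈ {g : Γ | rk D Θ y (g • y) ≤ C ∧ rk D Θ z (g • z) ≤ C} |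
        (rk D Θ y (g⁻¹ • S), rk D Θ y (g⁻¹ • T)) = b} ⊆
        (fun k => k * g₀) '' {g : Γ | g • S = S ∧ g • T = T} := by
      rintro g ⟨⟨hg, hg'⟩, hb'⟩
      rw [← hb, Prod.mk.injEq] at hb'
      have e : ∀ U ∈ sep D Θ y z, C + 2 ≤ rk D Θ y U → rk D Θ y U ≤ C + 3 →
          rk D Θ y (g⁻¹ • U) = rk D Θ y (g₀⁻¹ • U) → (g * g₀⁻¹) • U = U := by
        intro U hU h1 h2 h3
        have := rk_injOn h y z (move U hU h1 h2 g hg hg').1 (move U hU h1 h2 g₀ hg₀ hg₀').1 h3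
        rw [mul_smul, ← this, smul_inv_smul]
      exact ⟨g * g₀⁻¹, ⟨e S hS (by omega) (by omega) hb'.1, e T hT (by omega) (by omega) hb'.2⟩,
        by simp⟩
    exact ⟨(hf.image _).subset sub, (Set.ncard_le_ncard sub (hf.image _)).trans
      ((Set.ncard_image_le hf).trans hN)⟩

theorem rk_lox (h : StrongProj D Θ)
    (hinv : ∀ (g : Γ) S a b, D (g • S) (g • a) (g • b) = D S a b) {g : Γ} {v : V}
    (h1 : g⁻¹ • v ≠ v) (h2 : g • v ≠ v) (h3 : 2 * Θ < D v (g⁻¹ • v) (g • v)) (n : ℕ) :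
    n ≤ rk D Θ v (g ^ n • v) + 1 := by
  have hs0 : v ∈ sep D Θ (g⁻¹ • v) (g • v) := ⟨h1.symm, h2.symm, h3⟩
  have hs : ∀ n : ℕ, g ^ (n + 1) • v ∈ sep D Θ (g ^ n • v) (g ^ (n + 2) • v) := by
    intro n
    have := (mem_sep_smul hinv (g ^ (n + 1))).2 hs0
    rwa [smul_smul, smul_smul, ← pow_succ, pow_succ g n, mul_inv_cancel_right, ← pow_succ] at this
  have key : ∀ n : ℕ, g ^ (n + 1) • v ∈ sep D Θ v (g ^ (n + 2) • v) := by
    intro n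
    induction n with
    | zero => simpa using hs 0
    | succ n ih =>
      have e := (wk_of_sep ih).exact h (g ^ (n + 3) • v)
      have h4 := hs (n + 1)
      refine ⟨((wk_of_sep ih).ne h).symm, h4.2.1, ?_⟩
      rw [e]
      exact h4.2.2
  induction n with
  | zero => omega
  | succ n ih =>
    rcases n with _ | n
    · omega
    · have : rk D Θ v (g ^ (n + 1 + 1) • v) = _ := rk_eq_of_sep h (key n)
      omega

/-- The counting metric. -/
noncomputable def cntDist (D : V → V → V → ℕ) (Θ : ℕ) (a b : V) : ℕ :=
  open Classical in if a = b then 0 else rk D Θ a b + 3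

theorem cntDist_le (a b : V) : cntDist D Θ a b ≤ rk D Θ a b + 3 := by
  unfold cntDist; split_ifs <;> omega

theorem le_cntDist (h : StrongProj D Θ) (a b : V) : rk D Θ a b ≤ cntDist D Θ a b := by
  unfold cntDist; split_ifs with e
  · subst e; rw [rk_self h]
  · omega

theorem acylData_cntDist (h : StrongProj D Θ)
    (hinv : ∀ (g : Γ) S a b, D (g • S) (g • a) (g • b) = D S a b) {N : ℕ}
    (hstab : ∀ S T : V, S ≠ T → {g : Γ | g • S = S ∧ g • T = T}.Finite ∧
      {g : Γ | g • S = S ∧ g • T = T}.ncard ≤ N) {g : Γ} {v : V}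
    (h1 : g⁻¹ • v ≠ v) (h2 : g • v ≠ v) (h3 : 2 * Θ < D v (g⁻¹ • v) (g • v)) :
    AcylData (Γ := Γ) (cntDist D Θ) 30 where
  self a := by simp [cntDist]
  symm a b := by
    by_cases hab : a = b
    · rw [hab]
    · simp [cntDist, rk_comm h a b, hab, Ne.symm hab]
  tri a b e := by
    have := rk_tri h a b e
    unfold cntDist
    split_ifs <;> simp_all <;> omega
  hyp a b e u := by
    have := rk_hyp h a b e u
    have c1 := cntDist_le (D := D) (Θ := Θ) a b
    have c2 := cntDist_le (D := D) (Θ := Θ) e u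
    have c3 := le_cntDist h a e
    have c4 := le_cntDist h b u
    have c5 := le_cntDist h a u
    have c6 := le_cntDist h b e
    omega
  geod a b i hi := by
    have c1 := cntDist_le (D := D) (Θ := Θ) a b
    have c2 := le_cntDist h a b
    rcases Nat.lt_or_ge i (rk D Θ a b) with h4 | h4
    · obtain ⟨T, -, e1, e2⟩ := exists_rk h a b h4
      have c3 := cntDist_le (D := D) (Θ := Θ) a T
      have c4 := cntDist_le (D := D) (Θ := Θ) T b
      exact ⟨T, by omega, by omega⟩
    · have : cntDist D Θ b b = 0 := by simp [cntDist]
      exact ⟨b, by omega, by omega⟩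
  inv g a b := by
    by_cases hab : a = b
    · simp [cntDist, hab]
    · have : g • a ≠ g • b := fun e => hab (MulAction.injective g e)
      simp [cntDist, rk_smul hinv, hab, this]
  acyl C := by
    refine ⟨2 * C + 23, N * ((2 * C + 6) * (2 * C + 6)), fun y z hyz => ?_⟩
    have c1 := cntDist_le (D := D) (Θ := Θ) y z
    obtain ⟨hf, hn⟩ := rk_acyl h hinv hstab C y z (by omega)
    have sub : {g : Γ | cntDist D Θ y (g • y) ≤ C ∧ cntDist D Θ z (g • z) ≤ C} ⊆
        {g : Γ | rk D Θ y (g • y) ≤ C ∧ rk D Θ z (g • z) ≤ C} := fun g hg =>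
      ⟨(le_cntDist h _ _).trans hg.1, (le_cntDist h _ _).trans hg.2⟩
    exact ⟨hf.subset sub, (Set.ncard_le_ncard sub hf).trans hn⟩
  lox := by
    refine ⟨g, v, fun n => ?_⟩
    have := rk_lox h hinv h1 h2 h3 n
    have := le_cntDist h v (g ^ n • v)
    omega

end action

/-- Functions dominating an integer distance. -/
def Dom {V : Type*} (σ : V → V → ℕ) (f : V → ℝ) : Prop := ∀ x y, (σ x y : ℝ) ≤ f x + f y

/-- Extremal functions: the points of the tight span. -/
def Extr {V : Type*} (σ : V → V → ℕ) (f : V → ℝ) : Prop :=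
  Dom σ f ∧ ∀ x, ∀ ε : ℝ, 0 < ε → ∃ y, f x + f y < σ x y + ε

/-- The tight span. -/
def TightSpan {V : Type*} (σ : V → V → ℕ) : Type _ := {f : V → ℝ // Extr σ f}

section retract
variable {V : Type*} {σ : V → V → ℕ}

theorem Dom.nonneg {f : V → ℝ} (h : Dom σ f) (x : V) : 0 ≤ f x := by
  have h1 := h x x
  have : (0 : ℝ) ≤ σ x x := Nat.cast_nonneg _
  linarith

/-- The conjugate function. -/
noncomputable def conj (σ : V → V → ℕ) (f : V → ℝ) (x : V) : ℝ := ⨆ z, ((σ x z : ℝ) - f z)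

theorem Dom.bdd {f : V → ℝ} (h : Dom σ f) (x : V) :
    BddAbove (Set.range fun z => (σ x z : ℝ) - f z) := by
  refine ⟨f x, ?_⟩
  rintro _ ⟨z, rfl⟩
  have := h x z
  simp only
  linarith

theorem Dom.conj_le [Nonempty V] {f : V → ℝ} (h : Dom σ f) (x : V) : conj σ f x ≤ f x :=
  ciSup_le fun z => by have := h x z; linarith

theorem Dom.le_conj {f : V → ℝ} (h : Dom σ f) (x z : V) : (σ x z : ℝ) - f z ≤ conj σ f x :=
  le_ciSup (h.bdd x) z

theorem conj_le_conj [Nonempty V] {f g : V → ℝ} (hf : Dom σ f) {r : ℝ}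
    (hr : ∀ x, f x ≤ g x + r) (x : V) : conj σ g x ≤ conj σ f x + r :=
  ciSup_le fun z => by
    have := hf.le_conj x z
    have := hr z
    linarith

/-- Averaging with the conjugate. -/
noncomputable def halfConj (σ : V → V → ℕ) (f : V → ℝ) (x : V) : ℝ := (f x + conj σ f x) / 2

theorem Dom.halfConj {f : V → ℝ} (symm : ∀ x y, σ x y = σ y x) (h : Dom σ f) :
    Dom σ (halfConj σ f) := by
  intro x y
  have h1 := h.le_conj x y
  have h2 := h.le_conj y x
  rw [symm y x] at h2
  simp only [SpinQuot.halfConj]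
  linarith

theorem Dom.iterate {f : V → ℝ} (symm : ∀ x y, σ x y = σ y x) (h : Dom σ f) (n : ℕ) :
    Dom σ ((SpinQuot.halfConj σ)^[n] f) := by
  induction n with
  | zero => exact h
  | succ n ih => rw [Function.iterate_succ_apply']; exact ih.halfConj symm

theorem Dom.iterate_antitone [Nonempty V] {f : V → ℝ} (symm : ∀ x y, σ x y = σ y x)
    (h : Dom σ f) (x : V) : Antitone fun n => (SpinQuot.halfConj σ)^[n] f x := by
  refine antitone_nat_of_succ_le fun n => ?_
  rw [Function.iterate_succ_apply']
  have := (h.iterate symm n).conj_le x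
  simp only [SpinQuot.halfConj] at this ⊢
  linarith

/-- The retraction onto the tight span. -/
noncomputable def retr (σ : V → V → ℕ) (f : V → ℝ) (x : V) : ℝ := ⨅ n, (halfConj σ)^[n] f x

theorem Dom.bddBelow {f : V → ℝ} (symm : ∀ x y, σ x y = σ y x) (h : Dom σ f) (x : V) :
    BddBelow (Set.range fun n => (SpinQuot.halfConj σ)^[n] f x) :=
  ⟨0, by rintro _ ⟨n, rfl⟩; exact (h.iterate symm n).nonneg x⟩

theorem Dom.tendsto_retr [Nonempty V] {f : V → ℝ} (symm : ∀ x y, σ x y = σ y x) (h : Dom σ f)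
    (x : V) : Tendsto (fun n => (SpinQuot.halfConj σ)^[n] f x) atTop (nhds (retr σ f x)) :=
  tendsto_atTop_ciInf (h.iterate_antitone symm x) (h.bddBelow symm x)

theorem Dom.retr_dom [Nonempty V] {f : V → ℝ} (symm : ∀ x y, σ x y = σ y x) (h : Dom σ f) :
    Dom σ (retr σ f) := fun x y =>
  ge_of_tendsto' ((h.tendsto_retr symm x).add (h.tendsto_retr symm y))
    fun n => h.iterate symm n x y

theorem Dom.retr_extr [Nonempty V] {f : V → ℝ} (symm : ∀ x y, σ x y = σ y x) (h : Dom σ f) :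
    Extr σ (retr σ f) := by
  have hd := h.retr_dom symm
  refine ⟨hd, fun x ε hε => ?_⟩
  have h1 := h.tendsto_retr symm x
  have h2 : Tendsto (fun n => conj σ ((SpinQuot.halfConj σ)^[n] f) x) atTop
      (nhds (retr σ f x)) := by
    have h3 := (((tendsto_add_atTop_iff_nat 1).2 h1).const_mul 2).sub h1
    rw [two_mul, add_sub_cancel_right] at h3
    refine h3.congr fun n => ?_
    rw [Function.iterate_succ_apply']
    simp only [SpinQuot.halfConj]
    ring
  have h4 : retr σ f x ≤ conj σ (retr σ f) x := by
    refine le_of_tendsto' h2 fun n => ?_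
    have := conj_le_conj (r := 0) hd (g := (SpinQuot.halfConj σ)^[n] f)
      (fun z => by rw [add_zero]; exact ciInf_le (h.bddBelow symm z) n) x
    linarith
  obtain ⟨z, hz⟩ := exists_lt_of_lt_ciSup (show retr σ f x - ε < conj σ (retr σ f) x by linarith)
  exact ⟨z, by linarith⟩

theorem retr_le_retr [Nonempty V] {f g : V → ℝ} (symm : ∀ x y, σ x y = σ y x)
    (hf : Dom σ f) (hg : Dom σ g) {r : ℝ}
    (hr : ∀ x, f x ≤ g x + r) (hr' : ∀ x, g x ≤ f x + r) (x : V) :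
    retr σ f x ≤ retr σ g x + r := by
  have key : ∀ n, (∀ x, (halfConj σ)^[n] f x ≤ (halfConj σ)^[n] g x + r) ∧
      ∀ x, (halfConj σ)^[n] g x ≤ (halfConj σ)^[n] f x + r := by
    intro n
    induction n with
    | zero => exact ⟨hr, hr'⟩
    | succ n ih =>
      simp only [Function.iterate_succ_apply']
      constructor
      · intro x
        have h1 := ih.1 x
        have h2 := conj_le_conj (hg.iterate symm n) ih.2 x
        simp only [halfConj] at *
        linarith
      · intro x
        have h1 := ih.2 x
        have h2 := conj_le_conj (hf.iterate symm n) ih.1 x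
        simp only [halfConj] at *
        linarith
  exact le_of_tendsto_of_tendsto' (hf.tendsto_retr symm x)
    ((hg.tendsto_retr symm x).add_const r) fun n => (key n).1 x

theorem Extr.retr_eq [Nonempty V] {f : V → ℝ} (hf : Extr σ f) : retr σ f = f := by
  have hc : halfConj σ f = f := by
    ext x
    have h1 := hf.1.conj_le x
    have h2 : f x ≤ conj σ f x := by
      refine le_of_forall_pos_le_add fun ε hε => ?_
      obtain ⟨y, hy⟩ := hf.2 x ε hε
      have := hf.1.le_conj x y
      linarith
    simp only [halfConj]
    linarith
  ext x
  simp only [retr, Function.iterate_fixed hc, ciInf_const]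

theorem Extr.lip {f : V → ℝ} (tri : ∀ a b e, σ a e ≤ σ a b + σ b e) (hf : Extr σ f) (x y : V) :
    f x ≤ f y + σ x y := by
  refine le_of_forall_pos_le_add fun ε hε => ?_
  obtain ⟨z, hz⟩ := hf.2 x ε hε
  have h1 := hf.1 y z
  have h2 : (σ x z : ℝ) ≤ σ x y + σ y z := by exact_mod_cast tri x y z
  linarith

theorem Extr.le_swap {f g : V → ℝ} (hf : Extr σ f) (hg : Extr σ g) {r : ℝ}
    (h : ∀ x, f x ≤ g x + r) (x : V) : g x ≤ f x + r := by
  refine le_of_forall_pos_le_add fun ε hε => ?_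
  obtain ⟨z, hz⟩ := hg.2 x ε hε
  have := hf.1 x z
  have := h z
  linarith

end retract

section metric
variable {V : Type*} [Nonempty V] {σ : V → V → ℕ}

/-- The sup distance between extremal functions. -/
noncomputable def tsDist (f g : V → ℝ) : ℝ := ⨆ x, (f x - g x)

theorem ts_bdd (tri : ∀ a b e, σ a e ≤ σ a b + σ b e)
    {f g : V → ℝ} (hf : Extr σ f) (hg : Extr σ g) :
    BddAbove (Set.range fun x => f x - g x) := by
  obtain ⟨x₀⟩ := ‹Nonempty V›
  refine ⟨f x₀ + g x₀, ?_⟩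
  rintro _ ⟨x, rfl⟩
  have := hf.lip tri x x₀
  have := hg.1 x x₀
  simp only
  linarith

theorem tsDist_le_iff (tri : ∀ a b e, σ a e ≤ σ a b + σ b e)
    {f g : V → ℝ} (hf : Extr σ f) (hg : Extr σ g) {r : ℝ} :
    tsDist f g ≤ r ↔ ∀ x, f x ≤ g x + r := by
  rw [tsDist, ciSup_le_iff (ts_bdd tri hf hg)]
  simp only [sub_le_iff_le_add']

/-- The metric of the tight span. -/
@[reducible] noncomputable def tsMetric
    (tri : ∀ a b e, σ a e ≤ σ a b + σ b e) : MetricSpace (TightSpan σ) where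
  dist f g := tsDist f.1 g.1
  dist_self f := by simp [tsDist]
  dist_comm f g := by
    refine le_antisymm ?_ ?_
    · rw [tsDist_le_iff tri f.2 g.2]
      exact g.2.le_swap f.2 ((tsDist_le_iff tri g.2 f.2).1 le_rfl)
    · rw [tsDist_le_iff tri g.2 f.2]
      exact f.2.le_swap g.2 ((tsDist_le_iff tri f.2 g.2).1 le_rfl)
  dist_triangle f g h := by
    rw [tsDist_le_iff tri f.2 h.2]
    intro x
    have h1 := (tsDist_le_iff tri f.2 g.2).1 le_rfl x
    have h2 := (tsDist_le_iff tri g.2 h.2).1 le_rfl x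
    linarith
  eq_of_dist_eq_zero := by
    intro f g h
    have h1 := (tsDist_le_iff tri f.2 g.2).1 h.le
    have h2 := f.2.le_swap g.2 h1
    refine Subtype.ext (funext fun x => le_antisymm ?_ ?_)
    · simpa using h1 x
    · simpa using h2 x

/-- The canonical embedding into the tight span. -/
def tsPt (self : ∀ a, σ a a = 0) (symm : ∀ a b, σ a b = σ b a)
    (tri : ∀ a b e, σ a e ≤ σ a b + σ b e) (v : V) : TightSpan σ :=
  ⟨fun x => σ v x, fun x y => by
    have := tri x v y
    rw [symm x v] at this
    simp only
    exact_mod_cast this, fun x ε hε => ⟨v, by simp only; rw [self, symm v x]; push_cast; linarith⟩⟩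

end metric

section space
variable {V : Type*} [Nonempty V] {σ : V → V → ℕ}

theorem thin_of_four_point {X : Type*} [MetricSpace X] {c : ℝ} (hc : 0 ≤ c)
    (h : ∀ a b e u : X, dist a b + dist e u ≤ dist a e + dist b u + c ∨
      dist a b + dist e u ≤ dist a u + dist b e + c) : MetricDeltaHyperbolic X (2 * c) := by
  intro x y z γ₀ γ₁ γ₂ h₀ h₁ h₂ s hs
  obtain ⟨a0, b0, e0⟩ := h₀
  obtain ⟨a1, b1, e1⟩ := h₁
  obtain ⟨a2, b2, e2⟩ := h₂
  have px : dist (γ₀ s) x = s := by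
    rw [← a0, e0 s hs 0 ⟨le_rfl, dist_nonneg⟩, sub_zero, abs_of_nonneg hs.1]
  have py : dist (γ₀ s) y = dist x y - s := by
    conv_lhs => rw [← b0]
    rw [e0 s hs _ ⟨dist_nonneg, le_rfl⟩, abs_sub_comm, abs_of_nonneg (by linarith [hs.2])]
  have tx := dist_triangle x y z
  have t1 := dist_triangle y z x
  have t2 := dist_triangle z x y
  have c1 := dist_comm z x
  have c2 := dist_comm y x
  have c3 := dist_comm z y
  have pz := h (γ₀ s) z x y
  rcases le_total (2 * s) (dist x y + dist x z - dist y z) with h1 | h1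
  · have hs' : dist z x - s ∈ Icc (0 : ℝ) (dist z x) :=
      ⟨by linarith, by linarith [hs.1]⟩
    refine ⟨γ₂ (dist z x - s), Or.inr ⟨_, hs', rfl⟩, ?_⟩
    have qz : dist (γ₂ (dist z x - s)) z = dist z x - s := by
      have := e2 _ hs' 0 ⟨le_rfl, dist_nonneg⟩
      rwa [a2, sub_zero, abs_of_nonneg hs'.1] at this
    have qx : dist (γ₂ (dist z x - s)) x = s := by
      have := e2 _ hs' _ ⟨dist_nonneg, le_rfl⟩
      rw [b2, abs_sub_comm, abs_of_nonneg (by linarith [hs.1])] at this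
      linarith
    have pq := h (γ₀ s) (γ₂ (dist z x - s)) z x
    rcases pq with pq | pq <;> rcases pz with pz | pz <;> linarith
  · have hs' : dist x y - s ∈ Icc (0 : ℝ) (dist y z) :=
      ⟨by linarith [hs.2], by linarith [hs.1]⟩
    refine ⟨γ₁ (dist x y - s), Or.inl ⟨_, hs', rfl⟩, ?_⟩
    have qy : dist (γ₁ (dist x y - s)) y = dist x y - s := by
      have := e1 _ hs' 0 ⟨le_rfl, dist_nonneg⟩
      rwa [a1, sub_zero, abs_of_nonneg hs'.1] at this
    have qz : dist (γ₁ (dist x y - s)) z = dist y z - (dist x y - s) := by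
      have := e1 _ hs' _ ⟨dist_nonneg, le_rfl⟩
      rwa [b1, abs_sub_comm, abs_of_nonneg (by linarith [hs'.2])] at this
    have pq := h (γ₀ s) (γ₁ (dist x y - s)) z y
    rcases pq with pq | pq <;> rcases pz with pz | pz <;> linarith

theorem ts_dist_le_iff (tri : ∀ a b e, σ a e ≤ σ a b + σ b e) (f g : TightSpan σ) {r : ℝ} :
    @dist _ (tsMetric tri).toDist f g ≤ r ↔ ∀ x, f.1 x ≤ g.1 x + r :=
  tsDist_le_iff tri f.2 g.2

theorem ts_dist_pt (self : ∀ a, σ a a = 0) (symm : ∀ a b, σ a b = σ b a)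
    (tri : ∀ a b e, σ a e ≤ σ a b + σ b e) (f : TightSpan σ) (v : V) :
    @dist _ (tsMetric tri).toDist f (tsPt self symm tri v) = f.1 v := by
  refine le_antisymm ?_ ?_
  · rw [ts_dist_le_iff]
    intro x
    have := f.2.lip tri x v
    rw [symm] at this
    simp only [tsPt]
    linarith
  · have := (ts_dist_le_iff tri f (tsPt self symm tri v)).1 le_rfl v
    simpa [tsPt, self] using this

theorem ts_four_point (symm : ∀ a b, σ a b = σ b a)
    (tri : ∀ a b e, σ a e ≤ σ a b + σ b e) {c : ℕ}
    (hyp : ∀ a b e u, σ a b + σ e u ≤ σ a e + σ b u + c ∨ σ a b + σ e u ≤ σ a u + σ b e + c)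
    (a b e u : TightSpan σ) : letI := tsMetric tri
      dist a b + dist e u ≤ dist a e + dist b u + c ∨
      dist a b + dist e u ≤ dist a u + dist b e + c := by
  let _ := tsMetric tri
  have dom : ∀ f g : TightSpan σ, ∀ x y, (σ x y : ℝ) ≤ f.1 x + g.1 y + dist f g := by
    intro f g x y
    have h1 := (ts_dist_le_iff tri f g).1 le_rfl y
    have h2 := f.2.1 x y
    linarith
  have wit : ∀ f g : TightSpan σ, ∀ ε : ℝ, 0 < ε →
      ∃ x y, f.1 x + g.1 y + dist f g < σ x y + ε := by
    intro f g ε hε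
    obtain ⟨y, hy⟩ : ∃ y, g.1 y + (dist f g - ε / 2) < f.1 y := by
      by_contra hcon
      push Not at hcon
      have := (ts_dist_le_iff tri f g).2 hcon
      linarith
    obtain ⟨x, hx⟩ := f.2.2 y (ε / 2) (by linarith)
    refine ⟨x, y, ?_⟩
    rw [symm x y]
    linarith
  have key : ∀ ε : ℝ, 0 < ε → dist a b + dist e u ≤
      max (dist a e + dist b u) (dist a u + dist b e) + c + ε := by
    intro ε hε
    obtain ⟨x, y, h1⟩ := wit a b (ε / 2) (by linarith)
    obtain ⟨z, w, h2⟩ := wit e u (ε / 2) (by linarith)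
    have h3 := dom a e x z
    have h4 := dom b u y w
    have h5 := dom a u x w
    have h6 := dom b e y z
    have m1 := le_max_left (dist a e + dist b u) (dist a u + dist b e)
    have m2 := le_max_right (dist a e + dist b u) (dist a u + dist b e)
    rcases hyp x y z w with h | h
    · have h' : (σ x y : ℝ) + σ z w ≤ σ x z + σ y w + c := by exact_mod_cast h
      linarith
    · have h' : (σ x y : ℝ) + σ z w ≤ σ x w + σ y z + c := by exact_mod_cast h
      linarith
  have := le_of_forall_pos_le_add key
  rcases le_total (dist a e + dist b u) (dist a u + dist b e) with h | h
  · rw [max_eq_right h] at this; exact Or.inr this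
  · rw [max_eq_left h] at this; exact Or.inl this

theorem ts_geodesic (symm : ∀ a b, σ a b = σ b a)
    (tri : ∀ a b e, σ a e ≤ σ a b + σ b e) : @GeodesicSpace (TightSpan σ) (tsMetric tri) := by
  let _ := tsMetric tri
  intro f g
  set D := dist f g with hD
  have fg := (ts_dist_le_iff tri f g).1 hD.ge
  have gf := (ts_dist_le_iff tri g f).1 (by rw [dist_comm])
  rcases eq_or_ne D 0 with h0 | h0
  · refine ⟨fun _ => f, rfl, dist_eq_zero.1 (hD ▸ h0), ?_⟩
    rw [← hD, h0]
    intro s hs t ht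
    have : s = t := by rw [Icc_self] at hs ht; rw [hs, ht]
    simp [this]
  have hDpos : 0 < D := lt_of_le_of_ne dist_nonneg (Ne.symm h0)
  let L : ℝ → V → ℝ := fun t x => (1 - t / D) * f.1 x + t / D * g.1 x
  have hdom : ∀ t ∈ Icc (0 : ℝ) D, Dom σ (L t) := by
    intro t ht x y
    have h1 := f.2.1 x y
    have h2 := g.2.1 x y
    have a1 : 0 ≤ t / D := div_nonneg ht.1 hDpos.le
    have a2 : 0 ≤ 1 - t / D := by rw [sub_nonneg, div_le_one hDpos]; exact ht.2
    have := mul_le_mul_of_nonneg_left h1 a2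
    have := mul_le_mul_of_nonneg_left h2 a1
    simp only [L]
    linarith
  have lip : ∀ s ∈ Icc (0 : ℝ) D, ∀ t ∈ Icc (0 : ℝ) D, ∀ x,
      retr σ (L s) x ≤ retr σ (L t) x + |s - t| := by
    intro s hs t ht
    have diff : ∀ s t : ℝ, ∀ x, L s x ≤ L t x + |s - t| := by
      intro s t x
      have e : L s x - L t x = (s - t) / D * (g.1 x - f.1 x) := by simp only [L]; ring
      have h1 : |g.1 x - f.1 x| ≤ D := abs_le.2 ⟨by linarith [fg x], by linarith [gf x]⟩
      have h2 : |L s x - L t x| ≤ |s - t| := by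
        rw [e, abs_mul, abs_div, abs_of_pos hDpos, div_mul_eq_mul_div, div_le_iff₀ hDpos]
        exact mul_le_mul_of_nonneg_left h1 (abs_nonneg _)
      linarith [le_abs_self (L s x - L t x)]
    exact retr_le_retr symm (hdom s hs) (hdom t ht) (diff s t)
      (fun x => by rw [abs_sub_comm]; exact diff t s x)
  have hex : ∀ t, ∃ p : TightSpan σ, t ∈ Icc (0 : ℝ) D → p.1 = retr σ (L t) := by
    intro t
    by_cases ht : t ∈ Icc (0 : ℝ) D
    · exact ⟨⟨_, (hdom t ht).retr_extr symm⟩, fun _ => rfl⟩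
    · exact ⟨f, fun h => absurd h ht⟩
  choose γ hγ using hex
  have m0 : (0 : ℝ) ∈ Icc (0 : ℝ) D := ⟨le_rfl, hDpos.le⟩
  have mD : D ∈ Icc (0 : ℝ) D := ⟨hDpos.le, le_rfl⟩
  have g0 : γ 0 = f := by
    refine Subtype.ext ?_
    have : L 0 = f.1 := by ext x; simp [L]
    rw [hγ 0 m0, this, f.2.retr_eq]
  have gD : γ D = g := by
    refine Subtype.ext ?_
    have : L D = g.1 := by ext x; simp [L, h0]
    rw [hγ D mD, this, g.2.retr_eq]
  have dle : ∀ s ∈ Icc (0 : ℝ) D, ∀ t ∈ Icc (0 : ℝ) D, dist (γ s) (γ t) ≤ |s - t| := by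
    intro s hs t ht
    rw [ts_dist_le_iff tri, hγ s hs, hγ t ht]
    exact lip s hs t ht
  have dge : ∀ s ∈ Icc (0 : ℝ) D, ∀ t ∈ Icc (0 : ℝ) D, s ≤ t → t - s ≤ dist (γ s) (γ t) := by
    intro s hs t ht hst
    have h1 := dle 0 m0 s hs
    have h2 := dle t ht D mD
    rw [zero_sub, abs_neg, abs_of_nonneg hs.1] at h1
    rw [abs_sub_comm, abs_of_nonneg (by linarith [ht.2])] at h2
    have h3 := dist_triangle4 (γ 0) (γ s) (γ t) (γ D)
    have h4 : dist (γ 0) (γ D) = D := by rw [g0, gD]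
    linarith
  refine ⟨γ, g0, gD, fun s hs t ht => le_antisymm (dle s hs t ht) ?_⟩
  rcases le_total s t with h | h
  · rw [abs_sub_comm, abs_of_nonneg (by linarith)]
    exact dge s hs t ht h
  · rw [abs_of_nonneg (by linarith), dist_comm]
    exact dge t ht s hs h

theorem ts_dense (symm : ∀ a b, σ a b = σ b a) {c : ℕ}
    (hyp : ∀ a b e u, σ a b + σ e u ≤ σ a e + σ b u + c ∨ σ a b + σ e u ≤ σ a u + σ b e + c)
    (geod : ∀ a b i, i ≤ σ a b → ∃ m, σ a m ≤ i + c ∧ σ m b ≤ σ a b - i + c)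
    (f : TightSpan σ) : ∃ v, f.1 v ≤ 2 * c + 4 := by
  obtain ⟨x₀⟩ := ‹Nonempty V›
  obtain ⟨y, hy⟩ := f.2.2 x₀ 1 one_pos
  have f0 := f.2.1.nonneg x₀
  have f1 := f.2.1.nonneg y
  have hi := Nat.floor_le f0
  have hi' := Nat.lt_floor_add_one (f.1 x₀)
  set i := min ⌊f.1 x₀⌋₊ (σ x₀ y) with hidef
  have i1 : (i : ℝ) ≤ f.1 x₀ := le_trans (by exact_mod_cast min_le_left _ _) hi
  have i2 : i ≤ σ x₀ y := min_le_right _ _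
  have i3 : (σ x₀ y : ℝ) ≤ i + f.1 y + 1 := by
    rcases min_choice ⌊f.1 x₀⌋₊ (σ x₀ y) with h | h
    · rw [hidef, h]
      have := f.2.1 x₀ y
      linarith
    · rw [hidef, h]
      linarith
  obtain ⟨v, h1, h2⟩ := geod x₀ y i i2
  have h1' : (σ x₀ v : ℝ) ≤ i + c := by exact_mod_cast h1
  have h2' : (σ v y : ℝ) ≤ σ x₀ y - i + c := by
    have : σ v y + i ≤ σ x₀ y + c := by omega
    have : (σ v y : ℝ) + i ≤ σ x₀ y + c := by exact_mod_cast this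
    linarith
  obtain ⟨w, hw⟩ := f.2.2 v 1 one_pos
  have h3 := f.2.1 w y
  have h4 := f.2.1 w x₀
  refine ⟨v, ?_⟩
  rcases hyp v w x₀ y with h | h
  · have h' : (σ v w : ℝ) + σ x₀ y ≤ σ x₀ v + σ w y + c := by
      rw [symm x₀ v]; exact_mod_cast h
    linarith
  · have h' : (σ v w : ℝ) + σ x₀ y ≤ σ v y + σ w x₀ + c := by exact_mod_cast h
    linarith

end space

theorem AcylData.exists_space.{u, w} {Γ : Type w} {V : Type u} [Group Γ] [MulAction Γ V]
    {σ : V → V → ℕ} {c : ℕ} (h : AcylData (Γ := Γ) σ c) :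
    ∃ (X : Type u) (mX : MetricSpace X) (act : Γ → X → X) (δ : ℝ), 0 ≤ δ ∧
      @IsometricAction Γ X _ mX act ∧ @GeodesicSpace X mX ∧
      @MetricDeltaHyperbolic X mX δ ∧ @MetricActAcylindrical Γ X _ mX act ∧
      ∃ f : Γ, @MetricActHyperbolic Γ X _ mX act f := by
  obtain ⟨f₀, v₀, hf₀⟩ := h.lox
  have : Nonempty V := ⟨v₀⟩
  let _ := tsMetric h.tri
  have hinv : ∀ (g : Γ) x y, σ (g⁻¹ • x) y = σ x (g • y) := by
    intro g x y
    rw [← h.inv g, smul_inv_smul]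
  have hex : ∀ (g : Γ) (f : TightSpan σ), Extr σ fun x => f.1 (g⁻¹ • x) := by
    intro g f
    refine ⟨fun x y => ?_, fun x ε hε => ?_⟩
    · have := f.2.1 (g⁻¹ • x) (g⁻¹ • y)
      rwa [h.inv] at this
    · obtain ⟨y, hy⟩ := f.2.2 (g⁻¹ • x) ε hε
      refine ⟨g • y, ?_⟩
      simpa [hinv] using hy
  let act : Γ → TightSpan σ → TightSpan σ := fun g f => ⟨_, hex g f⟩
  have iso : ∀ (g : Γ) (x y : TightSpan σ), dist (act g x) (act g y) ≤ dist x y := by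
    intro g x y
    rw [ts_dist_le_iff h.tri]
    exact fun v => (ts_dist_le_iff h.tri x y).1 le_rfl _
  have one : ∀ x, act 1 x = x := fun x => Subtype.ext (funext fun v => by simp [act])
  have mul : ∀ g g' x, act (g * g') x = act g (act g' x) := fun g g' x =>
    Subtype.ext (funext fun v => by simp [act, mul_smul])
  have iso' : ∀ (g : Γ) (x y : TightSpan σ), dist (act g x) (act g y) = dist x y := by
    intro g x y
    refine le_antisymm (iso g x y) ?_
    have := iso g⁻¹ (act g x) (act g y)
    rwa [← mul, ← mul, inv_mul_cancel, one, one] at this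
  let P : V → TightSpan σ := tsPt h.self h.symm h.tri
  have actP : ∀ g v, act g (P v) = P (g • v) := fun g v =>
    Subtype.ext (funext fun x => by simp [act, P, tsPt, h.symm v, hinv, h.symm x])
  have dP : ∀ v w, dist (P v) (P w) = σ v w := fun v w => ts_dist_pt h.self h.symm h.tri (P v) w
  have dense : ∀ f : TightSpan σ, ∃ v, dist f (P v) ≤ 2 * c + 4 := by
    intro f
    obtain ⟨v, hv⟩ := ts_dense h.symm h.hyp h.geod f
    exact ⟨v, by rw [ts_dist_pt]; exact hv⟩
  refine ⟨TightSpan σ, inferInstance, act, 2 * c, by positivity, ⟨one, mul, iso'⟩,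
    ts_geodesic h.symm h.tri,
    thin_of_four_point (Nat.cast_nonneg c) (ts_four_point h.symm h.tri h.hyp), ?_, f₀, P v₀, ?_⟩
  · intro D hD
    obtain ⟨r, N, hrN⟩ := h.acyl (⌈D⌉₊ + 4 * c + 8)
    refine ⟨r + 4 * c + 8, N, by positivity, fun x y hxy => ?_⟩
    obtain ⟨v, hv⟩ := dense x
    obtain ⟨w, hw⟩ := dense y
    have move : ∀ (x : TightSpan σ) (v : V) (g : Γ), dist x (P v) ≤ 2 * c + 4 →
        dist x (act g x) ≤ D → σ v (g • v) ≤ ⌈D⌉₊ + 4 * c + 8 := by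
      intro x v g hv hg
      have h1 : (σ v (g • v) : ℝ) ≤ ⌈D⌉₊ + 4 * c + 8 := by
        rw [← dP, ← actP]
        have h2 := dist_triangle4 (P v) x (act g x) (act g (P v))
        rw [iso', dist_comm (P v) x] at h2
        have := Nat.le_ceil D
        linarith
      exact_mod_cast h1
    have hvw : r ≤ σ v w := by
      have h1 : (r : ℝ) ≤ σ v w := by
        rw [← dP]
        have h2 := dist_triangle4 x (P v) (P w) y
        rw [dist_comm (P w)] at h2
        linarith
      exact_mod_cast h1
    obtain ⟨h3, h4⟩ := hrN v w hvw
    have sub : {g : Γ | dist x (act g x) ≤ D ∧ dist y (act g y) ≤ D} ⊆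
        {g : Γ | σ v (g • v) ≤ ⌈D⌉₊ + 4 * c + 8 ∧ σ w (g • w) ≤ ⌈D⌉₊ + 4 * c + 8} :=
      fun g hg => ⟨move x v g hv hg.1, move y w g hw hg.2⟩
    exact ⟨h3.subset sub, (Set.ncard_le_ncard sub h3).trans h4⟩
  · let a : ℕ → ℝ := fun n => σ v₀ (f₀ ^ n • v₀)
    have sub : Subadditive a := by
      intro m n
      have h1 := h.tri v₀ (f₀ ^ m • v₀) (f₀ ^ (m + n) • v₀)
      rw [pow_add, mul_smul, h.inv] at h1
      simp only [a]
      rw [pow_add, mul_smul]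
      exact_mod_cast h1
    have bdd : BddBelow (Set.range fun n => a n / n) :=
      ⟨0, by rintro _ ⟨n, rfl⟩; exact div_nonneg (Nat.cast_nonneg _) (Nat.cast_nonneg _)⟩
    have lim := sub.tendsto_lim bdd
    have low : (1 : ℝ) ≤ sub.lim := by
      have h1 : Tendsto (fun n : ℕ => (1 : ℝ) - c / n) atTop (nhds (1 - 0)) :=
        tendsto_const_nhds.sub (tendsto_const_div_atTop_nhds_zero_nat _)
      rw [sub_zero] at h1
      refine le_of_tendsto_of_tendsto h1 lim ?_
      filter_upwards [eventually_gt_atTop 0] with n hn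
      have hn' : (0 : ℝ) < n := Nat.cast_pos.2 hn
      rw [one_sub_div hn'.ne', div_le_div_iff_of_pos_right hn']
      have : (n : ℝ) ≤ σ v₀ (f₀ ^ n • v₀) + c := by exact_mod_cast hf₀ n
      simp only [a]
      linarith
    refine ⟨sub.lim, by linarith, lim.congr fun n => ?_⟩
    rw [actP, dP]

/-- A family of uniformly quasiconvex subsets with bounded overlaps. -/
structure ConeSys {V Q : Type*} (d : Q → Q → ℕ) (C : V → Set Q) (κ : ℕ) (M : ℕ → ℕ) : Prop where
  ne : ∀ S, (C S).Nonempty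
  qc : ∀ S p q m, p ∈ C S → q ∈ C S → d p m + d m q = d p q → ∃ s ∈ C S, d m s ≤ κ
  overlap : ∀ S S' c p q, S ≠ S' → p ∈ C S → q ∈ C S → (∃ p' ∈ C S', d p p' ≤ c) →
    (∃ q' ∈ C S', d q q' ≤ c) → d p q ≤ M c

/-- The nearest points of a subset. -/
def nearest {Q : Type*} (d : Q → Q → ℕ) (A : Set Q) (p : Q) : Set Q :=
  {s | s ∈ A ∧ ∀ s' ∈ A, d p s ≤ d p s'}

theorem nearest_nonempty {Q : Type*} (d : Q → Q → ℕ) {A : Set Q} (hA : A.Nonempty) (p : Q) :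
    (nearest d A p).Nonempty := by
  obtain ⟨s, hs⟩ := (measure fun s => d p s).wf.has_min A hA
  exact ⟨s, hs.1, fun u hu => not_lt.1 (hs.2 u hu)⟩

/-- The set of distances between nearest point projections of two subsets. -/
def projSet {V Q : Type*} (d : Q → Q → ℕ) (C : V → Set Q) (S A B : V) : Set ℕ :=
  {n | ∃ a ∈ C A, ∃ b ∈ C B, ∃ s ∈ nearest d (C S) a, ∃ t ∈ nearest d (C S) b, n = d s t}

/-- The projection distance between two subsets. -/
noncomputable def coneProj {V Q : Type*} (d : Q → Q → ℕ) (C : V → Set Q) (S A B : V) : ℕ :=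
  sSup (projSet d C S A B)

section
variable {Γ V Q : Type*} [Group Γ] [MulAction Γ Q] {d : Q → Q → ℕ} {δ : ℕ} {C : V → Set Q}
  {κ : ℕ} {M : ℕ → ℕ}

theorem HypAct.fellow (hd : HypAct (Γ := Γ) d δ) {a b p p' : Q} {e : ℕ}
    (h : d a p + d p b ≤ d a b + e) (h' : d a p' + d p' b ≤ d a b + e) :
    d p p' + d a p ≤ d a p' + e + δ ∨ d p p' + d a p' ≤ d a p + e + δ := by
  have h1 := hd.hyp p p' a b
  have h2 := hd.symm p a
  have h3 := hd.symm p' a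
  omega

/-- Points almost on a geodesic are close to the geodesic. -/
theorem HypAct.fellow_geod (hd : HypAct (Γ := Γ) d δ) {a b p m : Q} {e : ℕ}
    (h : d a p + d p b ≤ d a b + e) (h1 : d a m = min (d a p) (d a b))
    (h2 : d m b = d a b - min (d a p) (d a b)) : d p m ≤ 2 * e + δ := by
  have h3 := hd.fellow h (p' := m) (by omega)
  omega

theorem ConeSys.qc' (hd : HypAct (Γ := Γ) d δ) (hC : ConeSys d C κ M) {S : V} {p q m : Q} {e : ℕ}
    (hp : p ∈ C S) (hq : q ∈ C S) (h : d p m + d m q ≤ d p q + e) :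
    ∃ s ∈ C S, d m s ≤ κ + 2 * e + δ := by
  obtain ⟨m', h1, h2⟩ := hd.geod p q (min (d p m) (d p q)) (min_le_right _ _)
  have h3 := hd.fellow_geod h h1 h2
  obtain ⟨s, hs, hs'⟩ := hC.qc S p q m' hp hq (by omega)
  have := hd.tri m m' s
  exact ⟨s, hs, by omega⟩

theorem ConeSys.nearest_tri (hd : HypAct (Γ := Γ) d δ) (hC : ConeSys d C κ M) {S : V} {p s s' : Q}
    (hs : s ∈ nearest d (C S) p) (hs' : s' ∈ C S) :
    d p s + d s s' ≤ d p s' + (2 * κ + 2 * δ + 1) := by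
  obtain ⟨m, h1, h2⟩ := hd.geod s s' (min (κ + δ + 1) (d s s')) (min_le_right _ _)
  obtain ⟨t, ht, ht'⟩ := hC.qc S s s' m hs.1 hs' (by omega)
  have h3 := hs.2 t ht
  have h4 := hd.tri p m t
  have h5 := hd.hyp p m s s'
  have h6 := hs.2 s' hs'
  have h7 := hd.symm m s
  omega

theorem ConeSys.nearest_pair (hd : HypAct (Γ := Γ) d δ) (hC : ConeSys d C κ M) {S : V}
    {p q s t : Q} (hs : s ∈ nearest d (C S) p) (ht : t ∈ nearest d (C S) q) :
    d s t ≤ 4 * κ + 5 * δ + 2 ∨ d p s + d s t + d t q ≤ d p q + (4 * κ + 5 * δ + 2) := by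
  have h1 := hC.nearest_tri hd hs ht.1
  have h2 := hC.nearest_tri hd ht hs.1
  have h3 := hd.hyp p t s q
  have h4 := hd.symm t s
  have h5 := hd.symm q s
  have h6 := hd.symm q t
  omega

theorem ConeSys.nearest_bdd (hd : HypAct (Γ := Γ) d δ) (hC : ConeSys d C κ M) :
    ∃ θ₀, ∀ S S' p q s t, S ≠ S' → p ∈ C S' → q ∈ C S' → s ∈ nearest d (C S) p →
      t ∈ nearest d (C S) q → d s t ≤ θ₀ := by
  set K := 4 * κ + 5 * δ + 2 with hK
  refine ⟨max K (M (κ + 2 * K + δ)), fun S S' p q s t hne hp hq hs ht => ?_⟩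
  rcases hC.nearest_pair hd hs ht with h | h
  · exact le_max_of_le_left h
  · refine le_max_of_le_right (hC.overlap S S' _ s t hne hs.1 ht.1 ?_ ?_)
    · refine hC.qc' hd hp hq ?_
      have := hd.tri s t q
      omega
    · refine hC.qc' hd hp hq ?_
      have := hd.tri p s t
      omega

theorem ConeSys.le_coneProj (hC : ConeSys d C κ M) (hd : HypAct (Γ := Γ) d δ) {S A B : V}
    (hA : A ≠ S) (hB : B ≠ S) {a b s t : Q} (ha : a ∈ C A) (hb : b ∈ C B)
    (hs : s ∈ nearest d (C S) a) (ht : t ∈ nearest d (C S) b) : d s t ≤ coneProj d C S A B := by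
  obtain ⟨θ₀, h₀⟩ := hC.nearest_bdd hd
  refine le_csSup ⟨θ₀ + d s t + θ₀, ?_⟩ ⟨a, ha, b, hb, s, hs, t, ht, rfl⟩
  rintro _ ⟨a', ha', b', hb', s', hs', t', ht', rfl⟩
  have h1 := h₀ S A a' a s' s hA.symm ha' ha hs' hs
  have h2 := h₀ S B b b' t t' hB.symm hb hb' ht ht'
  have h3 := hd.tri s' s t'
  have h4 := hd.tri s t t'
  omega

theorem ConeSys.exists_coneProj (hC : ConeSys d C κ M) (hd : HypAct (Γ := Γ) d δ) {S A B : V}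
    (hA : A ≠ S) (hB : B ≠ S) : ∃ a ∈ C A, ∃ b ∈ C B, ∃ s ∈ nearest d (C S) a,
      ∃ t ∈ nearest d (C S) b, coneProj d C S A B = d s t := by
  obtain ⟨a, ha⟩ := hC.ne A
  obtain ⟨b, hb⟩ := hC.ne B
  obtain ⟨s, hs⟩ := nearest_nonempty d (hC.ne S) a
  obtain ⟨t, ht⟩ := nearest_nonempty d (hC.ne S) b
  refine Nat.sSup_mem (s := projSet d C S A B) ⟨_, a, ha, b, hb, s, hs, t, ht, rfl⟩
    ⟨coneProj d C S A B, ?_⟩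
  rintro _ ⟨a', ha', b', hb', s', hs', t', ht', rfl⟩
  exact hC.le_coneProj hd hA hB ha' hb' hs' ht'

theorem ConeSys.coneProj_close (hC : ConeSys d C κ M) (hd : HypAct (Γ := Γ) d δ) {θ₀ : ℕ}
    (h₀ : ∀ S S' p q s t, S ≠ S' → p ∈ C S' → q ∈ C S' → s ∈ nearest d (C S) p →
      t ∈ nearest d (C S) q → d s t ≤ θ₀) {S A B : V} (hA : A ≠ S) (hB : B ≠ S) {a b s t : Q}
    (ha : a ∈ C A) (hb : b ∈ C B) (hs : s ∈ nearest d (C S) a) (ht : t ∈ nearest d (C S) b) :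
    coneProj d C S A B ≤ d s t + 2 * θ₀ := by
  obtain ⟨a', ha', b', hb', s', hs', t', ht', e⟩ := hC.exists_coneProj hd hA hB
  have h1 := h₀ S A a' a s' s hA.symm ha' ha hs' hs
  have h2 := h₀ S B b b' t t' hB.symm hb hb' ht ht'
  have h3 := hd.tri s' s t'
  have h4 := hd.tri s t t'
  omega

theorem ConeSys.projSys (hC : ConeSys d C κ M) (hd : HypAct (Γ := Γ) d δ) :
    ∃ θ, ProjSys (coneProj d C) θ := by
  obtain ⟨θ₀, h₀⟩ := hC.nearest_bdd hd
  set K := 4 * κ + 5 * δ + 2 with hK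
  refine ⟨2 * θ₀ + 2 * K + M (2 * (2 * K + δ)), ⟨?_, ?_, ?_, ?_, ?_⟩⟩
  · intro S a b
    have : projSet d C S a b = projSet d C S b a := by
      ext n
      constructor <;>
      · rintro ⟨a', ha', b', hb', s', hs', t', ht', rfl⟩
        exact ⟨b', hb', a', ha', t', ht', s', hs', hd.symm _ _⟩
    rw [coneProj, this, coneProj]
  · intro S A B D hA hB hD
    obtain ⟨a, ha, b, hb, s, hs, t, ht, e⟩ := hC.exists_coneProj hd hA hD
    obtain ⟨c, hc⟩ := hC.ne B
    obtain ⟨u, hu⟩ := nearest_nonempty d (hC.ne S) c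
    have h1 := hC.le_coneProj hd hA hB ha hc hs hu
    have h2 := hC.le_coneProj hd hB hD hc hb hu ht
    have := hd.tri s u t
    omega
  · intro S A hA
    obtain ⟨a, ha, b, hb, s, hs, t, ht, e⟩ := hC.exists_coneProj hd hA hA
    have := h₀ S A a b s t hA.symm ha hb hs ht
    omega
  · intro X Y Z hXY hYZ hXZ hlt
    by_contra hcon
    push Not at hcon
    obtain ⟨p, hp, r, hr, s, hs, t, ht, e⟩ := hC.exists_coneProj hd hXY hYZ.symm
    obtain ⟨u, hu⟩ := nearest_nonempty d (hC.ne Z) p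
    obtain ⟨v, hv⟩ := nearest_nonempty d (hC.ne Z) s
    obtain ⟨w, hw⟩ := nearest_nonempty d (hC.ne Y) u
    have h1 := hC.coneProj_close hd h₀ hXZ hYZ hp hs.1 hu hv
    have h2 := hC.coneProj_close hd h₀ hXY hYZ.symm hp hu.1 hs hw
    have h3 := hC.nearest_pair hd hu hv
    have h4 := hC.nearest_pair hd hs hw
    omega
  · intro A B
    obtain ⟨a, ha⟩ := hC.ne A
    obtain ⟨b, hb⟩ := hC.ne B
    have geo : ∀ i, ∃ m, i ≤ d a b → d a m = i ∧ d m b = d a b - i := by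
      intro i
      by_cases hi : i ≤ d a b
      · obtain ⟨m, hm⟩ := hd.geod a b i hi
        exact ⟨m, fun _ => hm⟩
      · exact ⟨a, fun h => absurd h hi⟩
    choose m hm using geo
    have key : ∀ S : V, ∃ ij : ℕ × ℕ, S ≠ A → S ≠ B →
        2 * θ₀ + 2 * K + M (2 * (2 * K + δ)) < coneProj d C S A B →
        (ij.1 ≤ d a b ∧ ij.2 ≤ d a b) ∧ ∃ s ∈ C S, ∃ t ∈ C S, d s (m ij.1) ≤ 2 * K + δ ∧
          d t (m ij.2) ≤ 2 * K + δ ∧ M (2 * (2 * K + δ)) < d s t := by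
      intro S
      by_cases hS : S ≠ A ∧ S ≠ B ∧ 2 * θ₀ + 2 * K + M (2 * (2 * K + δ)) < coneProj d C S A B
      · obtain ⟨hA, hB, hlt⟩ := hS
        obtain ⟨s, hs⟩ := nearest_nonempty d (hC.ne S) a
        obtain ⟨t, ht⟩ := nearest_nonempty d (hC.ne S) b
        have h1 := hC.coneProj_close hd h₀ hA.symm hB.symm ha hb hs ht
        have h2 := hC.nearest_pair hd hs ht
        have h3 := hd.tri s t b
        have h4 := hd.tri a s t
        refine ⟨(min (d a s) (d a b), min (d a t) (d a b)), fun _ _ _ =>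
          ⟨⟨min_le_right _ _, min_le_right _ _⟩, s, hs.1, t, ht.1, ?_, ?_, by omega⟩⟩
        · exact hd.fellow_geod (by omega) (hm _ (min_le_right _ _)).1 (hm _ (min_le_right _ _)).2
        · exact hd.fellow_geod (by omega) (hm _ (min_le_right _ _)).1 (hm _ (min_le_right _ _)).2
      · exact ⟨(0, 0), fun h1 h2 h3 => absurd ⟨h1, h2, h3⟩ hS⟩
    choose φ hφ using key
    refine Set.Finite.of_finite_image (f := φ) ?_ ?_
    · refine ((Set.finite_Iic (d a b)).prod (Set.finite_Iic (d a b))).subset ?_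
      rintro _ ⟨S, ⟨h1, h2, h3⟩, rfl⟩
      exact (hφ S h1 h2 h3).1
    · rintro S ⟨h1, h2, h3⟩ S' ⟨h1', h2', h3'⟩ e
      by_contra hne
      obtain ⟨-, s, hs, t, ht, k1, k2, k3⟩ := hφ S h1 h2 h3
      obtain ⟨-, s', hs', t', ht', k1', k2', k3'⟩ := hφ S' h1' h2' h3'
      rw [← e] at k1' k2'
      have l1 := hd.tri s (m (φ S).1) s'
      have l2 := hd.tri t (m (φ S).2) t'
      rw [hd.symm (m (φ S).1) s'] at l1
      rw [hd.symm (m (φ S).2) t'] at l2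
      have := hC.overlap S S' (2 * (2 * K + δ)) s t hne hs ht ⟨s', hs', by omega⟩
        ⟨t', ht', by omega⟩
      omega

variable [MulAction Γ V]

theorem nearest_smul (hd : HypAct (Γ := Γ) d δ)
    (hCg : ∀ (g : Γ) S p, g • p ∈ C (g • S) ↔ p ∈ C S) (g : Γ) {S : V} {p s : Q} :
    g • s ∈ nearest d (C (g • S)) (g • p) ↔ s ∈ nearest d (C S) p := by
  simp only [nearest, Set.mem_ofPred_eq, hCg, hd.inv]
  refine and_congr_right fun _ => ⟨fun h s' hs' => ?_, fun h s' hs' => ?_⟩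
  · have := h (g • s') ((hCg g S s').2 hs')
    rwa [hd.inv] at this
  · have := h (g⁻¹ • s') (by rwa [← hCg g, smul_inv_smul])
    have e : d (g • p) s' = d p (g⁻¹ • s') := by rw [← hd.inv g p (g⁻¹ • s'), smul_inv_smul]
    rwa [e]

theorem coneProj_smul (hd : HypAct (Γ := Γ) d δ)
    (hCg : ∀ (g : Γ) S p, g • p ∈ C (g • S) ↔ p ∈ C S) (g : Γ) (S A B : V) :
    coneProj d C (g • S) (g • A) (g • B) = coneProj d C S A B := by
  have sub : ∀ (g : Γ) S A B, projSet d C S A B ⊆ projSet d C (g • S) (g • A) (g • B) := by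
    rintro g S A B _ ⟨a', ha', b', hb', s', hs', t', ht', rfl⟩
    exact ⟨g • a', (hCg g _ _).2 ha', g • b', (hCg g _ _).2 hb', g • s',
      (nearest_smul hd hCg g).2 hs', g • t', (nearest_smul hd hCg g).2 ht', (hd.inv g _ _).symm⟩
  have : projSet d C (g • S) (g • A) (g • B) = projSet d C S A B := by
    refine Set.Subset.antisymm ?_ (sub g S A B)
    have := sub g⁻¹ (g • S) (g • A) (g • B)
    simpa only [inv_smul_smul] using this
  rw [coneProj, this, coneProj]

theorem ConeSys.acylData (hd : HypAct (Γ := Γ) d δ) (hC : ConeSys d C κ M)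
    (hCg : ∀ (g : Γ) S p, g • p ∈ C (g • S) ↔ p ∈ C S)
    (hfin : ∀ c : ℕ, ∃ N : ℕ, ∀ S, ∀ s ∈ C S, {g : Γ | g • S = S ∧ d s (g • s) ≤ c}.Finite ∧
      {g : Γ | g • S = S ∧ d s (g • s) ≤ c}.ncard ≤ N)
    {F t : Γ} {S : V} {x : Q} (hx : x ∈ C S) (hF : F • S = S) (ht : t • S ≠ S)
    (hgrow : ∀ c : ℕ, ∃ n : ℕ, c ≤ d x (F ^ n • x)) :
    ∃ (σ : V → V → ℕ) (c : ℕ), AcylData (Γ := Γ) σ c := by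
  obtain ⟨θ, hp⟩ := hC.projSys hd
  have hs := strongProj_sideDist hp
  have hinv : ∀ (g : Γ) S a b, sideDist (coneProj d C) θ (g • S) (g • a) (g • b) =
    sideDist (coneProj d C) θ S a b := fun g S a b => sideDist_smul (coneProj_smul hd hCg) g S a b
  obtain ⟨θ₀, h₀⟩ := hC.nearest_bdd hd
  obtain ⟨N, hN⟩ := hfin θ₀
  have hstab : ∀ S T : V, S ≠ T → {g : Γ | g • S = S ∧ g • T = T}.Finite ∧
      {g : Γ | g • S = S ∧ g • T = T}.ncard ≤ N := by
    intro S T hne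
    obtain ⟨p, hp⟩ := hC.ne T
    obtain ⟨s, hs⟩ := nearest_nonempty d (hC.ne S) p
    have sub : {g : Γ | g • S = S ∧ g • T = T} ⊆ {g : Γ | g • S = S ∧ d s (g • s) ≤ θ₀} := by
      rintro g ⟨h1, h2⟩
      refine ⟨h1, h₀ S T p (g • p) s (g • s) hne hp ?_ hs ?_⟩
      · have := (hCg g T p).2 hp
        rwa [h2] at this
      · have := (nearest_smul hd hCg g).2 hs
        rwa [h1] at this
    obtain ⟨h1, h2⟩ := hN S s hs.1
    exact ⟨h1.subset sub, (Set.ncard_le_ncard sub h1).trans h2⟩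
  have ht' : t⁻¹ • S ≠ S := fun e => ht (by rw [inv_smul_eq_iff] at e; exact e.symm)
  have tx := (hCg t S x).2 hx
  have tx' := (hCg t⁻¹ S x).2 hx
  obtain ⟨s, hs1⟩ := nearest_nonempty d (hC.ne S) (t⁻¹ • x)
  obtain ⟨u, hu1⟩ := nearest_nonempty d (hC.ne S) (t • x)
  obtain ⟨n, hn⟩ := hgrow (d x s + d u x + 2 * (20 * θ) + 1)
  have hFn : F ^ n • S = S :=
    (MulAction.stabilizer Γ S).pow_mem (MulAction.mem_stabilizer_iff.2 hF) n
  have e1 : (F ^ n * t)⁻¹ • S = t⁻¹ • S := by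
    rw [mul_inv_rev, mul_smul, inv_smul_eq_iff.2 hFn.symm]
  have n2 : (F ^ n * t) • S ≠ S := by
    intro e
    rw [mul_smul, ← eq_inv_smul_iff, inv_smul_eq_iff.2 hFn.symm] at e
    exact ht e
  refine ⟨_, _, acylData_cntDist hs hinv hstab (g := F ^ n * t) (v := S) (by rwa [e1]) n2 ?_⟩
  refine lt_of_lt_of_le ?_ (pd_le_sideDist hp (by rwa [e1]) n2)
  rw [e1, mul_smul]
  rw [mul_smul] at n2
  have hu2 := (nearest_smul hd hCg (F ^ n)).2 hu1
  rw [hFn] at hu2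
  have h1 := hC.le_coneProj hd ht' n2 tx' ((hCg (F ^ n) _ _).2 tx) hs1 hu2
  have h2 := hd.tri x s (F ^ n • x)
  have h3 := hd.tri s (F ^ n • u) (F ^ n • x)
  rw [hd.inv] at h3
  omega

end

/-- An element `F` whose orbit through `x` is a quasigeodesic with almost additive distances, and
which acts properly discontinuously along this orbit. -/
structure Axis {Γ Q : Type*} [Group Γ] [MulAction Γ Q] (d : Q → Q → ℕ) (δ : ℕ) (F : Γ) (x : Q)
    (A : ℕ → ℕ) (C : ℕ) : Prop where
  dist : ∀ i j : ℤ, d (F ^ i • x) (F ^ j • x) = A (j - i).natAbs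
  le : δ ≤ C
  step : ∀ n, A (n + 1) ≤ A n + C
  incr : ∀ n, A n + 1 ≤ A (n + 1)
  super : ∀ m n, A m + A n ≤ A (m + n) + C
  wpd : ∀ D : ℕ, ∃ M : ℕ,
    {g : Γ | d x (g • x) ≤ D ∧ d (F ^ (M : ℤ) • x) (g • F ^ (M : ℤ) • x) ≤ D}.Finite

section
variable {Γ Q : Type*} [Group Γ] [MulAction Γ Q] {d : Q → Q → ℕ} {δ : ℕ}

theorem HypAct.self (hd : HypAct (Γ := Γ) d δ) (p : Q) : d p p = 0 := (hd.eq_iff p p).2 rfl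

theorem HypAct.dist_zpow (hd : HypAct (Γ := Γ) d δ) (F : Γ) (x : Q) (i j : ℤ) :
    d (F ^ i • x) (F ^ j • x) = d x (F ^ (j - i).natAbs • x) := by
  have key : ∀ i j : ℤ, i ≤ j → d (F ^ i • x) (F ^ j • x) = d x (F ^ (j - i).natAbs • x) := by
    intro i j h
    have e : F ^ j = F ^ i * F ^ (j - i).natAbs := by
      rw [← zpow_natCast F, ← zpow_add]
      congr 1
      omega
    rw [e, mul_smul, hd.inv]
  rcases le_total i j with h | h
  · exact key i j h
  · rw [hd.symm, key j i h, ← Int.natAbs_neg, neg_sub]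

/-- Points almost on a geodesic stay almost on it when an endpoint is moved. -/
theorem HypAct.btw_move (hd : HypAct (Γ := Γ) d δ) {p m q q' : Q} {e c : ℕ}
    (h : d p m + d m q ≤ d p q + e) (hq : d q q' ≤ c) (hm : c + e + δ < d m q) :
    d p m + d m q' ≤ d p q' + (e + δ) := by
  have h1 := hd.hyp p q m q'
  have h2 := hd.symm q m
  omega

theorem exists_doubling {f : Γ} {x : Q} (hgr : ∃ k n₀ : ℕ, ∀ n, n₀ ≤ n → n ≤ k * d x (f ^ n • x))
    (T : ℕ) : ∃ s : ℕ, 1 ≤ s ∧ d x (f ^ s • x) + T ≤ d x (f ^ (2 * s) • x) := by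
  by_contra hcon
  push Not at hcon
  obtain ⟨k, n₀, hk⟩ := hgr
  have hpow : ∀ j : ℕ, d x (f ^ (2 ^ j) • x) ≤ d x (f • x) + j * T := by
    intro j
    induction j with
    | zero => simp
    | succ j ih =>
      have := hcon (2 ^ j) (Nat.one_le_two_pow)
      rw [pow_succ', add_one_mul j T]
      omega
  set j := n₀ + k * (d x (f • x) + 2 * T) with hj
  have h1 := hk (2 ^ (2 * j)) ((Nat.lt_two_pow_self (n := 2 * j)).le.trans' (by omega))
  have h2 := hpow (2 * j)
  have h3 := Nat.lt_two_pow_self (n := j)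
  have h4 : 2 ^ (2 * j) = 2 ^ j * 2 ^ j := by rw [two_mul, pow_add]
  have h5 : (j + 1) * (j + 1) ≤ 2 ^ (2 * j) := by
    rw [h4]
    exact Nat.mul_le_mul h3 h3
  have h6 : k * d x (f ^ (2 ^ (2 * j)) • x) ≤ k * (d x (f • x) + 2 * j * T) :=
    Nat.mul_le_mul_left _ h2
  have h7 : k * (d x (f • x) + 2 * j * T) ≤ (k * (d x (f • x) + 2 * T)) * (j + 1) := by
    have e : (k * (d x (f • x) + 2 * T)) * (j + 1) =
        k * (d x (f • x) + 2 * j * T) + k * (d x (f • x) * j + 2 * T) := by ring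
    omega
  have h8 : (k * (d x (f • x) + 2 * T)) * (j + 1) ≤ j * (j + 1) := Nat.mul_le_mul_right _ (by omega)
  nlinarith

/-- A suitable power of a WPD element has an axis. -/
theorem exists_axis (hd : HypAct (Γ := Γ) d δ) {f t : Γ} {x : Q} (h : WPDData d f t x) :
    ∃ (s : ℕ) (A : ℕ → ℕ) (C : ℕ), 1 ≤ s ∧ Axis d δ (f ^ s) x A C := by
  obtain ⟨s, hs, hdbl⟩ := exists_doubling h.growth (2 * δ + 1)
  set F := f ^ s with hF
  set A : ℕ → ℕ := fun n => d x (F ^ n • x) with hA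
  have dist : ∀ i j : ℤ, d (F ^ i • x) (F ^ j • x) = A (j - i).natAbs := hd.dist_zpow F x
  have A0 : A 0 = 0 := by simp [hA, hd.self]
  have step : ∀ n, A (n + 1) ≤ A n + A 1 := by
    intro n
    have h1 := hd.tri (F ^ (0 : ℤ) • x) (F ^ (n : ℤ) • x) (F ^ (n + 1 : ℤ) • x)
    rw [dist, dist, dist] at h1
    rwa [show ((n : ℤ) + 1 - 0).natAbs = n + 1 by omega, show ((n : ℤ) - 0).natAbs = n by omega,
      show ((n : ℤ) + 1 - n).natAbs = 1 by omega] at h1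
  have A2 : A 1 + (2 * δ + 1) ≤ A 2 := by
    change d x (F ^ 1 • x) + (2 * δ + 1) ≤ d x (F ^ 2 • x)
    rwa [pow_one, hF, ← pow_mul, mul_comm s 2]
  have incr : ∀ n, A n + δ + 1 ≤ A (n + 1) := by
    intro n
    induction n with
    | zero =>
      have := step 1
      simp only [zero_add, A0]
      simp only [Nat.reduceAdd] at this
      omega
    | succ n ih =>
      have h1 := hd.hyp (F ^ (0 : ℤ) • x) (F ^ (2 : ℤ) • x) (F ^ (1 : ℤ) • x)
        (F ^ (n + 2 : ℤ) • x)
      simp only [dist] at h1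
      have e1 : ((n : ℤ) + 2 - 1).natAbs = n + 1 := by omega
      have e2 : ((n : ℤ) + 2 - 2).natAbs = n := by omega
      have e3 : ((n : ℤ) + 2 - 0).natAbs = n + 2 := by omega
      have e4 : ((2 : ℤ) - 0).natAbs = 2 := rfl
      have e5 : ((1 : ℤ) - 0).natAbs = 1 := rfl
      have e6 : ((1 : ℤ) - 2).natAbs = 1 := rfl
      rw [e1, e2, e3, e4, e5, e6] at h1
      rw [show n + 1 + 1 = n + 2 from rfl]
      omega
  have super : ∀ m n, A m + A n ≤ A (m + n) + (A 1 + δ) := by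
    intro n m
    rcases m with _ | m
    · simp [A0]
    · have h1 := hd.hyp (F ^ (0 : ℤ) • x) (F ^ (n + 1 : ℤ) • x) (F ^ (n : ℤ) • x)
        (F ^ (n + (m + 1) : ℤ) • x)
      simp only [dist] at h1
      have e1 : ((n : ℤ) + 1 - 0).natAbs = n + 1 := by omega
      have e2 : ((n : ℤ) - 0).natAbs = n := by omega
      have e3 : ((n : ℤ) + (m + 1) - n).natAbs = m + 1 := by omega
      have e4 : ((n : ℤ) + (m + 1) - (n + 1)).natAbs = m := by omega
      have e5 : ((n : ℤ) + (m + 1) - 0).natAbs = n + (m + 1) := by omega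
      have e6 : ((n : ℤ) - (n + 1)).natAbs = 1 := by omega
      rw [e1, e2, e3, e4, e5, e6] at h1
      have h2 := incr n
      have h3 := incr m
      omega
  refine ⟨s, A, A 1 + δ, hs, dist, by omega, fun n => (step n).trans (by omega),
    fun n => (incr n).trans' (by omega), super, fun D => ?_⟩
  have hlip : ∀ r, d x (f ^ r • x) ≤ r * d x (f • x) := by
    intro r
    induction r with
    | zero => simp [hd.self]
    | succ r ih =>
      have h1 := hd.tri x (f ^ r • x) (f ^ (r + 1) • x)
      rw [pow_succ, mul_smul, hd.inv, ← mul_smul, ← pow_succ] at h1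
      rw [Nat.succ_mul]
      omega
  obtain ⟨M, hM⟩ := h.wpd (2 * (s * d x (f • x)) + 3 * D + 2 * (A 1 + δ))
  refine ⟨M, hM.subset ?_⟩
  rintro g ⟨h1, h2⟩
  refine ⟨by omega, ?_⟩
  have hq : M / s ≤ M := Nat.div_le_self _ _
  set q := M / s with hq'
  have hr : f ^ M = F ^ q * f ^ (M % s) := by
    rw [hF, ← pow_mul, ← pow_add, Nat.div_add_mod]
  have near : d (F ^ q • x) (f ^ M • x) ≤ s * d x (f • x) := by
    rw [hr, mul_smul, hd.inv]
    exact (hlip _).trans (Nat.mul_le_mul_right _ (Nat.mod_lt _ (by omega)).le)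
  have f1 : d x (F ^ M • x) = A M := rfl
  have f2 : d x (F ^ q • x) = A q := rfl
  have f3 : d (F ^ q • x) (F ^ M • x) = A (M - q) := by
    have := dist q M
    rwa [zpow_natCast, zpow_natCast, show ((M : ℤ) - q).natAbs = M - q by omega] at this
  rw [zpow_natCast, ← hF] at h2
  have f4 := super q (M - q)
  rw [show q + (M - q) = M by omega] at f4
  have g1 := hd.tri x (g • x) (g • F ^ q • x)
  have g2 := hd.tri (g • F ^ q • x) (g • F ^ M • x) (F ^ M • x)
  have g3 := hd.symm (g • F ^ M • x) (F ^ M • x)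
  have g6 := hd.tri x (g • x) (F ^ q • x)
  have g7 := hd.tri (g • x) x (g • F ^ q • x)
  have g8 := hd.symm x (g • x)
  rw [hd.inv] at g1 g2 g7
  have g4 := hd.fellow (a := x) (b := F ^ M • x) (p := F ^ q • x) (p' := g • F ^ q • x)
    (e := 2 * D + (A 1 + δ)) (by omega) (by omega)
  have g5 := hd.tri (f ^ M • x) (F ^ q • x) (g • f ^ M • x)
  have k1 := hd.tri (F ^ q • x) (g • F ^ q • x) (g • f ^ M • x)
  rw [hd.inv] at k1
  have k2 := hd.symm (f ^ M • x) (F ^ q • x)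
  omega

variable {F : Γ} {x : Q} {A : ℕ → ℕ} {C : ℕ}

theorem Axis.dist_zero (hA : Axis d δ F x A C) (j : ℤ) : d x (F ^ j • x) = A j.natAbs := by
  have := hA.dist 0 j
  rwa [zpow_zero, one_smul, sub_zero] at this

theorem Axis.add_le (hA : Axis d δ F x A C) (n k : ℕ) : A n + k ≤ A (n + k) := by
  induction k with
  | zero => rfl
  | succ k ih =>
    have := hA.incr (n + k)
    rw [show n + (k + 1) = n + k + 1 from rfl]
    omega

theorem Axis.mono (hA : Axis d δ F x A C) {n m : ℕ} (h : n ≤ m) : A n ≤ A m := by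
  have := hA.add_le n (m - n)
  rw [Nat.add_sub_cancel' h] at this
  omega

/-- The neighborhood of radius `c` of the orbit of `x` under `F`. -/
def nearAxis {Γ Q : Type*} [Group Γ] [MulAction Γ Q] (d : Q → Q → ℕ) (F : Γ) (x : Q) (c : ℕ) :
    Set Q := {q | ∃ i : ℤ, d q (F ^ i • x) ≤ c}

theorem nearAxis_mono (F : Γ) (x : Q) {c c' : ℕ} (h : c ≤ c') :
    nearAxis d F x c ⊆ nearAxis d F x c' := fun _ ⟨i, hi⟩ => ⟨i, hi.trans h⟩

theorem Axis.near_of_btw (hd : HypAct (Γ := Γ) d δ) (hA : Axis d δ F x A C) {q : Q} {i j : ℤ}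
    {e : ℕ} (h : d (F ^ i • x) q + d q (F ^ j • x) ≤ d (F ^ i • x) (F ^ j • x) + e) :
    q ∈ nearAxis d F x (2 * e + 3 * C) := by
  wlog hij : i ≤ j generalizing i j
  · refine this (i := j) (j := i) ?_ (by omega)
    have h1 := hd.symm (F ^ i • x) q
    have h2 := hd.symm (F ^ j • x) q
    have h3 := hd.symm (F ^ i • x) (F ^ j • x)
    omega
  obtain ⟨n, rfl⟩ := Int.le.dest hij
  have hle := hA.le
  have A0 : A 0 = 0 := by
    have := hA.dist 0 0
    rw [hd.self] at this
    exact this.symm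
  have ex : ∃ k ≤ n, A k ≤ d (F ^ i • x) q ∧ d (F ^ i • x) q ≤ A k + C + e := by
    have h1 := hA.dist i (i + n)
    rw [show (i + (n : ℤ) - i).natAbs = n by omega] at h1
    by_contra hcon
    push Not at hcon
    have hind : ∀ k ≤ n, A k ≤ d (F ^ i • x) q := by
      intro k
      induction k with
      | zero => intro _; omega
      | succ k ih =>
        intro hk
        have h2 := hcon k (by omega) (ih (by omega))
        have h3 := hA.step k
        omega
    have h2 := hcon n le_rfl (hind n le_rfl)
    omega
  obtain ⟨k, hk, h1, h2⟩ := ex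
  have h3 := hA.dist i (i + k)
  have h4 := hA.dist (i + k) (i + n)
  have h5 := hA.dist i (i + n)
  have h6 := hA.super k (n - k)
  rw [show (i + (k : ℤ) - i).natAbs = k by omega] at h3
  rw [show (i + (n : ℤ) - (i + k)).natAbs = n - k by omega] at h4
  rw [show (i + (n : ℤ) - i).natAbs = n by omega] at h5
  rw [show k + (n - k) = n by omega] at h6
  have h7 := hd.fellow (a := F ^ i • x) (b := F ^ (i + (n : ℤ)) • x) (p := q)
    (p' := F ^ (i + (k : ℤ)) • x) (e := e + C) (by omega) (by omega)
  exact ⟨i + k, by omega⟩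

/-- A point almost between two points near the axis is uniformly near to the axis, unless it is
close to one of the two points. -/
theorem Axis.tube (hd : HypAct (Γ := Γ) d δ) (hA : Axis d δ F x A C) {p q m : Q} {c e : ℕ}
    (hp : p ∈ nearAxis d F x c) (hq : q ∈ nearAxis d F x c) (h : d p m + d m q ≤ d p q + e) :
    d p m ≤ c + e + 2 * δ ∨ d m q ≤ c + e + δ ∨ m ∈ nearAxis d F x (2 * e + 7 * C) := by
  by_contra hcon
  push Not at hcon
  obtain ⟨h1, h2, h3⟩ := hcon
  obtain ⟨i, hi⟩ := hp
  obtain ⟨j, hj⟩ := hq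
  have hle := hA.le
  have k1 := hd.btw_move h hj (by omega)
  have s1 := hd.symm p m
  have s2 := hd.symm m (F ^ j • x)
  have s3 := hd.symm p (F ^ j • x)
  have k2 := hd.btw_move (p := F ^ j • x) (m := m) (q := p) (q' := F ^ i • x) (e := e + δ) (c := c)
    (by omega) hi (by omega)
  refine h3 (nearAxis_mono F x ?_ (hA.near_of_btw hd k2))
  omega

/-- The elements preserving the axis up to finite distance. -/
def axisStab (hd : HypAct (Γ := Γ) d δ) (F : Γ) (x : Q) : Subgroup Γ where
  carrier := {g | ∃ c, ∀ i : ℤ, g • F ^ i • x ∈ nearAxis d F x c ∧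
    g⁻¹ • F ^ i • x ∈ nearAxis d F x c}
  mul_mem' := by
    have key : ∀ {g h : Γ} {c c' : ℕ}, (∀ i : ℤ, g • F ^ i • x ∈ nearAxis d F x c) →
        (∀ i : ℤ, h • F ^ i • x ∈ nearAxis d F x c') →
        ∀ i : ℤ, (g * h) • F ^ i • x ∈ nearAxis d F x (c + c') := by
      intro g h c c' hg hh i
      obtain ⟨j, hj⟩ := hh i
      obtain ⟨k, hk⟩ := hg j
      refine ⟨k, ?_⟩
      have h1 := hd.tri (g • h • F ^ i • x) (g • F ^ j • x) (F ^ k • x)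
      rw [hd.inv] at h1
      rw [mul_smul]
      omega
    rintro g h ⟨c, hc⟩ ⟨c', hc'⟩
    refine ⟨c + c', fun i => ⟨key (fun i => (hc i).1) (fun i => (hc' i).1) i, ?_⟩⟩
    rw [mul_inv_rev, add_comm]
    exact key (fun i => (hc' i).2) (fun i => (hc i).2) i
  one_mem' := ⟨0, fun i => by
    simp only [inv_one, one_smul, and_self]
    exact ⟨i, (hd.self _).le⟩⟩
  inv_mem' := by
    rintro g ⟨c, hc⟩
    exact ⟨c, fun i => ⟨(hc i).2, by rw [inv_inv]; exact (hc i).1⟩⟩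

theorem mem_axisStab_self (hd : HypAct (Γ := Γ) d δ) (F : Γ) (x : Q) : F ∈ axisStab hd F x :=
  ⟨0, fun i => ⟨⟨1 + i, by rw [zpow_add, zpow_one, mul_smul]; exact (hd.self _).le⟩,
    ⟨-1 + i, by rw [zpow_add, zpow_neg_one, mul_smul]; exact (hd.self _).le⟩⟩⟩

theorem Axis.near_of_mem (hd : HypAct (Γ := Γ) d δ) (hA : Axis d δ F x A C) {g : Γ}
    (hg : g ∈ axisStab hd F x) (i : ℤ) : g • F ^ i • x ∈ nearAxis d F x (9 * C) := by
  obtain ⟨c, hc⟩ := hg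
  set N := c + C + 2 * δ + 1 with hN
  have h1 := hA.dist (i - N) i
  have h2 := hA.dist i (i + N)
  have h3 := hA.dist (i - N) (i + N)
  have h4 := hA.super N N
  have h5 := hA.add_le 0 N
  rw [show (i - (i - (N : ℤ))).natAbs = N by omega] at h1
  rw [show (i + (N : ℤ) - i).natAbs = N by omega] at h2
  rw [show (i + (N : ℤ) - (i - N)).natAbs = N + N by omega] at h3
  rw [zero_add] at h5
  have h6 := hA.tube hd (m := g • F ^ i • x) (e := C) (hc (i - N)).1 (hc (i + N)).1
    (by simp only [hd.inv]; omega)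
  simp only [hd.inv] at h6
  rcases h6 with h6 | h6 | h6
  · omega
  · omega
  · exact nearAxis_mono F x (by omega) h6

end

section
variable {Γ Q : Type*} [Group Γ] [MulAction Γ Q] {d : Q → Q → ℕ} {δ : ℕ}
variable {F : Γ} {x : Q} {A : ℕ → ℕ} {C : ℕ}

/-- An axis whose endpoints are close to the axis fellow travels it. -/
theorem Axis.fellow_axis (hd : HypAct (Γ := Γ) d δ) (hA : Axis d δ F x A C) {g : Γ} {c n : ℕ}
    {k : ℤ} (h0 : d x (g • x) ≤ c) (hn : d (g • F ^ (n : ℤ) • x) (F ^ k • x) ≤ c) :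
    ∃ ε : ℤ, (ε = 1 ∨ ε = -1) ∧
      ∀ l : ℕ, l + 2 * c ≤ n → d (g • F ^ (l : ℤ) • x) (F ^ (ε * l) • x) ≤ 5 * c + 2 * C := by
  have hle := hA.le
  have a1 := hA.dist_zero n
  have a2 := hA.dist_zero k
  have b1 := hd.tri x (g • x) (F ^ k • x)
  have b2 := hd.tri (g • x) (g • F ^ (n : ℤ) • x) (F ^ k • x)
  have b3 := hd.tri (g • x) x (g • F ^ (n : ℤ) • x)
  have b4 := hd.tri x (F ^ k • x) (g • F ^ (n : ℤ) • x)
  have b5 := hd.symm (F ^ k • x) (g • F ^ (n : ℤ) • x)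
  have b6 := hd.symm x (g • x)
  rw [hd.inv] at b2 b3
  rw [Int.natAbs_natCast] at a1
  have hk : n ≤ k.natAbs + 2 * c := by
    by_contra hcon
    have := hA.add_le k.natAbs (n - k.natAbs)
    rw [show k.natAbs + (n - k.natAbs) = n by omega] at this
    omega
  have hε : ∃ ε : ℤ, (ε = 1 ∨ ε = -1) ∧ k = ε * k.natAbs := by
    rcases le_total 0 k with h | h
    · exact ⟨1, Or.inl rfl, by omega⟩
    · exact ⟨-1, Or.inr rfl, by omega⟩
  obtain ⟨ε, h1, h2⟩ := hε
  refine ⟨ε, h1, fun l hl => ?_⟩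
  have c1 := hA.dist_zero (ε * l)
  have c2 := hA.dist (ε * l) k
  have c3 := hA.dist l n
  have c4 := hA.dist_zero l
  rw [show (ε * (l : ℤ)).natAbs = l by rcases h1 with rfl | rfl <;> omega] at c1
  rw [show (k - ε * (l : ℤ)).natAbs = k.natAbs - l by
    rcases h1 with rfl | rfl <;> omega] at c2
  rw [show ((n : ℤ) - l).natAbs = n - l by omega] at c3
  rw [Int.natAbs_natCast] at c4
  have s1 := hA.super l (n - l)
  have s2 := hA.super l (k.natAbs - l)
  rw [show l + (n - l) = n by omega] at s1
  rw [show l + (k.natAbs - l) = k.natAbs by omega] at s2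
  have e1 := hd.tri x (g • x) (g • F ^ (l : ℤ) • x)
  have e2 := hd.tri (g • x) x (g • F ^ (l : ℤ) • x)
  have e3 := hd.tri (g • F ^ (l : ℤ) • x) (g • F ^ (n : ℤ) • x) (F ^ k • x)
  rw [hd.inv] at e1 e2 e3
  have := hd.fellow (a := x) (b := F ^ k • x) (p := g • F ^ (l : ℤ) • x)
    (p' := F ^ (ε * (l : ℤ)) • x) (e := C + 4 * c) (by omega) (by omega)
  omega

theorem Axis.finite_pm (hd : HypAct (Γ := Γ) d δ) (hA : Axis d δ F x A C) (D : ℕ) :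
    ∃ M : ℕ, {g : Γ | d x (g • x) ≤ D ∧ ∃ ε : ℤ, (ε = 1 ∨ ε = -1) ∧
      d (g • F ^ (M : ℤ) • x) (F ^ (ε * M) • x) ≤ D}.Finite := by
  obtain ⟨M, hM⟩ := hA.wpd (2 * D)
  refine ⟨M, ?_⟩
  have key : ∀ ε : ℤ, {g : Γ | d x (g • x) ≤ D ∧
      d (g • F ^ (M : ℤ) • x) (F ^ (ε * M) • x) ≤ D}.Finite := by
    intro ε
    rcases Set.eq_empty_or_nonempty {g : Γ | d x (g • x) ≤ D ∧
      d (g • F ^ (M : ℤ) • x) (F ^ (ε * M) • x) ≤ D} with h | ⟨g₀, h1, h2⟩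
    · rw [h]
      exact Set.finite_empty
    · refine Set.Finite.subset (hM.image fun g => g₀ * g) ?_
      rintro g ⟨h3, h4⟩
      refine ⟨g₀⁻¹ * g, ⟨?_, ?_⟩, mul_inv_cancel_left _ _⟩
      · rw [← hd.inv g₀, mul_smul, smul_inv_smul]
        have k1 := hd.tri (g₀ • x) x (g • x)
        have k2 := hd.symm x (g₀ • x)
        omega
      · rw [← hd.inv g₀, mul_smul, smul_inv_smul]
        have k1 := hd.tri (g₀ • F ^ (M : ℤ) • x) (F ^ (ε * M) • x) (g • F ^ (M : ℤ) • x)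
        have k2 := hd.symm (F ^ (ε * M) • x) (g • F ^ (M : ℤ) • x)
        omega
  refine ((key 1).union (key (-1))).subset ?_
  rintro g ⟨h1, ε, rfl | rfl, h2⟩
  · exact Or.inl ⟨h1, h2⟩
  · exact Or.inr ⟨h1, h2⟩

theorem Axis.near_of_comm (hd : HypAct (Γ := Γ) d δ) (hA : Axis d δ F x A C) {g : Γ} {r : ℕ}
    (hr : 0 < r) {r' : ℤ} (h : g * F ^ (r : ℤ) = F ^ r' * g) :
    ∀ i : ℤ, g • F ^ i • x ∈ nearAxis d F x (A r + d (g • x) x) := by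
  intro i
  have h1 : ∀ q : ℤ, g * (F ^ (r : ℤ)) ^ q = (F ^ r') ^ q * g := fun q =>
    (SemiconjBy.zpow_right (h : SemiconjBy g (F ^ (r : ℤ)) (F ^ r')) q)
  have hs := Int.emod_nonneg i (b := r) (by omega)
  have hs' := Int.emod_lt_of_pos i (b := r) (by omega)
  have e : i = r * (i / r) + i % r := (Int.mul_ediv_add_emod i r).symm
  refine ⟨r' * (i / r), ?_⟩
  have e2 : g • F ^ i • x = F ^ (r' * (i / r)) • g • F ^ (i % r) • x := by
    conv_lhs => rw [e]
    rw [zpow_add, zpow_mul, zpow_mul, mul_smul, ← mul_smul, h1, mul_smul]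
  rw [e2, hd.inv]
  have k1 := hd.tri (g • F ^ (i % r) • x) (g • x) x
  have k2 := hd.symm (F ^ (i % r) • x) x
  have k3 := hA.dist_zero (i % r)
  have k4 := hA.mono (n := (i % r).natAbs) (m := r) (by omega)
  rw [hd.inv] at k1
  omega

theorem Axis.mem_of_comm (hd : HypAct (Γ := Γ) d δ) (hA : Axis d δ F x A C) {g : Γ} {r : ℕ}
    (hr : 0 < r) {ε : ℤ} (hε : ε = 1 ∨ ε = -1) (h : g * F ^ (r : ℤ) = F ^ (ε * r) * g) :
    g ∈ axisStab hd F x := by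
  have h' : g⁻¹ * F ^ (r : ℤ) = F ^ (ε * r) * g⁻¹ := by
    have hs : SemiconjBy g (F ^ (r : ℤ)) (F ^ (ε * r)) := h
    have hs' := hs.inv_symm_left
    rcases hε with rfl | rfl
    · simpa only [one_mul] using hs'.eq
    · have := hs'.inv_right
      simp only [← zpow_neg, neg_mul, one_mul, neg_neg] at this ⊢
      exact this.eq
  refine ⟨max (A r + d (g • x) x) (A r + d (g⁻¹ • x) x), fun i => ⟨?_, ?_⟩⟩
  · exact nearAxis_mono F x (le_max_left _ _) (hA.near_of_comm hd hr h i)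
  · exact nearAxis_mono F x (le_max_right _ _) (hA.near_of_comm hd hr h' i)

/-- Elements outside the stabilizer of the axis move it away. -/
theorem Axis.overlap_bdd (hd : HypAct (Γ := Γ) d δ) (hA : Axis d δ F x A C) (c : ℕ) :
    ∃ B : ℕ, ∀ g ∉ axisStab hd F x, ∀ (i : ℤ) (n : ℕ), g • F ^ i • x ∈ nearAxis d F x c →
      g • F ^ (i + n) • x ∈ nearAxis d F x c → n ≤ B := by
  obtain ⟨M, hM⟩ := hA.finite_pm hd (5 * c + 2 * C)
  set W := {g : Γ | d x (g • x) ≤ 5 * c + 2 * C ∧ ∃ ε : ℤ, (ε = 1 ∨ ε = -1) ∧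
      d (g • F ^ (M : ℤ) • x) (F ^ (ε * M) • x) ≤ 5 * c + 2 * C} with hW
  refine ⟨W.ncard + M + 2 * c, fun g hg i n hi hn => ?_⟩
  by_contra hlt
  push Not at hlt
  obtain ⟨k, hk⟩ := hi
  obtain ⟨k', hk'⟩ := hn
  set u := F ^ (-k) * g * F ^ i with hu
  have hug : u ∉ axisStab hd F x := by
    intro h
    apply hg
    have e : g = F ^ k * u * F ^ (-i) := by rw [hu]; group
    rw [e]
    have hF := mem_axisStab_self hd F x
    exact mul_mem (mul_mem (zpow_mem hF _) h) (zpow_mem hF _)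
  have h0 : d x (u • x) ≤ c := by
    rw [hu, mul_smul, mul_smul, ← hd.inv (F ^ k), ← mul_smul (F ^ k) (F ^ (-k)), ← zpow_add,
      add_neg_cancel, zpow_zero, one_smul, hd.symm]
    exact hk
  have h1 : d (u • F ^ (n : ℤ) • x) (F ^ (-k + k') • x) ≤ c := by
    rw [hu, mul_smul, mul_smul, zpow_add, mul_smul, hd.inv, ← mul_smul (F ^ i), ← zpow_add]
    exact hk'
  obtain ⟨ε, hε, hl⟩ := hA.fellow_axis hd h0 h1
  have hmem : ∀ l : ℕ, l ≤ W.ncard → F ^ (-(ε * l)) * u * F ^ (l : ℤ) ∈ W := by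
    intro l hlW
    refine ⟨?_, ε, hε, ?_⟩
    · have := hl l (by omega)
      rw [mul_smul, mul_smul, ← hd.inv (F ^ (ε * l)), ← mul_smul (F ^ (ε * l)) (F ^ (-(ε * l))),
        ← zpow_add, add_neg_cancel, zpow_zero, one_smul, hd.symm]
      exact this
    · have := hl (l + M) (by omega)
      rw [mul_smul, mul_smul, ← hd.inv (F ^ (ε * l)), ← mul_smul (F ^ (ε * l)) (F ^ (-(ε * l))),
        ← zpow_add, add_neg_cancel, zpow_zero, one_smul, ← mul_smul (F ^ (ε * l)), ← zpow_add,
        ← mul_smul (F ^ (l : ℤ)), ← zpow_add, ← mul_add]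
      push_cast at this
      exact this
  obtain ⟨a, ha, b, hb, hab, e⟩ := Finset.exists_ne_map_eq_of_card_lt_of_maps_to
    (s := Finset.range (W.ncard + 1)) (t := hM.toFinset)
    (f := fun l : ℕ => F ^ (-(ε * l)) * u * F ^ (l : ℤ))
    (by rw [← Set.ncard_eq_toFinset_card W hM, Finset.card_range]; omega)
    (by
      intro l hl
      have := Finset.mem_range.1 (Finset.mem_coe.1 hl)
      simpa only [Set.Finite.coe_toFinset] using hmem l (by omega))
  have fin : ∀ a b : ℕ, a < b → F ^ (-(ε * a)) * u * F ^ (a : ℤ) =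
      F ^ (-(ε * b)) * u * F ^ (b : ℤ) → False := by
    intro a b hab e
    apply hug
    refine hA.mem_of_comm hd (r := b - a) (by omega) hε ?_
    have e1 : u = F ^ (ε * a) * (F ^ (-(ε * b)) * u * F ^ (b : ℤ)) * F ^ (-(a : ℤ)) := by
      rw [← e]
      group
    have e2 : ((b - a : ℕ) : ℤ) = b - a := by omega
    rw [e2]
    conv_rhs => rw [e1]
    have e3 : ε * ((b : ℤ) - a) = ε * b + -(ε * a) := by ring
    rw [e3]
    group
  rcases lt_or_gt_of_ne hab with h | h
  · exact fin a b h e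
  · exact fin b a h e.symm

theorem Axis.finite_stab (hd : HypAct (Γ := Γ) d δ) (hA : Axis d δ F x A C) (c : ℕ) :
    {g : Γ | g ∈ axisStab hd F x ∧ d x (g • x) ≤ c}.Finite := by
  obtain ⟨M, hM⟩ := hA.finite_pm hd (5 * (c + 9 * C) + 2 * C)
  refine hM.subset ?_
  rintro g ⟨hg, hc⟩
  obtain ⟨k, hk⟩ := hA.near_of_mem hd hg ((M + 2 * (c + 9 * C) : ℕ) : ℤ)
  obtain ⟨ε, hε, hl⟩ := hA.fellow_axis hd (hc.trans (Nat.le_add_right c (9 * C)))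
    (hk.trans (Nat.le_add_left (9 * C) c))
  exact ⟨by omega, ε, hε, hl M le_rfl⟩

theorem Axis.not_mem_of_indep {f t : Γ} {s : ℕ} (hd : HypAct (Γ := Γ) d δ)
    (hA : Axis d δ (f ^ s) x A C) (h : WPDData d f t x) : t ∉ axisStab hd (f ^ s) x := by
  intro ht
  obtain ⟨N, hN⟩ := h.indep (9 * C + 1)
  obtain ⟨N', hN'⟩ := h.growth' (9 * C + A N + 1)
  set n := max N N' with hn
  have h1 := hN' n (le_max_right _ _)
  obtain ⟨k, hk⟩ := hA.near_of_mem hd (pow_mem ht n) 0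
  rw [zpow_zero, one_smul] at hk
  have h2 := hd.tri x ((f ^ s) ^ k • x) (t ^ n • x)
  have h3 := hd.symm ((f ^ s) ^ k • x) (t ^ n • x)
  have h4 := hA.dist_zero k
  have hkN : N ≤ k.natAbs := by
    by_contra hlt
    have := hA.mono (n := k.natAbs) (m := N) (by omega)
    omega
  have hs : s ≠ 0 := by
    rintro rfl
    have h7 := hA.add_le 0 1
    rw [zero_add] at h7
    have h5 := hA.dist_zero 1
    have h6 := hA.dist_zero 0
    simp only [pow_zero, one_zpow, one_smul, hd.self] at h5 h6
    simp only [Int.natAbs_one, Int.natAbs_zero] at h5 h6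
    omega
  have h5 := hN (s * k) n (by
    rw [Int.natAbs_mul, Int.natAbs_natCast]
    exact hkN.trans (Nat.le_mul_of_pos_left _ (by omega))) (by omega)
  rw [zpow_mul, zpow_natCast, zpow_natCast] at h5
  omega

end

/-- The type of translates of a subset. -/
def Translates (Γ : Type*) {Q : Type*} [Group Γ] [MulAction Γ Q] (B : Set Q) : Type _ :=
  {S : Set Q // ∃ g : Γ, ∀ p, p ∈ S ↔ g⁻¹ • p ∈ B}

/-- The action on the translates of a subset. -/
@[reducible]
def translatesAct {Γ Q : Type*} [Group Γ] [MulAction Γ Q] (B : Set Q) :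
    MulAction Γ (Translates Γ B) where
  smul g S := ⟨{p | g⁻¹ • p ∈ S.1}, by
    obtain ⟨h, hh⟩ := S.2
    refine ⟨g * h, fun p => ?_⟩
    rw [mul_inv_rev, mul_smul]
    exact hh _⟩
  one_smul S := Subtype.ext (by
    change {p | (1 : Γ)⁻¹ • p ∈ S.1} = S.1
    simp)
  mul_smul g h S := Subtype.ext (by
    change {p | (g * h)⁻¹ • p ∈ S.1} = {p | h⁻¹ • g⁻¹ • p ∈ S.1}
    simp only [mul_inv_rev, mul_smul])

theorem HypAct.exists_acylData.{u, w} {Γ : Type w} {Q : Type u} [Group Γ] [MulAction Γ Q]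
    {d : Q → Q → ℕ} {δ : ℕ} (hd : HypAct (Γ := Γ) d δ) {f t : Γ} {x : Q}
    (h : WPDData d f t x) :
    ∃ (V : Type u) (_ : MulAction Γ V) (σ : V → V → ℕ) (c : ℕ), AcylData (Γ := Γ) σ c := by
  obtain ⟨s, A, C, hs, hA⟩ := exists_axis hd h
  have ht := hA.not_mem_of_indep hd h
  set F := f ^ s with hF
  set E := axisStab hd F x with hE
  set B : Set Q := {p | ∃ g ∈ E, p = g • x} with hB
  let act := translatesAct (Γ := Γ) B
  have mem_smul : ∀ (g : Γ) (S : Translates Γ B) p, p ∈ (g • S).1 ↔ g⁻¹ • p ∈ S.1 :=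
    fun _ _ _ => Iff.rfl
  let S₀ : Translates Γ B := ⟨B, 1, fun p => by rw [inv_one, one_smul]⟩
  have hS : ∀ S : Translates Γ B, ∃ g : Γ, S = g • S₀ := by
    intro S
    obtain ⟨g, hg⟩ := S.2
    exact ⟨g, Subtype.ext (Set.ext hg)⟩
  have hxB : x ∈ B := ⟨1, one_mem E, (one_smul _ _).symm⟩
  have smulB : ∀ g ∈ E, ∀ p, g • p ∈ B ↔ p ∈ B := by
    have key : ∀ g ∈ E, ∀ p ∈ B, g • p ∈ B := by
      rintro g hg p ⟨g', hg', rfl⟩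
      exact ⟨g * g', mul_mem hg hg', (mul_smul _ _ _).symm⟩
    intro g hg p
    refine ⟨fun hp => ?_, key g hg p⟩
    have := key g⁻¹ (inv_mem hg) _ hp
    rwa [inv_smul_smul] at this
  have fixE : ∀ g ∈ E, g • S₀ = S₀ := fun g hg =>
    Subtype.ext (Set.ext fun p => smulB g⁻¹ (inv_mem hg) p)
  have nearB : ∀ g ∈ E, ∀ p ∈ B, g • p ∈ nearAxis d F x (9 * C) := by
    rintro g hg p ⟨g', hg', rfl⟩
    have := hA.near_of_mem hd (mul_mem hg hg') 0
    rwa [zpow_zero, one_smul, mul_smul] at this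
  have axB : ∀ i : ℤ, F ^ i • x ∈ B := fun i => ⟨F ^ i, zpow_mem (mem_axisStab_self hd F x) i, rfl⟩
  have stabE : ∀ g : Γ, g • S₀ = S₀ → g ∈ E := by
    intro g hg
    have key : ∀ g : Γ, g • S₀ = S₀ → ∀ i : ℤ, g • F ^ i • x ∈ nearAxis d F x (9 * C) := by
      intro g hg i
      have h1 : g • F ^ i • x ∈ (g • S₀).1 := by
        rw [mem_smul, inv_smul_smul]
        exact axB i
      rw [hg] at h1
      have := nearB 1 (one_mem E) _ h1
      rwa [one_smul] at this
    exact ⟨9 * C, fun i => ⟨key g hg i, key g⁻¹ (by rw [inv_smul_eq_iff, hg]) i⟩⟩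
  choose B₂ hB₂ using hA.overlap_bdd hd
  have hle := hA.le
  have hC : ConeSys (V := Translates Γ B) d (fun S => S.1) (11 * C)
      (fun c => A (B₂ (c + 18 * C)) + 9 * C) := by
    refine ⟨fun S => ?_, fun S p q m hp hq hm => ?_, fun S S' c p q hne hp hq hp' hq' => ?_⟩
    · obtain ⟨g, rfl⟩ := hS S
      exact ⟨g • x, by rw [mem_smul, inv_smul_smul]; exact hxB⟩
    · obtain ⟨g, rfl⟩ := hS S
      rw [mem_smul] at hp hq
      have hp1 := nearB 1 (one_mem E) _ hp
      have hq1 := nearB 1 (one_mem E) _ hq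
      rw [one_smul] at hp1 hq1
      have h1 := hA.tube hd (m := g⁻¹ • m) (e := 0) hp1 hq1 (by simp only [hd.inv]; omega)
      simp only [hd.inv] at h1
      rcases h1 with h1 | h1 | ⟨i, hi⟩
      · refine ⟨p, by rwa [mem_smul], ?_⟩
        rw [hd.symm]
        omega
      · exact ⟨q, by rwa [mem_smul], by omega⟩
      · refine ⟨g • F ^ i • x, by rw [mem_smul, inv_smul_smul]; exact axB i, ?_⟩
        rw [← hd.inv g, smul_inv_smul] at hi
        omega
    · obtain ⟨g, rfl⟩ := hS S
      obtain ⟨g', rfl⟩ := hS S'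
      obtain ⟨p', hp', hpp⟩ := hp'
      obtain ⟨q', hq', hqq⟩ := hq'
      rw [mem_smul] at hp hq hp' hq'
      obtain ⟨ε, hε, ep⟩ := hp
      have ep' : p = (g * ε) • x := by rw [mul_smul, ← ep, smul_inv_smul]
      obtain ⟨k, hk⟩ := nearB ε⁻¹ (inv_mem hε) _ hq
      rw [← hd.inv (g * ε), mul_smul g, smul_inv_smul, smul_inv_smul] at hk
      have hu : g'⁻¹ * (g * ε) ∉ E := by
        intro hmem
        apply hne
        have h1 := fixE _ (mul_mem hmem (inv_mem hε))
        rw [← mul_assoc, mul_inv_cancel_right, mul_smul, inv_smul_eq_iff] at h1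
        exact h1
      have near : ∀ r r', g'⁻¹ • r' ∈ B → d r r' ≤ c + 9 * C →
          g'⁻¹ • r ∈ nearAxis d F x (c + 18 * C) := by
        intro r r' hr' hrr
        obtain ⟨i, hi⟩ := nearB 1 (one_mem E) _ hr'
        rw [one_smul] at hi
        have h1 := hd.tri (g'⁻¹ • r) (g'⁻¹ • r') (F ^ i • x)
        rw [hd.inv] at h1
        exact ⟨i, by omega⟩
      have n1 : (g'⁻¹ * (g * ε)) • F ^ (0 : ℤ) • x ∈ nearAxis d F x (c + 18 * C) := by
        rw [zpow_zero, one_smul, mul_smul, ← ep']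
        exact near p p' hp' (by omega)
      have n2 : (g'⁻¹ * (g * ε)) • F ^ k • x ∈ nearAxis d F x (c + 18 * C) := by
        rw [mul_smul]
        refine near _ q' hq' ?_
        have h1 := hd.tri ((g * ε) • F ^ k • x) q q'
        have h2 := hd.symm ((g * ε) • F ^ k • x) q
        omega
      have hkB : k.natAbs ≤ B₂ (c + 18 * C) := by
        rcases le_total 0 k with hk0 | hk0
        · refine hB₂ _ _ hu 0 k.natAbs n1 ?_
          rwa [show (0 : ℤ) + (k.natAbs : ℤ) = k by omega]
        · refine hB₂ _ _ hu k k.natAbs n2 ?_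
          rwa [show k + (k.natAbs : ℤ) = 0 by omega]
      have h1 := hd.tri p ((g * ε) • F ^ k • x) q
      have h2 := hd.symm ((g * ε) • F ^ k • x) q
      have h3 : d p ((g * ε) • F ^ k • x) = A k.natAbs := by
        rw [ep', hd.inv, hA.dist_zero]
      have h4 := hA.mono hkB
      omega
  refine ⟨Translates Γ B, act, ?_⟩
  refine hC.acylData hd (F := F) (t := t) (S := S₀) (x := x) ?_ ?_ hxB
    (fixE F (mem_axisStab_self hd F x)) (fun e => ht (stabE t e)) ?_
  · intro g S p
    rw [mem_smul, inv_smul_smul]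
  · intro c
    have hfin := hA.finite_stab hd c
    refine ⟨{g : Γ | g ∈ E ∧ d x (g • x) ≤ c}.ncard, fun S p hp => ?_⟩
    · obtain ⟨g, rfl⟩ := hS S
      rw [mem_smul] at hp
      obtain ⟨ε, hε, ep⟩ := hp
      have ep' : p = (g * ε) • x := by rw [mul_smul, ← ep, smul_inv_smul]
      have sub : {h : Γ | h • g • S₀ = g • S₀ ∧ d p (h • p) ≤ c} ⊆
          (fun k => (g * ε) * k * (g * ε)⁻¹) '' {g : Γ | g ∈ E ∧ d x (g • x) ≤ c} := by
        rintro h ⟨h1, h2⟩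
        refine ⟨(g * ε)⁻¹ * h * (g * ε), ⟨?_, ?_⟩, by group⟩
        · apply stabE
          rw [mul_smul, mul_smul, mul_smul g, fixE ε hε, h1, mul_inv_rev, mul_smul, inv_smul_smul,
            fixE _ (inv_mem hε)]
        · rw [← hd.inv (g * ε), mul_smul _ (g * ε), mul_smul _ h, smul_inv_smul, ← ep']
          exact h2
      exact ⟨(hfin.image _).subset sub,
        (Set.ncard_le_ncard sub (hfin.image _)).trans (Set.ncard_image_le hfin)⟩
  · intro c
    refine ⟨c, ?_⟩
    have h1 := hA.dist_zero c
    have h2 := hA.add_le 0 c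
    rw [zpow_natCast, Int.natAbs_natCast] at h1
    rw [zero_add] at h2
    omega

end SpinQuot
end

/-- **Corollary 1.3 (Clay–Mangahas).**  Let `P` be a projection complex which is
`δ₀`-hyperbolic with its path metric and let `G` be a group with a non-elementary WPD
action on `P`.  There is a constant `L_WPD(P, G)` such that for every equivariant
`L`-spinning family `{R_v}` with `L ≥ L_WPD(P, G)`, the quotient group `G/⟨R_v⟩` is
acylindrically hyperbolic. -/
theorem acylindrically_hyperbolic_quotient {Y : Type u} {G : Type*} [Group G]
    [MulAction G Y] (pc : ProjComplex Y) (hact : PCAction pc G) (δ₀ : ℝ)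
    (hP : GraphDeltaHyperbolic pc.graph δ₀)
    (hne : ActNonelementaryWPD pc.graph (fun (g : G) (x : Y) => g • x)) :
    ∃ LWPD : ℝ, ∀ (L : ℝ) (R : Y → Subgroup G), LWPD ≤ L →
      IsEquivSpinningFamily pc R L →
      IsAcylindricallyHyperbolic.{u} (G ⧸ spinSubgroup R) := by
  obtain ⟨LWPD, hL⟩ := SpinQuot.exists_wpd_quotient pc hact δ₀ hP hne
  refine ⟨LWPD, fun L R hLL hR => ?_⟩
  obtain ⟨Q, _, d, δ, f, t, x, hd, hw⟩ := hL L R hLL hR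
  obtain ⟨V, _, σ, c, h⟩ := hd.exists_acylData hw
  exact ⟨SpinQuot.not_virtuallyCyclic hd hw, h.exists_space⟩
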